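/- Soft edge universality for products of Ginibre matrices: Fix an integer M ≥ 1 and integers ν_1, …, ν_M ≥ 0, and set x* = (M+1)^{M+1}/M^M and c2 = (M+1)^{M+2/3}/(2^{1/3}·M^{M−1}). Then, as n → ∞, the rescaled kernel e^{−2^{−1/3}·(M+1)^{2/3}·(ξ−η)·n^{1/3}} · n^{M−2/3} · c2 · K_n( n^M·(x* + c2·ξ·n^{−2/3}), n^M·(x* + c2·η·n^{−2/3}) ) converges to the Airy kernel K_Ai(ξ, η), uniformly for (ξ, η) in any compact subset of ℝ². -/

import Mathlib

open Complex Real Set Filter MeasureTheory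

/-- The point on the vertical contour `𝒞`: `s = -1/2 + iσ`. -/
noncomputable def sC (σ : ℝ) : ℂ := -(1/2) + σ * Complex.I

/-- The point on the circular contour `Σ` (center `(n-1)/2`, radius `n/2 - 1/8`). -/
noncomputable def tC (n : ℕ) (θ : ℝ) : ℂ :=
  ((n : ℂ) - 1) / 2 + ((n : ℂ) / 2 - 1/8) * Complex.exp (θ * Complex.I)

/-- The integrand of the double contour integral defining the kernel. -/
noncomputable def integrand (M : ℕ) (ν : ℕ → ℕ) (n : ℕ) (x y : ℝ) (s t : ℂ) : ℂ :=
  (∏ j ∈ Finset.range (M + 1),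
      Complex.Gamma (s + (ν j : ℂ) + 1) / Complex.Gamma (t + (ν j : ℂ) + 1)) *
    (Complex.Gamma (t - (n : ℂ) + 1) / Complex.Gamma (s - (n : ℂ) + 1)) *
    Complex.exp (t * Real.log x) * Complex.exp (-(s + 1) * Real.log y) / (s - t)

/-- The correlation kernel `K_n(x,y)` for products of `M` Ginibre matrices. -/
noncomputable def Kn (M : ℕ) (ν : ℕ → ℕ) (n : ℕ) (x y : ℝ) : ℂ :=
  (1 / (2 * (Real.pi : ℂ) * Complex.I) ^ 2) *
    ∫ σ : ℝ, Complex.I *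
      ∫ θ in (0 : ℝ)..(2 * Real.pi),
        (((n : ℂ) / 2 - 1/8) * Complex.I * Complex.exp (θ * Complex.I)) *
          integrand M ν n x y (sC σ) (tC n θ)

/-- Parametrization of the right Airy contour `γ_R = {1 + |r| e^{i sgn(r) π/3}}`,
traversed with increasing imaginary part. -/
noncomputable def muR (r : ℝ) : ℂ :=
  1 + ((|r| : ℝ) : ℂ) * Complex.exp (((Real.sign r * (Real.pi / 3) : ℝ) : ℂ) * Complex.I)

/-- Derivative of the parametrization `muR`. -/
noncomputable def dmuR (r : ℝ) : ℂ :=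
  (Real.sign r : ℂ) * Complex.exp (((Real.sign r * (Real.pi / 3) : ℝ) : ℂ) * Complex.I)

/-- Parametrization of the left Airy contour `γ_L = {-1 - |r| e^{-i sgn(r) π/3}}`,
traversed with increasing imaginary part. -/
noncomputable def lamL (r : ℝ) : ℂ :=
  -1 - ((|r| : ℝ) : ℂ) * Complex.exp ((-(Real.sign r * (Real.pi / 3)) : ℝ) * Complex.I)

/-- Derivative of the parametrization `lamL`. -/
noncomputable def dlamL (r : ℝ) : ℂ :=
  -(Real.sign r : ℂ) * Complex.exp ((-(Real.sign r * (Real.pi / 3)) : ℝ) * Complex.I)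

/-- The Airy kernel via its double contour integral representation. -/
noncomputable def KAi (ξ η : ℝ) : ℂ :=
  (1 / (2 * (Real.pi : ℂ) * Complex.I) ^ 2) *
    ∫ r : ℝ, dmuR r *
      ∫ q : ℝ, dlamL q *
        (Complex.exp (muR r ^ 3 / 3 - (ξ : ℂ) * muR r - lamL q ^ 3 / 3 + (η : ℂ) * lamL q) /
          (muR r - lamL q))

open scoped Topology

/-- The exponent `(z - 1/2) log z - z` in Stirling's formula. -/
noncomputable def stirlingExponent (z : ℂ) : ℂ := (z - 1 / 2) * Complex.log z - z

/-- The defect of the Stirling exponent with respect to the recursion `Γ(z + 1) = z Γ(z)`. -/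
noncomputable def stirlingDefect (z : ℂ) : ℂ :=
  stirlingExponent (z + 1) - stirlingExponent z - Complex.log z

theorem log_add_one_of_im_nonneg {z : ℂ} (hi : 0 ≤ z.im) (hz : 2 ≤ ‖z‖) :
    Complex.log (z + 1) = Complex.log z + Complex.log (1 + z⁻¹) := by
  have hz0 : z ≠ 0 := by
    rintro rfl
    norm_num at hz
  have hinv : ‖z⁻¹‖ ≤ 1 / 2 := by
    rw [norm_inv, one_div]
    exact inv_anti₀ (by norm_num) hz
  have hre : 0 < (1 + z⁻¹).re := by
    have := (abs_le.mp (Complex.abs_re_le_norm z⁻¹)).1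
    simp only [Complex.add_re, Complex.one_re]
    linarith
  have hne : 1 + z⁻¹ ≠ 0 := by
    intro h
    rw [h] at hre
    simp at hre
  have him : (1 + z⁻¹).im ≤ 0 := by
    simp only [Complex.add_im, Complex.one_im, Complex.inv_im, zero_add]
    exact div_nonpos_of_nonpos_of_nonneg (by linarith) (Complex.normSq_nonneg _)
  have harg1 : -(Real.pi / 2) < Complex.arg (1 + z⁻¹) :=
    (Complex.neg_pi_div_two_lt_arg_iff).2 (Or.inl hre)
  have harg2 : Complex.arg (1 + z⁻¹) ≤ 0 := by
    rcases him.lt_or_eq with h | h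
    · exact (Complex.arg_neg_iff.2 h).le
    · exact (Complex.arg_eq_zero_iff.2 ⟨hre.le, h⟩).le
  have harg3 : 0 ≤ Complex.arg z := Complex.arg_nonneg_iff.2 hi
  have harg4 := Complex.arg_le_pi z
  rw [← (Complex.log_mul_eq_add_log_iff hz0 hne).2 ⟨by linarith [Real.pi_pos], by linarith⟩]
  congr 1
  field_simp

theorem norm_stirlingDefect_le {z : ℂ} (hi : 0 ≤ z.im) (hz : 2 ≤ ‖z‖) :
    ‖stirlingDefect z‖ ≤ 2 / ‖z‖ ^ 2 := by
  have hz0 : z ≠ 0 := by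
    rintro rfl
    norm_num at hz
  set u : ℂ := z⁻¹ with hu
  have hu0 : u ≠ 0 := inv_ne_zero hz0
  have hinv : ‖u‖ ≤ 1 / 2 := by
    rw [hu, norm_inv, one_div]
    exact inv_anti₀ (by norm_num) hz
  have hzu : z = u⁻¹ := by rw [hu, inv_inv]
  have hT := Complex.norm_log_sub_logTaylor_le 2 (z := u) (by linarith)
  have hTe : Complex.logTaylor 3 u = u - u ^ 2 / 2 := by
    rw [Complex.logTaylor_succ, Complex.logTaylor_succ, Complex.logTaylor_succ,
      Complex.logTaylor_zero]
    norm_num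
    ring
  set R : ℂ := Complex.log (1 + u) - Complex.logTaylor 3 u with hR
  have hR' : ‖R‖ ≤ ‖u‖ ^ 3 := by
    refine hT.trans ?_
    have h1 : (1 - ‖u‖)⁻¹ ≤ 2 := by
      rw [inv_le_comm₀ (by linarith) (by norm_num)]
      linarith
    have : (1 - ‖u‖)⁻¹ / 3 ≤ 1 := by linarith
    calc ‖u‖ ^ (2 + 1) * (1 - ‖u‖)⁻¹ / ((2 : ℕ) + 1)
        = ‖u‖ ^ 3 * ((1 - ‖u‖)⁻¹ / 3) := by push_cast; ring
      _ ≤ ‖u‖ ^ 3 * 1 := by gcongr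
      _ = _ := mul_one _
  have key : stirlingDefect z = -u ^ 2 / 4 + R * (u⁻¹ + 1 / 2) := by
    have hl : Complex.log (1 + u) = R + (u - u ^ 2 / 2) := by rw [hR, hTe]; ring
    simp only [stirlingDefect, stirlingExponent]
    rw [log_add_one_of_im_nonneg hi hz, ← hu, hl, hzu]
    field_simp
    ring
  rw [key]
  have hnu : ‖z‖ = ‖u‖⁻¹ := by rw [hzu, norm_inv]
  have hupos : 0 < ‖u‖ := norm_pos_iff.2 hu0
  calc ‖-u ^ 2 / 4 + R * (u⁻¹ + 1 / 2)‖ ≤ ‖-u ^ 2 / 4‖ + ‖R * (u⁻¹ + 1 / 2)‖ := norm_add_le _ _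
    _ ≤ ‖u‖ ^ 2 / 4 + ‖u‖ ^ 3 * (‖u‖⁻¹ + 1 / 2) := by
        gcongr
        · simp
        · rw [norm_mul]
          gcongr
          refine (norm_add_le _ _).trans ?_
          simp
    _ = ‖u‖ ^ 2 * (5 / 4 + ‖u‖ / 2) := by
        field_simp
        ring
    _ ≤ ‖u‖ ^ 2 * 2 := by gcongr; linarith
    _ = 2 / ‖z‖ ^ 2 := by rw [hnu]; field_simp

theorem prod_add_natCast_eq_exp {z : ℂ} (hz : ∀ k : ℕ, z + k ≠ 0) (n : ℕ) :
    ∏ k ∈ Finset.range n, (z + k) =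
      Complex.exp (stirlingExponent (z + n) - stirlingExponent z -
        ∑ k ∈ Finset.range n, stirlingDefect (z + k)) := by
  induction n with
  | zero => simp
  | succ n ih =>
    rw [Finset.prod_range_succ, ih, Finset.sum_range_succ]
    nth_rewrite 2 [← Complex.exp_log (hz n)]
    rw [← Complex.exp_add]
    congr 1
    simp only [stirlingDefect]
    push_cast
    ring_nf

theorem tendsto_stirlingExponent_natCast_add (a : ℂ) :
    Tendsto (fun n : ℕ => stirlingExponent (n + a) -
      ((n + a - 1 / 2) * Real.log n - n)) atTop (𝓝 0) := by
  have h0 : Tendsto (fun n : ℕ => a / (n : ℂ)) atTop (𝓝 0) := by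
    simpa using tendsto_const_div_atTop_nhds_zero_nat a
  have hl : Tendsto (fun n : ℕ => Complex.log (1 + a / n)) atTop (𝓝 0) := by
    have h1 : Tendsto (fun n : ℕ => 1 + a / (n : ℂ)) atTop (𝓝 1) := by
      simpa using h0.const_add 1
    simpa [Function.comp_def] using
      (continuousAt_clog (by simp [Complex.one_mem_slitPlane])).tendsto.comp h1
  have hnl : Tendsto (fun n : ℕ => (n : ℂ) * Complex.log (1 + a / n)) atTop (𝓝 a) := by
    apply Complex.tendsto_nat_mul_log_one_add_of_tendsto
    refine tendsto_const_nhds.congr' ?_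
    filter_upwards [eventually_gt_atTop 0] with n hn
    have : (n : ℂ) ≠ 0 := by exact_mod_cast hn.ne'
    field_simp
  have hs : Tendsto (fun n : ℕ => (n : ℂ) * Complex.log (1 + a / n) +
      (a - 1 / 2) * Complex.log (1 + a / n) - a) atTop (𝓝 0) := by
    simpa using (hnl.add (hl.const_mul (a - 1 / 2))).sub_const a
  refine hs.congr' ?_
  have hne : ∀ᶠ n : ℕ in atTop, 1 + a / (n : ℂ) ≠ 0 := by
    have h1 : Tendsto (fun n : ℕ => 1 + a / (n : ℂ)) atTop (𝓝 1) := by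
      simpa using h0.const_add 1
    exact h1.eventually_ne one_ne_zero
  filter_upwards [hne, eventually_gt_atTop 0] with n hn hn0
  have hnr : (0 : ℝ) < n := by exact_mod_cast hn0
  have hnc : (n : ℂ) ≠ 0 := by exact_mod_cast hn0.ne'
  have : Complex.log (n + a) = Real.log n + Complex.log (1 + a / n) := by
    rw [← Complex.log_ofReal_mul hnr hn]
    congr 1
    push_cast
    field_simp
  simp only [stirlingExponent, this]
  ring

theorem Gamma_eq_exp_stirling {z : ℂ} (hz : ∀ k : ℕ, z + k ≠ 0)
    (hs : Summable fun k : ℕ => stirlingDefect (z + k))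
    (h2 : Summable fun k : ℕ => stirlingDefect (2 + k)) :
    Complex.Gamma z =
      Complex.exp (-stirlingExponent 2 - ∑' k : ℕ, stirlingDefect (2 + k)) *
        Complex.exp (stirlingExponent z + ∑' k : ℕ, stirlingDefect (z + k)) := by
  have hG2 : Complex.Gamma 2 = 1 := by simp
  have hlim : Tendsto (fun n : ℕ => Complex.GammaSeq z n / Complex.GammaSeq 2 n) atTop
      (𝓝 (Complex.Gamma z)) := by
    have := (Complex.GammaSeq_tendsto_Gamma z).div (Complex.GammaSeq_tendsto_Gamma 2)
      (by rw [hG2]; exact one_ne_zero)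
    rwa [hG2, div_one] at this
  refine tendsto_nhds_unique hlim ?_
  have h2k : ∀ k : ℕ, (2 : ℂ) + k ≠ 0 := fun k => by
    have : ((2 + k : ℕ) : ℂ) ≠ 0 := Nat.cast_ne_zero.2 (by omega)
    push_cast at this
    exact this
  have hA := tendsto_stirlingExponent_natCast_add 3
  have hB := tendsto_stirlingExponent_natCast_add (z + 1)
  have hS := (hs.hasSum.tendsto_sum_nat.comp (tendsto_add_atTop_nat 1))
  have hS2 := (h2.hasSum.tendsto_sum_nat.comp (tendsto_add_atTop_nat 1))
  have hE := (((hA.sub hB).add (hS.sub hS2)).const_add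
    (stirlingExponent z - stirlingExponent 2)).cexp
  rw [← Complex.exp_add]
  have e1 : (stirlingExponent z - stirlingExponent 2 +
      (0 - 0 + (∑' k : ℕ, stirlingDefect (z + k) - ∑' k : ℕ, stirlingDefect (2 + k)))) =
      (-stirlingExponent 2 - ∑' k : ℕ, stirlingDefect (2 + k)) +
        (stirlingExponent z + ∑' k : ℕ, stirlingDefect (z + k)) := by ring
  rw [← e1]
  refine hE.congr' ?_
  filter_upwards [eventually_gt_atTop 0] with n hn
  have hnc : (n : ℂ) ≠ 0 := by exact_mod_cast hn.ne'
  have hfac : (n.factorial : ℂ) ≠ 0 := Nat.cast_ne_zero.2 n.factorial_ne_zero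
  have hp : ∀ w : ℂ, (n : ℂ) ^ w = Complex.exp (w * Real.log n) := fun w => by
    rw [Complex.cpow_def_of_ne_zero hnc, mul_comm]
    norm_num
  simp only [Complex.GammaSeq, Function.comp]
  rw [prod_add_natCast_eq_exp hz, prod_add_natCast_eq_exp h2k, hp, hp]
  have : ∀ a b c d f : ℂ, f ≠ 0 → Complex.exp a * f / Complex.exp b /
      (Complex.exp c * f / Complex.exp d)
      = Complex.exp (a - b - c + d) := by
    intro a b c d f hf
    rw [Complex.exp_add, Complex.exp_sub, Complex.exp_sub]
    field_simp [Complex.exp_ne_zero]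
  rw [this _ _ _ _ _ hfac]
  congr 1
  push_cast
  have e2 : (2 : ℂ) + (n + 1) = n + 3 := by ring
  have e3 : z + ((n : ℂ) + 1) = n + (z + 1) := by ring
  rw [e2, e3]
  ring

theorem sum_inv_sq_add_sq_le {a : ℝ} (ha : 2 ≤ a) (n : ℕ) :
    ∑ k ∈ Finset.range n, 1 / (a ^ 2 + (k : ℝ) ^ 2) ≤ 4 / a := by
  have h : ∀ n : ℕ, ∑ k ∈ Finset.range n, 1 / (a ^ 2 + (k : ℝ) ^ 2) ≤
      2 / (a - 1) - 2 / (a - 1 + n) := by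
    intro n
    induction n with
    | zero => simp
    | succ n ih =>
      rw [Finset.sum_range_succ]
      have hn : (0 : ℝ) ≤ n := n.cast_nonneg
      have key : 1 / (a ^ 2 + (n : ℝ) ^ 2) ≤ 2 / (a - 1 + n) - 2 / (a - 1 + (n + 1 : ℕ)) := by
        push_cast
        rw [div_sub_div _ _ (by linarith) (by linarith), div_le_div_iff₀ (by positivity)
          (mul_pos (by linarith) (by linarith))]
        nlinarith [sq_nonneg (a - n)]
      linarith
  refine (h n).trans ?_
  have : 0 ≤ 2 / (a - 1 + n) := by
    have hn : (0 : ℝ) ≤ n := n.cast_nonneg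
    exact div_nonneg (by norm_num) (by linarith)
  have h2 : 2 / (a - 1) ≤ 4 / a := by
    rw [div_le_div_iff₀ (by linarith) (by linarith)]
    linarith
  linarith

theorem norm_add_natCast_sq_ge {z : ℂ} (hre : -(1 / 2) ≤ z.re) (hz : 2 ≤ ‖z‖) (k : ℕ) :
    (‖z‖ ^ 2 + (k : ℝ) ^ 2) / 2 ≤ ‖z + k‖ ^ 2 := by
  have h1 : ‖z + k‖ ^ 2 = ‖z‖ ^ 2 + 2 * k * z.re + (k : ℝ) ^ 2 := by
    rw [← Complex.normSq_eq_norm_sq, ← Complex.normSq_eq_norm_sq, Complex.normSq_apply,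
      Complex.normSq_apply]
    simp
    ring
  have hk : (0 : ℝ) ≤ k := k.cast_nonneg
  rw [h1]
  nlinarith [sq_nonneg ((k : ℝ) - 1)]

theorem stirlingDefect_bounds {z : ℂ} (hi : 0 ≤ z.im) (hre : -(1 / 2) ≤ z.re) (hz : 3 ≤ ‖z‖) :
    (∀ k : ℕ, z + k ≠ 0) ∧ (Summable fun k : ℕ => stirlingDefect (z + k)) ∧
      ‖∑' k : ℕ, stirlingDefect (z + k)‖ ≤ 16 / ‖z‖ := by
  have hz2 : 2 ≤ ‖z‖ := by linarith
  have hk2 : ∀ k : ℕ, 2 ≤ ‖z + k‖ := by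
    intro k
    have := norm_add_natCast_sq_ge hre hz2 k
    have h2 : (2 : ℝ) ^ 2 ≤ ‖z + k‖ ^ 2 := by nlinarith [sq_nonneg (k : ℝ)]
    exact (sq_le_sq₀ (by norm_num) (norm_nonneg _)).1 h2
  have hb : ∀ k : ℕ, ‖stirlingDefect (z + k)‖ ≤ 4 * (1 / (‖z‖ ^ 2 + (k : ℝ) ^ 2)) := by
    intro k
    refine (norm_stirlingDefect_le (by simpa using hi) (hk2 k)).trans ?_
    have := norm_add_natCast_sq_ge hre hz2 k
    calc 2 / ‖z + k‖ ^ 2 ≤ 2 / ((‖z‖ ^ 2 + (k : ℝ) ^ 2) / 2) := by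
          gcongr
      _ = _ := by field_simp; ring
  have hsum : Summable fun k : ℕ => 1 / (‖z‖ ^ 2 + (k : ℝ) ^ 2) :=
    summable_of_sum_range_le (fun k => by positivity) (sum_inv_sq_add_sq_le hz2)
  refine ⟨fun k h => ?_, Summable.of_norm_bounded (hsum.mul_left 4) hb, ?_⟩
  · have := hk2 k
    rw [h] at this
    norm_num at this
  · refine (tsum_of_norm_bounded (hsum.mul_left 4).hasSum hb).trans ?_
    rw [tsum_mul_left]
    have := hsum.tsum_le_of_sum_range_le (sum_inv_sq_add_sq_le hz2)
    calc 4 * ∑' k : ℕ, 1 / (‖z‖ ^ 2 + (k : ℝ) ^ 2) ≤ 4 * (4 / ‖z‖) := by gcongr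
      _ = _ := by ring

/-- Stirling's formula with a quantitative error term in the closed upper half of the half plane
`Re z ≥ -1/2`. -/
theorem exists_Gamma_stirling :
    ∃ C₀ : ℂ, C₀ ≠ 0 ∧ ∀ z : ℂ, 0 ≤ z.im → -(1 / 2) ≤ z.re → 3 ≤ ‖z‖ →
      ∃ e : ℂ, ‖e‖ ≤ 16 / ‖z‖ ∧ Complex.Gamma z = C₀ * Complex.exp (stirlingExponent z + e) := by
  refine ⟨_, Complex.exp_ne_zero
    (-stirlingExponent 2 - ∑' k : ℕ, stirlingDefect (2 + k)), fun z hi hre hz => ?_⟩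
  obtain ⟨h0, hs, hb⟩ := stirlingDefect_bounds hi hre hz
  obtain ⟨-, hs3, -⟩ := stirlingDefect_bounds (z := 3) (by simp) (by norm_num) (by simp)
  refine ⟨_, hb, Gamma_eq_exp_stirling h0 hs ?_⟩
  rw [← summable_nat_add_iff 1]
  refine hs3.congr fun k => ?_
  push_cast
  ring_nf

theorem norm_sum_stirlingDefect_le {z : ℂ} (hi : 0 ≤ z.im) {n : ℕ} {B : ℝ} (hB : 2 ≤ B)
    (hz : ∀ k : ℕ, k < n → B ≤ ‖z + k‖) :
    ‖∑ k ∈ Finset.range n, stirlingDefect (z + k)‖ ≤ n * (2 / B ^ 2) := by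
  refine (norm_sum_le _ _).trans ?_
  have : ∀ k ∈ Finset.range n, ‖stirlingDefect (z + k)‖ ≤ 2 / B ^ 2 := by
    intro k hk
    have h := hz k (Finset.mem_range.1 hk)
    refine (norm_stirlingDefect_le (by simpa using hi) (hB.trans h)).trans ?_
    gcongr
  refine (Finset.sum_le_sum this).trans ?_
  simp

/-- The phase function of the double contour integral, centred at its double critical point. -/
noncomputable def phase (p : ℝ) (w : ℂ) : ℂ :=
  (1 + p * w) * Complex.log (1 + p * w) / p ^ 2 - (1 + w) * Complex.log (1 + w) - (1 / p - 1) * w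

/-- The derivative of `phase`. -/
noncomputable def phaseDeriv (p : ℝ) (w : ℂ) : ℂ :=
  Complex.log (1 + p * w) / p - Complex.log (1 + w)

theorem hasDerivAt_phase {p : ℝ} (hp : p ≠ 0) {w : ℂ} (h1 : 1 + p * w ∈ Complex.slitPlane)
    (h2 : 1 + w ∈ Complex.slitPlane) : HasDerivAt (phase p) (phaseDeriv p w) w := by
  have hpc : (p : ℂ) ≠ 0 := by exact_mod_cast hp
  have n1 := Complex.slitPlane_ne_zero h1
  have n2 := Complex.slitPlane_ne_zero h2
  have a1 : HasDerivAt (fun w : ℂ => 1 + (p : ℂ) * w) p w := by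
    simpa using ((hasDerivAt_id w).const_mul (p : ℂ)).const_add 1
  have a2 : HasDerivAt (fun w : ℂ => 1 + w) 1 w := by
    simpa using (hasDerivAt_id w).const_add (1 : ℂ)
  have := (((a1.mul (a1.clog h1)).div_const ((p : ℂ) ^ 2)).sub (a2.mul (a2.clog h2))).sub
    ((hasDerivAt_id w).const_mul (1 / (p : ℂ) - 1))
  refine this.congr_deriv ?_
  simp only [phaseDeriv]
  field_simp
  ring

theorem norm_one_add_mul_log_sub_le {z : ℂ} (hz : ‖z‖ ≤ 1 / 2) :
    ‖(1 + z) * Complex.log (1 + z) - (z + z ^ 2 / 2 - z ^ 3 / 6)‖ ≤ 2 * ‖z‖ ^ 4 := by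
  have hT := Complex.norm_log_sub_logTaylor_le 3 (z := z) (by linarith)
  have hTe : Complex.logTaylor 4 z = z - z ^ 2 / 2 + z ^ 3 / 3 := by
    rw [Complex.logTaylor_succ, Complex.logTaylor_succ, Complex.logTaylor_succ,
      Complex.logTaylor_succ, Complex.logTaylor_zero]
    norm_num
    ring
  set R : ℂ := Complex.log (1 + z) - Complex.logTaylor 4 z with hR
  have hR' : ‖R‖ ≤ ‖z‖ ^ 4 * (1 / 2) := by
    refine hT.trans ?_
    have h1 : (1 - ‖z‖)⁻¹ ≤ 2 := by
      rw [inv_le_comm₀ (by linarith) (by norm_num)]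
      linarith
    have : (1 - ‖z‖)⁻¹ / 4 ≤ 1 / 2 := by linarith
    calc ‖z‖ ^ (3 + 1) * (1 - ‖z‖)⁻¹ / ((3 : ℕ) + 1)
        = ‖z‖ ^ 4 * ((1 - ‖z‖)⁻¹ / 4) := by push_cast; ring
      _ ≤ ‖z‖ ^ 4 * (1 / 2) := by gcongr
  have hl : Complex.log (1 + z) = R + (z - z ^ 2 / 2 + z ^ 3 / 3) := by rw [hR, hTe]; ring
  have key : (1 + z) * Complex.log (1 + z) - (z + z ^ 2 / 2 - z ^ 3 / 6) =
      z ^ 4 / 3 + (1 + z) * R := by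
    rw [hl]
    ring
  rw [key]
  have h1z : ‖1 + z‖ ≤ 3 / 2 := (norm_add_le _ _).trans (by simp; linarith)
  calc ‖z ^ 4 / 3 + (1 + z) * R‖ ≤ ‖z ^ 4 / 3‖ + ‖(1 + z) * R‖ := norm_add_le _ _
    _ ≤ ‖z‖ ^ 4 / 3 + 3 / 2 * (‖z‖ ^ 4 * (1 / 2)) := by
        gcongr
        · simp
        · rw [norm_mul]
          gcongr
    _ ≤ 2 * ‖z‖ ^ 4 := by nlinarith [pow_nonneg (norm_nonneg z) 4]

theorem norm_phase_sub_cubic_le {p : ℝ} (hp : 0 < p) (hp1 : p ≤ 1 / 2) {w : ℂ}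
    (hw : ‖w‖ ≤ 1 / 2) : ‖phase p w - (1 - p) / 6 * w ^ 3‖ ≤ 4 * ‖w‖ ^ 4 := by
  have hpc : (p : ℂ) ≠ 0 := by exact_mod_cast hp.ne'
  have hpw : ‖(p : ℂ) * w‖ = p * ‖w‖ := by
    rw [norm_mul, Complex.norm_real, Real.norm_of_nonneg hp.le]
  have h1 := norm_one_add_mul_log_sub_le (z := (p : ℂ) * w) (by rw [hpw]; nlinarith [norm_nonneg w])
  have h2 := norm_one_add_mul_log_sub_le hw
  have key : phase p w - (1 - p) / 6 * w ^ 3 =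
      ((1 + p * w) * Complex.log (1 + p * w) - (p * w + (p * w) ^ 2 / 2 - (p * w) ^ 3 / 6)) / p ^ 2
      - ((1 + w) * Complex.log (1 + w) - (w + w ^ 2 / 2 - w ^ 3 / 6)) := by
    simp only [phase]
    field_simp
    ring
  rw [key]
  refine (norm_sub_le _ _).trans ?_
  rw [norm_div, norm_pow, Complex.norm_real, Real.norm_of_nonneg hp.le]
  have h3 : ‖(1 + p * w) * Complex.log (1 + p * w) - (p * w + (p * w) ^ 2 / 2 - (p * w) ^ 3 / 6)‖
      / p ^ 2 ≤ 2 * ‖w‖ ^ 4 := by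
    rw [div_le_iff₀ (by positivity)]
    refine h1.trans ?_
    rw [hpw]
    have : p ^ 2 ≤ 1 := by nlinarith
    have h4 : 0 ≤ ‖w‖ ^ 4 * p ^ 2 := by positivity
    nlinarith
  linarith

theorem phase_conj {p : ℝ} {w : ℂ} (h1 : 1 + p * w ∈ Complex.slitPlane)
    (h2 : 1 + w ∈ Complex.slitPlane) :
    phase p ((starRingEnd ℂ) w) = (starRingEnd ℂ) (phase p w) := by
  have e1 : 1 + (p : ℂ) * (starRingEnd ℂ) w = (starRingEnd ℂ) (1 + p * w) := by simp
  have e2 : 1 + (starRingEnd ℂ) w = (starRingEnd ℂ) (1 + w) := by simp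
  simp only [phase]
  rw [e1, e2, Complex.log_conj _ (Complex.slitPlane_arg_ne_pi h1),
    Complex.log_conj _ (Complex.slitPlane_arg_ne_pi h2)]
  simp

/-- Lower bounds for `phaseDeriv` along rays through the critical point. -/
theorem re_mul_phaseDeriv_sub_ge {p : ℝ} (hp : 0 < p) (hp1 : p ≤ 1 / 2) {w d : ℂ} {m u₀ : ℝ}
    (hu0 : 0 ≤ u₀) (hu1 : u₀ ≤ 1)
    (hre : ∀ u ∈ Icc (0 : ℝ) 1, 0 < 1 + u * w.re)
    (h : ∀ u ∈ Icc u₀ 1, m ≤ (d * w ^ 2 / ((1 + (p * u : ℝ) * w) * (1 + (u : ℝ) * w))).re) :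
    (1 - p) / 2 * (1 - u₀ ^ 2) * m ≤ (d * phaseDeriv p w).re - (d * phaseDeriv p (u₀ * w)).re := by
  have hpc : (p : ℂ) ≠ 0 := by exact_mod_cast hp.ne'
  have s2 : ∀ u ∈ Icc (0 : ℝ) 1, 1 + (u : ℂ) * w ∈ Complex.slitPlane := by
    intro u hu
    left
    simpa using hre u hu
  have s1 : ∀ u ∈ Icc (0 : ℝ) 1, 1 + (p : ℂ) * (u * w) ∈ Complex.slitPlane := by
    intro u hu
    have := s2 (p * u) ⟨mul_nonneg hp.le hu.1, by nlinarith [hu.1, hu.2]⟩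
    push_cast at this
    rwa [mul_assoc] at this
  have hd : ∀ u ∈ Icc u₀ 1, HasDerivAt (fun u : ℝ => (d * phaseDeriv p (u * w)).re
      - (1 - p) / 2 * m * u ^ 2)
      ((1 - p) * u * ((d * w ^ 2 / ((1 + (p * u : ℝ) * w) * (1 + (u : ℝ) * w))).re - m)) u := by
    intro u hu
    have hu' : u ∈ Icc (0 : ℝ) 1 := ⟨hu0.trans hu.1, hu.2⟩
    have n1 := Complex.slitPlane_ne_zero (s1 u hu')
    have n2 := Complex.slitPlane_ne_zero (s2 u hu')
    have b0 : HasDerivAt (fun u : ℝ => (u : ℂ) * w) w u := by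
      simpa using (Complex.ofRealCLM.hasDerivAt (x := u)).mul_const w
    have b1 : HasDerivAt (fun u : ℝ => 1 + (p : ℂ) * (u * w)) (p * w) u :=
      (b0.const_mul (p : ℂ)).const_add 1
    have b2 : HasDerivAt (fun u : ℝ => 1 + (u : ℂ) * w) w u := b0.const_add 1
    have b3 := ((((b1.clog_real (s1 u hu')).div_const (p : ℂ)).sub
      (b2.clog_real (s2 u hu'))).const_mul d)
    have b4 := (Complex.reCLM.hasFDerivAt (x := d * phaseDeriv p (u * w))).comp_hasDerivAt u b3
    have b5 := b4.sub ((hasDerivAt_pow 2 u).const_mul ((1 - p) / 2 * m))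
    refine b5.congr_deriv ?_
    have e : d * (((p : ℂ) * w) / (1 + p * (u * w)) / p - w / (1 + u * w)) =
        ((1 - p) * u : ℝ) * (d * w ^ 2 / ((1 + (p * u : ℝ) * w) * (1 + (u : ℝ) * w))) := by
      have n1' : 1 + (p : ℂ) * u * w ≠ 0 := by rwa [mul_assoc]
      push_cast
      rw [← mul_assoc (p : ℂ) u w]
      generalize hA : 1 + (p : ℂ) * u * w = A at n1' ⊢
      generalize hB : 1 + (u : ℂ) * w = B at n2 ⊢
      have hAB : B - A = (1 - p) * u * w := by rw [← hA, ← hB]; ring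
      have e2 : (1 - (p : ℂ)) * u * (d * w ^ 2 / (A * B)) = (B - A) * (d * w / (A * B)) := by
        rw [hAB]; ring
      rw [e2]
      field_simp
    rw [e]
    simp only [Complex.reCLM_apply, Complex.re_ofReal_mul]
    push_cast
    ring
  have hmono : MonotoneOn (fun u : ℝ => (d * phaseDeriv p (u * w)).re
      - (1 - p) / 2 * m * u ^ 2) (Icc u₀ 1) := by
    apply monotoneOn_of_deriv_nonneg (convex_Icc _ _)
    · exact fun u hu => (hd u hu).continuousAt.continuousWithinAt
    · intro u hu
      rw [interior_Icc] at hu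
      exact (hd u (Ioo_subset_Icc_self hu)).differentiableAt.differentiableWithinAt
    · intro u hu
      rw [interior_Icc] at hu
      have hu' := Ioo_subset_Icc_self hu
      rw [(hd u hu').deriv]
      have := h u hu'
      have hu'' : 0 ≤ u := hu0.trans hu'.1
      refine mul_nonneg (mul_nonneg (by linarith) hu'') (by linarith)
  have := hmono ⟨le_rfl, hu1⟩ ⟨hu1, le_rfl⟩ hu1
  simp only [Complex.ofReal_one, one_mul, one_pow] at this
  nlinarith

theorem phaseDeriv_zero (p : ℝ) : phaseDeriv p 0 = 0 := by simp [phaseDeriv]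

theorem re_div_ge {X Y : ℂ} {c C L U : ℝ} (hc : 0 ≤ c) (hC : 0 ≤ C) (hL : 0 < L)
    (hXY : c - C ≤ X.re * Y.re + X.im * Y.im) (hLY : L ≤ Complex.normSq Y)
    (hYU : Complex.normSq Y ≤ U) : c / U - C / L ≤ (X / Y).re := by
  have hY : 0 < Complex.normSq Y := hL.trans_le hLY
  have h1 : c / U ≤ c / Complex.normSq Y := by gcongr
  have h2 : C / Complex.normSq Y ≤ C / L := by gcongr
  have h3 : (c - C) / Complex.normSq Y ≤ (X / Y).re := by
    rw [Complex.div_re, ← add_div]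
    gcongr
  rw [sub_div] at h3
  linarith

/-- The direction `exp (iπ/3)`. -/
noncomputable def rayDir : ℂ := 1 / 2 + (√3 / 2 : ℝ) * Complex.I

theorem rayDir_re : rayDir.re = 1 / 2 := by simp [rayDir]

theorem rayDir_im : rayDir.im = √3 / 2 := by simp [rayDir]

theorem normSq_one_add_real_mul (a : ℝ) (w : ℂ) :
    Complex.normSq (1 + a * w) = (1 + a * w.re) ^ 2 + (a * w.im) ^ 2 := by
  rw [Complex.normSq_apply]
  simp
  ring

theorem ray_cubic_lower_bound {e r α β : ℝ} (he : 0 ≤ e) (he1 : e ≤ 1 / 100) (hr : 0 ≤ r)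
    (hr1 : r ≤ 9 / 10) (hα : 0 ≤ α) (hα1 : α ≤ 1 / 2) (_ : 0 ≤ β) (hβ1 : β ≤ 1) {σ : ℝ}
    (hσ : -(α + β) ≤ σ) (hσ' : σ ≤ α + β) :
    3 / 25 * r ^ 2 - 2 * e ^ 2 ≤ r ^ 2 + e * r - e ^ 2 / 2 + σ * (r ^ 3 - e ^ 3) / 2
      - α * β * (e ^ 2 + e * r + r ^ 2) ^ 2 / 2 := by
  have h1 : α * β ≤ 1 / 2 := by nlinarith
  have h2 : -(3 / 2) * (r ^ 3 + e ^ 3) ≤ σ * (r ^ 3 - e ^ 3) := by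
    have r3 : 0 ≤ r ^ 3 := by positivity
    have e3 : 0 ≤ e ^ 3 := by positivity
    nlinarith
  have h3 : α * β * (e ^ 2 + e * r + r ^ 2) ^ 2 ≤ 1 / 2 * (e ^ 2 + e * r + r ^ 2) ^ 2 := by
    gcongr
  have h4 : r ^ 3 ≤ 9 / 10 * r ^ 2 := by nlinarith [sq_nonneg r]
  have h5 : e ^ 3 ≤ 1 / 100 * e ^ 2 := by nlinarith [sq_nonneg e]
  have h6 : (e ^ 2 + e * r + r ^ 2) ^ 2 ≤ 81 / 100 * r ^ 2 + 2 * e * r + 3 * e ^ 2 := by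
    have i1 : r ^ 4 ≤ 81 / 100 * r ^ 2 := by nlinarith [sq_nonneg r]
    have i2 : r ^ 3 * e ≤ 81 / 100 * (e * r) := by nlinarith [mul_nonneg he hr]
    have r2 : r ^ 2 ≤ 81 / 100 := by nlinarith
    have e2 : 0 ≤ e ^ 2 := sq_nonneg e
    have i3 : e ^ 2 * r ^ 2 ≤ 81 / 100 * e ^ 2 := by nlinarith
    have er : e * r ≤ 1 / 100 := by nlinarith
    have i4 : e ^ 3 * r ≤ 1 / 100 * e ^ 2 := by nlinarith
    have e2' : e ^ 2 ≤ 1 / 100 := by nlinarith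
    have i5 : e ^ 4 ≤ 1 / 100 * e ^ 2 := by nlinarith
    nlinarith [mul_nonneg he hr, sq_nonneg e]
  nlinarith [mul_nonneg he hr, sq_nonneg e, sq_nonneg r]

theorem sqrt_three_pows : √3 ^ 2 = 3 ∧ √3 ^ 3 = 3 * √3 ∧ √3 ^ 4 = 9 ∧ √3 ^ 5 = 9 * √3 ∧
    √3 ^ 6 = 27 := by
  have h : √3 ^ 2 = 3 := Real.sq_sqrt (by norm_num)
  refine ⟨h, ?_, ?_, ?_, ?_⟩
  · rw [pow_succ, h]
  · rw [show 4 = 2 * 2 by rfl, pow_mul, h]; norm_num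
  · rw [show 5 = 2 * 2 + 1 by rfl, pow_succ, pow_mul, h]; norm_num
  · rw [show 6 = 2 * 3 by rfl, pow_mul, h]; norm_num

theorem re_rayDir_mul_phaseDeriv_le {p : ℝ} (hp : 0 < p) (hp1 : p ≤ 1 / 2) {e r : ℝ}
    (he : 0 ≤ e) (he1 : e ≤ 1 / 100) (hr : 0 ≤ r) (hr1 : r ≤ 9 / 10) :
    (rayDir * phaseDeriv p (e + r * rayDir)).re ≤ 12 * e ^ 2 - r ^ 2 / 800 := by
  set w : ℂ := e + r * rayDir with hw
  have hwre : w.re = e + r / 2 := by simp [hw, rayDir_re]; ring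
  have hwim : w.im = √3 / 2 * r := by simp [hw, rayDir_im]; ring
  obtain ⟨s2, s3, s4, s5, s6⟩ := sqrt_three_pows
  have hns : Complex.normSq w = e ^ 2 + e * r + r ^ 2 := by
    rw [Complex.normSq_apply, hwre, hwim]
    ring_nf
    rw [s2]
    ring
  have := re_mul_phaseDeriv_sub_ge hp hp1 (w := w) (d := -rayDir) (u₀ := 0)
    (m := 3 / 25 * r ^ 2 / 16 - 2 * e ^ 2 / 1) le_rfl zero_le_one
    (fun u hu => by rw [hwre]; nlinarith [hu.1, mul_nonneg hu.1 he, mul_nonneg hu.1 hr]) ?_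
  · rw [Complex.ofReal_zero, zero_mul, phaseDeriv_zero, mul_zero, Complex.zero_re, sub_zero,
      neg_mul, Complex.neg_re] at this
    nlinarith [sq_nonneg r, sq_nonneg e]
  · intro u hu
    have hα : 0 ≤ p * u := mul_nonneg hp.le hu.1
    have hα1 : p * u ≤ 1 / 2 := by nlinarith [hu.1, hu.2]
    have hbd : ∀ a : ℝ, 0 ≤ a → a ≤ 1 → 1 ≤ Complex.normSq (1 + a * w) ∧
        Complex.normSq (1 + a * w) ≤ 4 := by
      intro a ha ha1
      have e1 : Complex.normSq (1 + a * w) = 1 + 2 * a * w.re + a ^ 2 * Complex.normSq w := by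
        rw [normSq_one_add_real_mul, Complex.normSq_apply]
        ring
      rw [e1, hns, hwre]
      have h2 : a ^ 2 ≤ 1 := by nlinarith
      have h3 : 0 ≤ e ^ 2 + e * r + r ^ 2 := by positivity
      have h4 : e ^ 2 + e * r + r ^ 2 ≤ 4 / 5 + 3 / 100 := by nlinarith
      have h5 : a * (e + r / 2) ≤ 1 / 100 + 9 / 20 := by nlinarith
      constructor
      · have : 0 ≤ a * (e + r / 2) := by positivity
        have : 0 ≤ a ^ 2 * (e ^ 2 + e * r + r ^ 2) := by positivity
        linarith
      · have : a ^ 2 * (e ^ 2 + e * r + r ^ 2) ≤ 1 * (4 / 5 + 3 / 100) := by gcongr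
        linarith
    obtain ⟨a1, a2⟩ := hbd (p * u) hα (by linarith)
    obtain ⟨b1, b2⟩ := hbd u hu.1 hu.2
    refine re_div_ge (by positivity) (by positivity) one_pos ?_ ?_ ?_
    · have key := ray_cubic_lower_bound he he1 hr hr1 hα hα1 hu.1 hu.2 (σ := p * u + u)
        (by linarith [hu.1]) le_rfl
      refine key.trans (le_of_eq ?_)
      have hw2 : w = ⟨e + r / 2, √3 / 2 * r⟩ := Complex.ext hwre hwim
      have hd2 : rayDir = ⟨1 / 2, √3 / 2⟩ := Complex.ext rayDir_re rayDir_im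
      rw [hw2, hd2]
      simp [pow_two]
      ring_nf
      simp only [s2, s4]
      ring
    · rw [Complex.normSq_mul]
      nlinarith
    · rw [Complex.normSq_mul]
      nlinarith

theorem re_neg_conj_rayDir_mul_phaseDeriv_ge {p : ℝ} (hp : 0 < p) (hp1 : p ≤ 1 / 2) {e r : ℝ}
    (he : 0 ≤ e) (he1 : e ≤ 1 / 100) (hr : 0 ≤ r) (hr1 : r ≤ 9 / 10) :
    r ^ 2 / 800 - 12 * e ^ 2 ≤ ((rayDir - 1) * phaseDeriv p (-e + r * (rayDir - 1))).re := by
  set w : ℂ := -e + r * (rayDir - 1) with hw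
  have hwre : w.re = -e - r / 2 := by simp [hw, rayDir_re]; ring
  have hwim : w.im = √3 / 2 * r := by simp [hw, rayDir_im]; ring
  obtain ⟨s2, s3, s4, s5, s6⟩ := sqrt_three_pows
  have hns : Complex.normSq w = e ^ 2 + e * r + r ^ 2 := by
    rw [Complex.normSq_apply, hwre, hwim]
    ring_nf
    rw [s2]
    ring
  have := re_mul_phaseDeriv_sub_ge hp hp1 (w := w) (d := rayDir - 1) (u₀ := 0)
    (m := 3 / 25 * r ^ 2 / 16 - 2 * e ^ 2 / (1 / 12)) le_rfl zero_le_one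
    (fun u hu => by rw [hwre]; nlinarith [hu.1, hu.2, mul_nonneg hu.1 he, mul_nonneg hu.1 hr]) ?_
  · rw [Complex.ofReal_zero, zero_mul, phaseDeriv_zero, mul_zero, Complex.zero_re, sub_zero] at this
    nlinarith [sq_nonneg r, sq_nonneg e]
  · intro u hu
    have hα : 0 ≤ p * u := mul_nonneg hp.le hu.1
    have hα1 : p * u ≤ 1 / 2 := by nlinarith [hu.1, hu.2]
    have hbd : ∀ a : ℝ, 0 ≤ a → a ≤ 1 → (54 / 100) ^ 2 ≤ Complex.normSq (1 + a * w) ∧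
        Complex.normSq (1 + a * w) ≤ 4 := by
      intro a ha ha1
      rw [normSq_one_add_real_mul, hwre, hwim]
      have h1 : 54 / 100 ≤ 1 + a * (-e - r / 2) := by nlinarith
      have h2 : 1 + a * (-e - r / 2) ≤ 1 := by nlinarith [mul_nonneg ha he, mul_nonneg ha hr]
      have h3 : (a * (√3 / 2 * r)) ^ 2 = 3 / 4 * (a ^ 2 * r ^ 2) := by
        ring_nf
        rw [s2]
        ring
      have h4 : a ^ 2 * r ^ 2 ≤ 1 * 1 := by
        gcongr
        · nlinarith
        · nlinarith
      rw [h3]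
      constructor
      · have : 0 ≤ a ^ 2 * r ^ 2 := by positivity
        nlinarith
      · nlinarith
    obtain ⟨a1, a2⟩ := hbd (p * u) hα (by linarith)
    obtain ⟨b1, b2⟩ := hbd u hu.1 hu.2
    refine re_div_ge (by positivity) (by positivity) (by norm_num) ?_ ?_ ?_
    · have key := ray_cubic_lower_bound he he1 hr hr1 hα hα1 hu.1 hu.2 (σ := -(p * u + u))
        (by linarith [hu.1]) (by linarith [hu.1])
      refine key.trans (le_of_eq ?_)
      have hw2 : w = ⟨-e - r / 2, √3 / 2 * r⟩ := Complex.ext hwre hwim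
      have hd2 : rayDir = ⟨1 / 2, √3 / 2⟩ := Complex.ext rayDir_re rayDir_im
      rw [hw2, hd2]
      simp [pow_two]
      ring_nf
      simp only [s2, s4]
      ring
    · rw [Complex.normSq_mul]
      nlinarith
    · rw [Complex.normSq_mul]
      nlinarith

theorem im_phaseDeriv_ge {p : ℝ} (hp : 0 < p) (hp1 : p ≤ 1 / 2) {w : ℂ} (hre : 0 ≤ w.re)
    (hre1 : w.re ≤ 1 / 2) (him : 77 / 100 ≤ w.im) (hn : 9 / 10 ≤ ‖w‖) :
    1 / 400 ≤ (phaseDeriv p w).im := by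
  have formula : ∀ v : ℂ, 0 ≤ v.re → 0 ≤ v.im → ∀ u ∈ Icc (0 : ℝ) 1,
      v.im * (u * Complex.normSq v) /
        Complex.normSq ((1 + (p * u : ℝ) * v) * (1 + (u : ℝ) * v)) ≤
      (-Complex.I * v ^ 2 / ((1 + (p * u : ℝ) * v) * (1 + (u : ℝ) * v))).re := by
    intro v h1 h2 u hu
    rw [Complex.div_re, ← add_div]
    gcongr
    · exact Complex.normSq_nonneg _
    · have : (-Complex.I * v ^ 2).re * ((1 + (p * u : ℝ) * v) * (1 + (u : ℝ) * v)).re +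
          (-Complex.I * v ^ 2).im * ((1 + (p * u : ℝ) * v) * (1 + (u : ℝ) * v)).im =
          v.im * (2 * v.re + (p * u + u) * Complex.normSq v) := by
        simp [pow_two, Complex.normSq_apply]
        ring
      rw [this]
      have h3 : 0 ≤ p * u * Complex.normSq v :=
        mul_nonneg (mul_nonneg hp.le hu.1) (Complex.normSq_nonneg _)
      gcongr
      nlinarith
  have pos : ∀ v : ℂ, 0 ≤ v.re → ∀ u ∈ Icc (0 : ℝ) 1, 0 < 1 + u * v.re := fun v hv u hu => by
    nlinarith [mul_nonneg hu.1 hv]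
  have mono : ∀ v : ℂ, 0 ≤ v.re → 0 ≤ v.im → ∀ u₀ ∈ Icc (0 : ℝ) 1,
      (phaseDeriv p (u₀ * v)).im ≤ (phaseDeriv p v).im := by
    intro v h1 h2 u₀ hu₀
    have := re_mul_phaseDeriv_sub_ge hp hp1 (w := v) (d := -Complex.I) (u₀ := u₀) (m := 0)
      hu₀.1 hu₀.2 (pos v h1) (fun u hu => by
        have hu' : u ∈ Icc (0 : ℝ) 1 := ⟨hu₀.1.trans hu.1, hu.2⟩
        refine le_trans ?_ (formula v h1 h2 u hu')
        exact div_nonneg (mul_nonneg h2 (mul_nonneg hu'.1 (Complex.normSq_nonneg _)))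
          (Complex.normSq_nonneg _))
    simp at this
    linarith
  have hnpos : 0 < ‖w‖ := by linarith
  set a : ℝ := 9 / 10 / ‖w‖ with ha
  have ha0 : 0 < a := by positivity
  have ha1 : a ≤ 1 := by
    rw [ha, div_le_one hnpos]
    exact hn
  have hns : Complex.normSq w = ‖w‖ ^ 2 := Complex.normSq_eq_norm_sq w
  set v : ℂ := a * w with hv
  have hvre : v.re = a * w.re := by simp [hv]
  have hvim : v.im = a * w.im := by simp [hv]
  have hvn : Complex.normSq v = 81 / 100 := by
    rw [hv, Complex.normSq_mul, Complex.normSq_ofReal, hns, ha]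
    field_simp
    norm_num
  have hvim' : 7 / 10 ≤ v.im := by
    have h1 : v.re ^ 2 + v.im ^ 2 = 81 / 100 := by
      rw [← hvn, Complex.normSq_apply]
      ring
    have h2 : v.re ≤ 50 / 77 * v.im := by
      rw [hvre, hvim]
      nlinarith
    have h3 : 0 ≤ v.re := by rw [hvre]; positivity
    have h4 : 0 ≤ v.im := by rw [hvim]; exact mul_nonneg ha0.le (by linarith)
    nlinarith
  have hvre0 : 0 ≤ v.re := by rw [hvre]; positivity
  have hvim0 : 0 ≤ v.im := by linarith
  have h1 := mono w hre (by linarith) a ⟨ha0.le, ha1⟩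
  have h2 := mono v hvre0 hvim0 0 ⟨le_rfl, zero_le_one⟩
  have h3 := mono ((1 / 2 : ℝ) * v) (by simpa using hvre0) (by simpa using hvim0) 0
    ⟨le_rfl, zero_le_one⟩
  have h4 := re_mul_phaseDeriv_sub_ge hp hp1 (w := v) (d := -Complex.I) (u₀ := 1 / 2)
    (m := 1 / 60) (by norm_num) (by norm_num) (pos v hvre0) (fun u hu => by
      have hu' : u ∈ Icc (0 : ℝ) 1 := ⟨by linarith [hu.1], hu.2⟩
      refine le_trans ?_ (formula v hvre0 hvim0 u hu')
      have hbd : ∀ b : ℝ, 0 ≤ b → b ≤ 1 → 1 ≤ Complex.normSq (1 + b * v) ∧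
          Complex.normSq (1 + b * v) ≤ 361 / 100 := by
        intro b hb hb1
        have e1 : Complex.normSq (1 + b * v) = 1 + 2 * b * v.re + b ^ 2 * Complex.normSq v := by
          rw [normSq_one_add_real_mul, Complex.normSq_apply]
          ring
        have hvre1 : v.re ≤ 9 / 10 := by
          have h1 : v.re ^ 2 + v.im ^ 2 = 81 / 100 := by
            rw [← hvn, Complex.normSq_apply]
            ring
          nlinarith
        rw [e1, hvn]
        constructor
        · nlinarith [mul_nonneg hb hvre0, sq_nonneg b]
        · nlinarith [mul_nonneg hb hvre0, sq_nonneg b, mul_nonneg hb (sub_nonneg.2 hvre1)]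
      obtain ⟨a1, a2⟩ := hbd (p * u) (mul_nonneg hp.le hu'.1) (by nlinarith [hu'.1, hu'.2])
      obtain ⟨b1, b2⟩ := hbd u hu'.1 hu'.2
      rw [Complex.normSq_mul (1 + _) (1 + _), le_div_iff₀ (by nlinarith), hvn]
      have h5 : Complex.normSq (1 + (p * u : ℝ) * v) * Complex.normSq (1 + (u : ℝ) * v) ≤
          361 / 100 * (361 / 100) := by gcongr
      have h6 : 7 / 10 * (1 / 2 * (81 / 100)) ≤ v.im * (u * (81 / 100)) := by
        gcongr
        exact hu.1
      linarith)
  simp [phaseDeriv_zero] at h1 h2 h3 h4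
  nlinarith

theorem re_phaseDeriv_nonpos {p : ℝ} (hp : 0 < p) (hp1 : p ≤ 1 / 2) {w : ℂ}
    (hre : w.re ≤ -(9 / 20)) (hre1 : -(101 / 100) ≤ p * w.re) (him : w.im ^ 2 = 243 / 400) :
    (phaseDeriv p w).re ≤ 0 := by
  have hlog : ∀ z : ℂ, (Complex.log z).re = Real.log (Complex.normSq z) / 2 := by
    intro z
    rw [Complex.log_re, Complex.normSq_eq_norm_sq, Real.log_pow]
    push_cast
    ring
  have e1 : (phaseDeriv p w).re = Real.log (Complex.normSq (1 + p * w)) / 2 / p -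
      Real.log (Complex.normSq (1 + w)) / 2 := by
    simp only [phaseDeriv, Complex.sub_re, Complex.div_ofReal_re, hlog]
  have n1 : Complex.normSq (1 + p * w) = 1 + p * (2 * w.re + p * (w.re ^ 2 + 243 / 400)) := by
    rw [normSq_one_add_real_mul, ← him]
    ring
  have n2 : Complex.normSq (1 + w) = (1 + w.re) ^ 2 + 243 / 400 := by
    have := normSq_one_add_real_mul 1 w
    rw [Complex.ofReal_one, one_mul] at this
    rw [this, ← him]
    ring
  set a := w.re with ha
  have posn1 : 0 < Complex.normSq (1 + p * w) := by
    rw [normSq_one_add_real_mul, mul_pow, him]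
    positivity
  have l1 : Real.log (Complex.normSq (1 + p * w)) ≤ p * (2 * a + p * (a ^ 2 + 243 / 400)) := by
    have := Real.log_le_sub_one_of_pos posn1
    rw [n1] at this ⊢
    linarith
  have l1' : Real.log (Complex.normSq (1 + p * w)) / 2 / p ≤
      (2 * a + p * (a ^ 2 + 243 / 400)) / 2 := by
    rw [div_le_iff₀ hp]
    linarith
  have posn2 : 0 < Complex.normSq (1 + w) := by rw [n2]; positivity
  have l2 := Real.one_sub_inv_le_log_of_pos posn2
  rw [e1]
  rcases le_or_gt (-2) a with h | h
  · have h3 : p * (a ^ 2 + 243 / 400) ≤ 1 / 2 * (a ^ 2 + 243 / 400) := by gcongr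
    have h4 : (Complex.normSq (1 + w))⁻¹ ≤ 1 - (2 * a + 1 / 2 * (a ^ 2 + 243 / 400)) := by
      rw [n2, inv_le_iff_one_le_mul₀ (by positivity)]
      nlinarith [mul_nonneg (by linarith : 0 ≤ a + 2) (by linarith : 0 ≤ -(9 / 20) - a),
        sq_nonneg (a + 1), sq_nonneg (a ^ 2), sq_nonneg (a * (a + 1)),
        mul_nonneg (mul_nonneg (by linarith : 0 ≤ a + 2) (by linarith : 0 ≤ -(9 / 20) - a))
        (sq_nonneg (a + 1)), sq_nonneg (a+3/4)]
    linarith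
  · have h3 : 0 ≤ Real.log (Complex.normSq (1 + w)) := by
      apply Real.log_nonneg
      rw [n2]
      nlinarith
    have h4 : 2 * a + p * (a ^ 2 + 243 / 400) ≤ 0 := by nlinarith
    linarith

/-- The product of the monic polynomial with zeros `0, …, n - 1` and the Gamma functions. -/
noncomputable def weight (M : ℕ) (ν : ℕ → ℕ) (n : ℕ) (z : ℂ) : ℂ :=
  (∏ k ∈ Finset.range n, (z - k)) * ∏ j ∈ Finset.range M, Complex.Gamma (z + ν (j + 1) + 1)

/-- The rational part of the Stirling approximation of `weight`. -/
noncomputable def algFactor (M : ℕ) (ν : ℕ → ℕ) (n : ℕ) (z : ℂ) : ℂ :=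
  z / (z - n) * ∏ j ∈ Finset.range M, ∏ i ∈ Finset.range (ν (j + 1) + 1), (z + i)

/-- The scale of the contours around the critical point. -/
noncomputable def critScale (M n : ℕ) : ℝ := n / M

/-- The double critical point. -/
noncomputable def critPoint (M n : ℕ) : ℝ := (M + 1) * critScale M n

/-- The logarithm of the soft edge. -/
noncomputable def logEdge (M n : ℕ) : ℝ :=
  (M + 1) * Real.log (critPoint M n) - Real.log (critScale M n)

/-- The normalised weight, in the local variable `w` with `z = critPoint + critScale * w`. -/
noncomputable def ratio (M : ℕ) (ν : ℕ → ℕ) (n : ℕ) (w : ℂ) : ℂ :=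
  weight M ν n (critPoint M n + critScale M n * w) / weight M ν n (critPoint M n) *
    Complex.exp (-(critScale M n * w * logEdge M n))

theorem Gamma_add_natCast_add_one {z : ℂ} (hz : ∀ k : ℕ, z + k ≠ 0) (m : ℕ) :
    Complex.Gamma (z + m + 1) = Complex.Gamma z * ∏ i ∈ Finset.range (m + 1), (z + i) := by
  induction m with
  | zero =>
    have := hz 0
    rw [Nat.cast_zero, add_zero] at this
    simp [Complex.Gamma_add_one z this, mul_comm]
  | succ m ih =>
    rw [Finset.prod_range_succ, ← mul_assoc, ← ih, Complex.Gamma_add_one _ (hz (m + 1))]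
    push_cast
    rw [mul_comm, add_assoc z]

theorem prod_sub_natCast (z : ℂ) (n : ℕ) :
    (∏ k ∈ Finset.range n, (z - k)) * (z - n) = (∏ k ∈ Finset.range n, (z - n + k)) * z := by
  have h1 : ∏ k ∈ Finset.range (n + 1), (z - n + k) = ∏ k ∈ Finset.range (n + 1), (z - k) := by
    rw [← Finset.prod_range_reflect]
    refine Finset.prod_congr rfl fun k hk => ?_
    have : k ≤ n := Nat.lt_succ_iff.1 (Finset.mem_range.1 hk)
    rw [Nat.add_sub_cancel, Nat.cast_sub this]
    ring
  rw [← Finset.prod_range_succ (fun k : ℕ => z - (k : ℂ)), ← h1, Finset.prod_range_succ]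
  ring

theorem exists_weight_stirling (M : ℕ) (ν : ℕ → ℕ) :
    ∃ C₀ : ℂ, C₀ ≠ 0 ∧ ∀ (n : ℕ) (z : ℂ) (B : ℝ), 0 ≤ z.im → -(1 / 2) ≤ z.re → 3 ≤ ‖z‖ → 2 ≤ B →
      (∀ k : ℕ, k < n → B ≤ ‖z - n + k‖) → (∀ k : ℕ, z - n + k ≠ 0) →
      ∃ e : ℂ, ‖e‖ ≤ M * (16 / ‖z‖) + n * (2 / B ^ 2) ∧
        weight M ν n z = C₀ * Complex.exp ((M + 1) * stirlingExponent z -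
          stirlingExponent (z - n) + e) * algFactor M ν n z := by
  obtain ⟨C, hC, hG⟩ := exists_Gamma_stirling
  refine ⟨C ^ M, pow_ne_zero _ hC, fun n z B hi hre h3 hB hk hne => ?_⟩
  obtain ⟨e, he, hGz⟩ := hG z hi hre h3
  have hd := norm_sum_stirlingDefect_le (z := z - n) (by simpa using hi) hB hk
  refine ⟨M * e - ∑ k ∈ Finset.range n, stirlingDefect (z - n + k), ?_, ?_⟩
  · refine (norm_sub_le _ _).trans (add_le_add ?_ hd)
    rw [norm_mul, Complex.norm_natCast]
    gcongr
  have hz0 := (stirlingDefect_bounds hi hre h3).1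
  have hzn : z - n ≠ 0 := by simpa using hne 0
  have e1 : ∏ k ∈ Finset.range n, (z - k) =
      (∏ k ∈ Finset.range n, (z - n + k)) * (z / (z - n)) := by
    rw [mul_div_assoc', eq_div_iff hzn, prod_sub_natCast]
  have e2 : ∏ j ∈ Finset.range M, Complex.Gamma (z + ν (j + 1) + 1) =
      (C ^ M * Complex.exp (M * (stirlingExponent z + e))) *
        ∏ j ∈ Finset.range M, ∏ i ∈ Finset.range (ν (j + 1) + 1), (z + i) := by
    rw [Finset.prod_congr rfl fun j _ => Gamma_add_natCast_add_one hz0 (ν (j + 1)),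
      Finset.prod_mul_distrib, Finset.prod_const, Finset.card_range, hGz, mul_pow,
      ← Complex.exp_nat_mul]
  rw [weight, e1, e2, prod_add_natCast_eq_exp hne, algFactor]
  have e3 : ((M : ℂ) + 1) * stirlingExponent z - stirlingExponent (z - n) +
      (M * e - ∑ k ∈ Finset.range n, stirlingDefect (z - n + k)) =
      (stirlingExponent (z - n + n) - stirlingExponent (z - n) -
        ∑ k ∈ Finset.range n, stirlingDefect (z - n + k)) + M * (stirlingExponent z + e) := by
    rw [sub_add_cancel]
    ring
  rw [e3, Complex.exp_add]
  ring

/-- The part of the upper half-plane on which the Stirling approximation is uniform. -/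
def StirlingRegion (M n : ℕ) (w : ℂ) : Prop :=
  0 ≤ w.im ∧ -(1 / 2) ≤ critPoint M n + critScale M n * w.re ∧ (-(1 / 2) ≤ w.re ∨ 1 / 2 ≤ w.im)

theorem critPoint_eq (M n : ℕ) (hM : 1 ≤ M) : critPoint M n = n + critScale M n := by
  have : (M : ℝ) ≠ 0 := by positivity
  rw [critPoint, critScale]
  field_simp

theorem critScale_pos {M n : ℕ} (hM : 1 ≤ M) (hn : 1 ≤ n) : 0 < critScale M n := by
  rw [critScale]
  positivity

theorem stirlingExponent_critical {M n : ℕ} (hM : 1 ≤ M) (hn : 1 ≤ n) {w : ℂ}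
    (h1 : 1 + ((1 / (M + 1) : ℝ) : ℂ) * w ≠ 0) (h2 : 1 + w ≠ 0) :
    ((M + 1) * stirlingExponent (critPoint M n + critScale M n * w) -
      stirlingExponent (critPoint M n + critScale M n * w - n)) -
    ((M + 1) * stirlingExponent (critPoint M n) - stirlingExponent (critPoint M n - n)) =
    critScale M n * phase (1 / (M + 1)) w + critScale M n * w * logEdge M n -
      (M + 1) / 2 * Complex.log (1 + ((1 / (M + 1) : ℝ) : ℂ) * w) + Complex.log (1 + w) / 2 := by
  have hN := critScale_pos hM hn
  have hM0 : (M : ℝ) ≠ 0 := by positivity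
  have hT : 0 < critPoint M n := by rw [critPoint]; positivity
  set p : ℝ := 1 / (M + 1) with hp
  have hp0 : 0 < p := by positivity
  have hM1 : ((M : ℂ) + 1) = 1 / p := by rw [hp]; push_cast; field_simp
  have hpc : (p : ℂ) ≠ 0 := by exact_mod_cast hp0.ne'
  have hTN : (critPoint M n : ℂ) = critScale M n / p := by
    rw [critPoint]
    push_cast
    rw [hM1]
    ring
  have a1 : (critPoint M n : ℂ) + critScale M n * w = (critPoint M n : ℝ) * (1 + p * w) := by
    rw [hTN]
    field_simp
  have a2 : (critPoint M n : ℂ) + critScale M n * w - n = (critScale M n : ℝ) * (1 + w) := by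
    rw [critPoint_eq M n hM]
    push_cast
    ring
  have a3 : (critPoint M n : ℂ) - n = (critScale M n : ℝ) := by
    rw [critPoint_eq M n hM]
    push_cast
    ring
  rw [a2, a1, a3]
  simp only [stirlingExponent, logEdge, phase]
  rw [Complex.log_ofReal_mul hT h1, Complex.log_ofReal_mul hN h2, ← Complex.ofReal_log hT.le,
    ← Complex.ofReal_log hN.le]
  push_cast
  rw [hM1]
  generalize (Real.log (critPoint M n) : ℂ) = a
  generalize (Real.log (critScale M n) : ℂ) = b
  rw [hTN]
  field_simp
  ring

theorem StirlingRegion.norm_sub_ge {M n : ℕ} (hM : 1 ≤ M) (hn : 1 ≤ n) {w : ℂ}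
    (h : StirlingRegion M n w) (k : ℕ) :
    critScale M n / 2 ≤ ‖(critPoint M n : ℂ) + critScale M n * w - n + k‖ := by
  have hN := critScale_pos hM hn
  have hk : (0 : ℝ) ≤ k := k.cast_nonneg
  rcases h.2.2 with h | h
  · refine le_trans ?_ (Complex.re_le_norm _)
    rw [critPoint_eq M n hM]
    simp
    nlinarith
  · refine le_trans ?_ (Complex.im_le_norm _)
    simp
    nlinarith

theorem StirlingRegion.norm_ge {M n : ℕ} (hM : 1 ≤ M) (hn : 1 ≤ n) {w : ℂ}
    (h : StirlingRegion M n w) :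
    critScale M n / 2 ≤ ‖(critPoint M n : ℂ) + critScale M n * w‖ := by
  simpa using h.norm_sub_ge hM hn n

theorem StirlingRegion.norm_one_add_ge {M n : ℕ} {w : ℂ} (h : StirlingRegion M n w) {a : ℝ}
    (ha : 0 ≤ a) (ha1 : a ≤ 1) : a / 2 ≤ ‖1 + a * w‖ := by
  rcases h.2.2 with h | h
  · refine le_trans ?_ (Complex.re_le_norm _)
    simp
    nlinarith
  · refine le_trans ?_ (Complex.im_le_norm _)
    simp
    nlinarith

theorem stirlingRegion_zero {M n : ℕ} : StirlingRegion M n 0 := by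
  refine ⟨by simp, ?_, Or.inl (by simp)⟩
  have : 0 ≤ critPoint M n := by rw [critPoint, critScale]; positivity
  simp
  linarith

/-- The slowly varying part of `ratio`, up to the error `e` of the Stirling approximation. -/
noncomputable def slowFactor (M : ℕ) (ν : ℕ → ℕ) (n : ℕ) (w e : ℂ) : ℂ :=
  Complex.exp (-((M + 1) / 2) * Complex.log (1 + ((1 / (M + 1) : ℝ) : ℂ) * w) +
    Complex.log (1 + w) / 2 + e) *
  (algFactor M ν n (critPoint M n + critScale M n * w) / algFactor M ν n (critPoint M n))

theorem exists_ratio_eq {M : ℕ} (hM : 1 ≤ M) (ν : ℕ → ℕ) :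
    ∃ (n₀ : ℕ) (C : ℝ), 1 ≤ n₀ ∧ 0 ≤ C ∧ ∀ n ≥ n₀, ∀ w : ℂ, StirlingRegion M n w →
      ∃ e : ℂ, ‖e‖ ≤ C / n ∧ ratio M ν n w =
        Complex.exp (critScale M n * phase (1 / (M + 1)) w) * slowFactor M ν n w e := by
  obtain ⟨C₀, hC₀, hW⟩ := exists_weight_stirling M ν
  have hMr : (0 : ℝ) < M := by exact_mod_cast hM
  refine ⟨6 * M, 2 * (M * (32 * M) + 8 * M ^ 2), by linarith, by positivity, fun n hn w hw => ?_⟩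
  have hn1 : 1 ≤ n := by linarith
  have hnr : (0 : ℝ) < n := by exact_mod_cast hn1
  have hN := critScale_pos hM hn1
  have hN6 : 6 ≤ critScale M n := by
    rw [critScale, le_div_iff₀ hMr]
    exact_mod_cast hn
  have step : ∀ v : ℂ, StirlingRegion M n v → ∃ e : ℂ, ‖e‖ ≤ (M * (32 * M) + 8 * M ^ 2) / n ∧
      weight M ν n (critPoint M n + critScale M n * v) = C₀ * Complex.exp ((M + 1) *
        stirlingExponent (critPoint M n + critScale M n * v) -
          stirlingExponent (critPoint M n + critScale M n * v - n) + e) *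
          algFactor M ν n (critPoint M n + critScale M n * v) := by
    intro v hv
    have hb := hv.norm_ge hM hn1
    obtain ⟨e, he, h⟩ := hW n (critPoint M n + critScale M n * v) (critScale M n / 2)
      (by simpa using mul_nonneg hN.le hv.1) (by simpa using hv.2.1) (by linarith) (by linarith)
      (fun k _ => hv.norm_sub_ge hM hn1 k) (fun k => by
        have := hv.norm_sub_ge hM hn1 k
        rw [← norm_pos_iff]
        linarith)
    refine ⟨e, he.trans ?_, h⟩
    calc (M : ℝ) * (16 / ‖(critPoint M n : ℂ) + critScale M n * v‖) +
          n * (2 / (critScale M n / 2) ^ 2)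
        ≤ M * (16 / (critScale M n / 2)) + n * (2 / (critScale M n / 2) ^ 2) := by gcongr
      _ = ((M : ℝ) * (32 * M) + 8 * (M : ℝ) ^ 2) / (n : ℝ) := by
        rw [critScale]
        field_simp
        ring
  have hne : ∀ v : ℂ, StirlingRegion M n v →
      algFactor M ν n (critPoint M n + critScale M n * v) ≠ 0 := by
    intro v hv
    have hb := hv.norm_ge hM hn1
    have hc := hv.norm_sub_ge hM hn1 0
    rw [algFactor]
    have h0 := (stirlingDefect_bounds (z := critPoint M n + critScale M n * v)
      (by simpa using mul_nonneg hN.le hv.1) (by simpa using hv.2.1) (by linarith)).1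
    refine mul_ne_zero (div_ne_zero ?_ ?_)
      (Finset.prod_ne_zero_iff.2 fun j _ => Finset.prod_ne_zero_iff.2 fun i _ => h0 i)
    · simpa using h0 0
    · rw [← norm_pos_iff]
      rw [Nat.cast_zero, add_zero] at hc
      linarith
  obtain ⟨e, he, h⟩ := step w hw
  obtain ⟨e', he', h'⟩ := step 0 stirlingRegion_zero
  have hne' := hne 0 stirlingRegion_zero
  rw [mul_zero, add_zero] at h' hne'
  refine ⟨e - e', ?_, ?_⟩
  · calc ‖e - e'‖ ≤ ‖e‖ + ‖e'‖ := norm_sub_le _ _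
      _ ≤ (M * (32 * M) + 8 * M ^ 2) / n + (M * (32 * M) + 8 * M ^ 2) / n := add_le_add he he'
      _ = _ := by ring
  have p1 : (1 : ℝ) / (M + 1) ≤ 1 := by
    rw [div_le_one (by positivity)]
    linarith
  have p0 : (0 : ℝ) < 1 / (M + 1) := by positivity
  have hcrit := stirlingExponent_critical hM hn1 (w := w)
    (norm_pos_iff.1 (lt_of_lt_of_le (half_pos p0) (hw.norm_one_add_ge p0.le p1)))
    (norm_pos_iff.1 (lt_of_lt_of_le one_half_pos (by
      have := hw.norm_one_add_ge zero_le_one le_rfl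
      rwa [Complex.ofReal_one, one_mul] at this)))
  rw [ratio, h, h', slowFactor]
  generalize algFactor M ν n (critPoint M n + critScale M n * w) = A at *
  have hexp : ∀ a b c d f : ℂ, a - b = c + d + f →
      C₀ * Complex.exp (a + e) * A / (C₀ * Complex.exp (b + e') * algFactor M ν n (critPoint M n)) *
        Complex.exp (-d) =
      Complex.exp c * (Complex.exp (f + (e - e')) * (A / algFactor M ν n (critPoint M n))) := by
    intro a b c d f habc
    rw [show a = b + c + d + f by linear_combination habc]
    simp only [Complex.exp_add, Complex.exp_sub, Complex.exp_neg]
    have := Complex.exp_ne_zero d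
    have := Complex.exp_ne_zero b
    have := Complex.exp_ne_zero e'
    field_simp
  refine hexp _ _ _ _ _ ?_
  rw [hcrit]
  ring

theorem algFactor_div {M : ℕ} (hM : 1 ≤ M) (ν : ℕ → ℕ) {n : ℕ} (hn : 1 ≤ n) (w : ℂ) :
    algFactor M ν n (critPoint M n + critScale M n * w) / algFactor M ν n (critPoint M n) =
      (1 + ((1 / (M + 1) : ℝ) : ℂ) * w) / (1 + w) *
        ∏ j ∈ Finset.range M, ∏ i ∈ Finset.range (ν (j + 1) + 1),
          (1 + critScale M n * w / (critPoint M n + i)) := by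
  have hN := critScale_pos hM hn
  have hT : 0 < critPoint M n := by rw [critPoint]; positivity
  have hTc : (critPoint M n : ℂ) ≠ 0 := by exact_mod_cast hT.ne'
  have hNc : (critScale M n : ℂ) ≠ 0 := by exact_mod_cast hN.ne'
  have hTN : (critPoint M n : ℂ) = (M + 1) * critScale M n := by
    rw [critPoint]
    push_cast
    ring
  have e1 : (critPoint M n : ℂ) + critScale M n * w - n = (critScale M n : ℝ) * (1 + w) := by
    rw [critPoint_eq M n hM]
    push_cast
    ring
  have e2 : (critPoint M n : ℂ) - n = (critScale M n : ℝ) := by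
    rw [critPoint_eq M n hM]
    push_cast
    ring
  have hM1 : ((M : ℂ) + 1) ≠ 0 := by exact_mod_cast (Nat.succ_ne_zero M)
  simp only [algFactor]
  rw [mul_div_mul_comm, e1, e2, ← Finset.prod_div_distrib]
  congr 1
  · rw [hTN]
    push_cast
    field_simp
  · refine Finset.prod_congr rfl fun j _ => ?_
    rw [← Finset.prod_div_distrib]
    refine Finset.prod_congr rfl fun i _ => ?_
    have : (critPoint M n : ℂ) + i ≠ 0 := by
      have : 0 < critPoint M n + i := by positivity
      exact_mod_cast this.ne'
    field_simp
    ring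

theorem norm_critScale_mul_div_le {M : ℕ} (hM : 1 ≤ M) {n : ℕ} (hn : 1 ≤ n) (w : ℂ) (i : ℕ) :
    ‖critScale M n * w / ((critPoint M n : ℂ) + i)‖ ≤ ‖w‖ := by
  have hN := critScale_pos hM hn
  have h1 : ‖(critPoint M n : ℂ) + i‖ = critPoint M n + i := by
    have : (0 : ℝ) ≤ critPoint M n + i := by rw [critPoint]; positivity
    rw [← abs_of_nonneg this, ← Real.norm_eq_abs, ← Complex.norm_real]
    push_cast
    rfl
  have h2 : critScale M n ≤ critPoint M n + i := by
    rw [critPoint]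
    have : (0 : ℝ) ≤ M * critScale M n + i := by positivity
    linarith
  rw [norm_div, norm_mul, h1, Complex.norm_real, Real.norm_of_nonneg hN.le,
    div_le_iff₀ (by linarith), mul_comm]
  gcongr

/-- Bound for `slowFactor` in the right half-plane. -/
theorem norm_slowFactor_le {M : ℕ} (hM : 1 ≤ M) (ν : ℕ → ℕ) {n : ℕ} (hn : 1 ≤ n) {w e : ℂ}
    (hw : 0 ≤ w.re) :
    ‖slowFactor M ν n w e‖ ≤
      Real.exp ‖e‖ * (1 + ‖w‖) ^ (2 + ∑ j ∈ Finset.range M, (ν (j + 1) + 1)) := by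
  set p : ℝ := 1 / (M + 1) with hp
  have p0 : 0 < p := by positivity
  have p1 : p ≤ 1 := by
    rw [hp, div_le_one (by positivity)]
    linarith [(M.cast_nonneg : (0 : ℝ) ≤ M)]
  have ha : 1 ≤ ‖1 + (p : ℂ) * w‖ := by
    refine le_trans ?_ (Complex.re_le_norm _)
    simp
    positivity
  have hb : 1 ≤ ‖1 + w‖ := by
    refine le_trans ?_ (Complex.re_le_norm _)
    simpa
  have hb' : ‖1 + w‖ ≤ 1 + ‖w‖ := (norm_add_le _ _).trans (by simp)
  have ha' : ‖1 + (p : ℂ) * w‖ ≤ 1 + ‖w‖ := by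
    refine (norm_add_le _ _).trans ?_
    rw [norm_one, norm_mul, Complex.norm_real, Real.norm_of_nonneg p0.le]
    gcongr
    exact mul_le_of_le_one_left (norm_nonneg _) p1
  have h1 : ‖Complex.exp (-((M + 1) / 2) * Complex.log (1 + (p : ℂ) * w) +
      Complex.log (1 + w) / 2 + e)‖ ≤ Real.exp ‖e‖ * (1 + ‖w‖) := by
    have hre : (-(((M : ℂ) + 1) / 2) * Complex.log (1 + (p : ℂ) * w) +
        Complex.log (1 + w) / 2 + e).re = -((M + 1) / 2) * Real.log ‖1 + (p : ℂ) * w‖ +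
          Real.log ‖1 + w‖ / 2 + e.re := by
      have : (-(((M : ℂ) + 1) / 2)) = ((-(((M : ℝ) + 1) / 2) : ℝ) : ℂ) := by push_cast; ring
      rw [this, Complex.add_re, Complex.add_re, Complex.re_ofReal_mul, Complex.log_re]
      congr 2
      simp [Complex.log_re]
    rw [Complex.norm_exp, hre]
    have l1 := Real.log_nonneg ha
    have l2 := Real.log_nonneg hb
    have l3 := Real.log_le_log (by linarith) hb'
    calc Real.exp _ ≤ Real.exp (‖e‖ + Real.log (1 + ‖w‖)) := by
          apply Real.exp_le_exp.2
          have : 0 ≤ ((M : ℝ) + 1) / 2 * Real.log ‖1 + (p : ℂ) * w‖ := by positivity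
          linarith [Complex.re_le_norm e]
      _ = _ := by rw [Real.exp_add, Real.exp_log (by positivity)]
  rw [slowFactor, algFactor_div hM ν hn, norm_mul, norm_mul, norm_div]
  have h2 : ‖∏ j ∈ Finset.range M, ∏ i ∈ Finset.range (ν (j + 1) + 1),
      (1 + critScale M n * w / ((critPoint M n : ℂ) + i))‖ ≤
        (1 + ‖w‖) ^ (∑ j ∈ Finset.range M, (ν (j + 1) + 1)) := by
    rw [norm_prod, ← Finset.prod_pow_eq_pow_sum]
    refine Finset.prod_le_prod (fun _ _ => norm_nonneg _) fun j _ => ?_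
    rw [norm_prod]
    refine (Finset.prod_le_prod (fun _ _ => norm_nonneg _) fun i _ => ?_).trans
      (Finset.prod_const (1 + ‖w‖)).le |>.trans_eq (by rw [Finset.card_range])
    refine (norm_add_le _ _).trans ?_
    rw [norm_one]
    gcongr
    exact norm_critScale_mul_div_le hM hn w i
  calc _ ≤ Real.exp ‖e‖ * (1 + ‖w‖) * ((1 + ‖w‖) / 1 *
        (1 + ‖w‖) ^ (∑ j ∈ Finset.range M, (ν (j + 1) + 1))) := by gcongr
    _ = _ := by ring

theorem norm_le_norm_add_natCast {z : ℂ} (hz : -(1 / 2) ≤ z.re) (i : ℕ) : ‖z‖ ≤ ‖z + i‖ := by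
  rcases Nat.eq_zero_or_pos i with rfl | hi
  · simp
  have hi' : (1 : ℝ) ≤ i := by exact_mod_cast hi
  rw [← sq_le_sq₀ (norm_nonneg _) (norm_nonneg _), ← Complex.normSq_eq_norm_sq,
    ← Complex.normSq_eq_norm_sq, Complex.normSq_apply, Complex.normSq_apply]
  simp
  nlinarith

/-- Lower bound for `slowFactor` in bounded parts of the Stirling region. -/
theorem exists_norm_inv_slowFactor_le {M : ℕ} (hM : 1 ≤ M) (ν : ℕ → ℕ) (A : ℝ) :
    ∃ C : ℝ, 0 ≤ C ∧ ∀ (n : ℕ) (w e : ℂ), M ≤ n → StirlingRegion M n w → ‖w‖ ≤ A →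
      ‖(slowFactor M ν n w e)⁻¹‖ ≤ C * Real.exp ‖e‖ := by
  set p : ℝ := 1 / (M + 1) with hp
  have p0 : 0 < p := by positivity
  have p1 : p ≤ 1 := by
    rw [hp, div_le_one (by positivity)]
    linarith [(M.cast_nonneg : (0 : ℝ) ≤ M)]
  refine ⟨Real.exp ((M + 1) / 2 * Real.log (1 + |A|) + Real.log 2 / 2) * ((1 + |A|) / (p / 2) *
    ∏ j ∈ Finset.range M, ∏ i ∈ Finset.range (ν (j + 1) + 1), (2 * ((M : ℝ) + 1 + i))),
    by positivity, fun n w e hn hw hA => ?_⟩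
  have hn1 : 1 ≤ n := hM.trans hn
  have hN := critScale_pos hM hn1
  have hN1 : 1 ≤ critScale M n := by
    rw [critScale, le_div_iff₀ (by exact_mod_cast hM), one_mul]
    exact_mod_cast hn
  have hA' : ‖w‖ ≤ |A| := hA.trans (le_abs_self A)
  have ha : p / 2 ≤ ‖1 + (p : ℂ) * w‖ := hw.norm_one_add_ge p0.le p1
  have hb : 1 / 2 ≤ ‖1 + w‖ := by
    have := hw.norm_one_add_ge zero_le_one le_rfl
    rwa [Complex.ofReal_one, one_mul] at this
  have hb' : ‖1 + w‖ ≤ 1 + |A| := (norm_add_le _ _).trans (by simpa)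
  have ha' : ‖1 + (p : ℂ) * w‖ ≤ 1 + |A| := by
    refine (norm_add_le _ _).trans ?_
    rw [norm_one, norm_mul, Complex.norm_real, Real.norm_of_nonneg p0.le]
    gcongr
    exact (mul_le_of_le_one_left (norm_nonneg _) p1).trans hA'
  have h1 : ‖(Complex.exp (-((M + 1) / 2) * Complex.log (1 + (p : ℂ) * w) +
      Complex.log (1 + w) / 2 + e))⁻¹‖ ≤
        Real.exp ((M + 1) / 2 * Real.log (1 + |A|) + Real.log 2 / 2) * Real.exp ‖e‖ := by
    have hre : (-(((M : ℂ) + 1) / 2) * Complex.log (1 + (p : ℂ) * w) +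
        Complex.log (1 + w) / 2 + e).re = -((M + 1) / 2) * Real.log ‖1 + (p : ℂ) * w‖ +
          Real.log ‖1 + w‖ / 2 + e.re := by
      have : (-(((M : ℂ) + 1) / 2)) = ((-(((M : ℝ) + 1) / 2) : ℝ) : ℂ) := by push_cast; ring
      rw [this, Complex.add_re, Complex.add_re, Complex.re_ofReal_mul, Complex.log_re]
      congr 2
      simp [Complex.log_re]
    rw [← Complex.exp_neg, Complex.norm_exp, Complex.neg_re, hre, ← Real.exp_add]
    apply Real.exp_le_exp.2
    have l1 := Real.log_le_log (by linarith) ha'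
    have l2 := Real.log_le_log one_half_pos hb
    rw [one_div, Real.log_inv] at l2
    have l3 : ((M : ℝ) + 1) / 2 * Real.log ‖1 + (p : ℂ) * w‖ ≤
      (M + 1) / 2 * Real.log (1 + |A|) := by gcongr
    linarith [neg_le_of_abs_le (Complex.abs_re_le_norm e)]
  rw [slowFactor, algFactor_div hM ν hn1, mul_inv, mul_inv, inv_div, norm_mul, norm_mul, norm_div]
  have h2 : ‖(∏ j ∈ Finset.range M, ∏ i ∈ Finset.range (ν (j + 1) + 1),
      (1 + critScale M n * w / ((critPoint M n : ℂ) + i)))⁻¹‖ ≤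
        ∏ j ∈ Finset.range M, ∏ i ∈ Finset.range (ν (j + 1) + 1), (2 * ((M : ℝ) + 1 + i)) := by
    rw [norm_inv, norm_prod, ← Finset.prod_inv_distrib]
    refine Finset.prod_le_prod (fun _ _ => by positivity) fun j _ => ?_
    rw [norm_prod, ← Finset.prod_inv_distrib]
    refine Finset.prod_le_prod (fun _ _ => by positivity) fun i _ => ?_
    have hT : 0 < critPoint M n + i := by rw [critPoint]; positivity
    have hTc : (critPoint M n : ℂ) + i ≠ 0 := by exact_mod_cast hT.ne'
    have e1 : 1 + critScale M n * w / ((critPoint M n : ℂ) + i) =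
        (critPoint M n + critScale M n * w + i) / ((critPoint M n + i : ℝ) : ℂ) := by
      push_cast
      field_simp
      ring
    have e2 := (hw.norm_ge hM hn1).trans (norm_le_norm_add_natCast (by simpa using hw.2.1) i)
    rw [e1, norm_div, Complex.norm_real, Real.norm_of_nonneg hT.le, inv_div,
      div_le_iff₀ (by linarith)]
    calc critPoint M n + i ≤ (M + 1) * critScale M n + i * critScale M n := by
          rw [critPoint]
          nlinarith [(i.cast_nonneg : (0 : ℝ) ≤ i)]
      _ = 2 * (M + 1 + i) * (critScale M n / 2) := by ring
      _ ≤ _ := by gcongr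
  calc _ ≤ Real.exp ((M + 1) / 2 * Real.log (1 + |A|) + Real.log 2 / 2) * Real.exp ‖e‖ *
      ((1 + |A|) / (p / 2) * ∏ j ∈ Finset.range M, ∏ i ∈ Finset.range (ν (j + 1) + 1),
        (2 * ((M : ℝ) + 1 + i))) := by gcongr
    _ = _ := by ring

theorem tendsto_slowFactor {M : ℕ} (hM : 1 ≤ M) (ν : ℕ → ℕ) {w e : ℕ → ℂ}
    (hw : Tendsto w atTop (𝓝 0)) (he : Tendsto e atTop (𝓝 0)) :
    Tendsto (fun n => slowFactor M ν n (w n) (e n)) atTop (𝓝 1) := by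
  have hpw : Tendsto (fun n => 1 + ((1 / (M + 1) : ℝ) : ℂ) * w n) atTop (𝓝 1) := by
    simpa using (hw.const_mul ((1 / (M + 1) : ℝ) : ℂ)).const_add 1
  have hw1 : Tendsto (fun n => 1 + w n) atTop (𝓝 1) := by simpa using hw.const_add 1
  have hlog : ∀ {u : ℕ → ℂ}, Tendsto u atTop (𝓝 1) →
      Tendsto (fun n => Complex.log (u n)) atTop (𝓝 0) := by
    intro u hu
    simpa [Function.comp_def] using
      (continuousAt_clog (by simp [Complex.one_mem_slitPlane])).tendsto.comp hu
  have h1 : Tendsto (fun n => Complex.exp (-((M + 1) / 2) *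
      Complex.log (1 + ((1 / (M + 1) : ℝ) : ℂ) * w n) + Complex.log (1 + w n) / 2 + e n))
      atTop (𝓝 1) := by
    have := (((hlog hpw).const_mul (-(((M : ℂ) + 1) / 2))).add ((hlog hw1).div_const 2)).add he
    simpa using this.cexp
  have h2 : Tendsto (fun n => ∏ j ∈ Finset.range M, ∏ i ∈ Finset.range (ν (j + 1) + 1),
      (1 + critScale M n * w n / ((critPoint M n : ℂ) + i))) atTop
      (𝓝 (∏ j ∈ Finset.range M, ∏ i ∈ Finset.range (ν (j + 1) + 1), 1)) := by
    refine tendsto_finsetProd _ fun j _ => tendsto_finsetProd _ fun i _ => ?_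
    have : Tendsto (fun n => critScale M n * w n / ((critPoint M n : ℂ) + i)) atTop (𝓝 0) := by
      refine squeeze_zero_norm' ?_ (tendsto_zero_iff_norm_tendsto_zero.1 hw)
      filter_upwards [eventually_ge_atTop 1] with n hn
      exact norm_critScale_mul_div_le hM hn _ i
    simpa using this.const_add 1
  have h3 := h1.mul ((hpw.div hw1 one_ne_zero).mul h2)
  simp only [Finset.prod_const_one, div_one, mul_one] at h3
  refine h3.congr' ?_
  filter_upwards [eventually_ge_atTop 1] with n hn
  rw [slowFactor, algFactor_div hM ν hn]
  rfl

theorem mul_re_phase_sub_le {p : ℝ} (hp : 0 < p) (hp1 : p ≤ 1) {z d : ℂ} {a b c : ℝ} (hab : a ≤ b)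
    {B B' : ℝ → ℝ} (hB : ∀ x, HasDerivAt B (B' x) x)
    (hs : ∀ x ∈ Icc a b, 0 < (z + x * d).im ∨ -1 < (z + x * d).re)
    (h : ∀ x ∈ Icc a b, c * (d * phaseDeriv p (z + x * d)).re ≤ B' x) :
    c * (phase p (z + b * d)).re - c * (phase p (z + a * d)).re ≤ B b - B a := by
  have hd : ∀ x ∈ Icc a b, HasDerivAt (fun x : ℝ => c * (phase p (z + x * d)).re - B x)
      (c * (d * phaseDeriv p (z + x * d)).re - B' x) x := by
    intro x hx
    have m2 : 1 + (z + x * d) ∈ Complex.slitPlane := by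
      rcases hs x hx with h | h
      · right
        rw [Complex.add_im, Complex.one_im, zero_add]
        exact h.ne'
      · left
        rw [Complex.add_re, Complex.one_re]
        linarith
    have m1 : 1 + (p : ℂ) * (z + x * d) ∈ Complex.slitPlane := by
      rcases hs x hx with h | h
      · right
        rw [Complex.add_im, Complex.one_im, zero_add, Complex.im_ofReal_mul]
        exact (mul_pos hp h).ne'
      · left
        rw [Complex.add_re, Complex.one_re, Complex.re_ofReal_mul]
        nlinarith
    have b0 : HasDerivAt (fun x : ℝ => z + (x : ℂ) * d) d x := by
      simpa using ((Complex.ofRealCLM.hasDerivAt (x := x)).mul_const d).const_add z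
    have b1 := (hasDerivAt_phase hp.ne' m1 m2).comp x b0
    have b2 := (Complex.reCLM.hasFDerivAt (x := phase p (z + x * d))).comp_hasDerivAt x b1
    have b3 := (b2.const_mul c).sub (hB x)
    rw [Complex.reCLM_apply, mul_comm (phaseDeriv p _)] at b3
    exact b3
  have hanti : AntitoneOn (fun x : ℝ => c * (phase p (z + x * d)).re - B x) (Icc a b) := by
    apply antitoneOn_of_deriv_nonpos (convex_Icc _ _)
    · exact fun x hx => (hd x hx).continuousAt.continuousWithinAt
    · intro x hx
      rw [interior_Icc] at hx
      exact (hd x (Ioo_subset_Icc_self hx)).differentiableAt.differentiableWithinAt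
    · intro x hx
      rw [interior_Icc] at hx
      rw [(hd x (Ioo_subset_Icc_self hx)).deriv]
      linarith [h x (Ioo_subset_Icc_self hx)]
  have := hanti ⟨le_rfl, hab⟩ ⟨hab, le_rfl⟩ hab
  simp only at this
  linarith

/-- The right contour: it follows the Airy contour up to radius `R`, then becomes vertical. -/
noncomputable def rightPath (R r : ℝ) : ℂ :=
  ((1 + min |r| R / 2 : ℝ) : ℂ) + ((√3 / 2 * r : ℝ) : ℂ) * Complex.I

theorem exp_pi_third : Complex.exp (((Real.pi / 3 : ℝ) : ℂ) * Complex.I) = rayDir := by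
  rw [Complex.exp_mul_I, ← Complex.ofReal_cos, ← Complex.ofReal_sin, Real.cos_pi_div_three,
    Real.sin_pi_div_three]
  apply Complex.ext
  · simp [rayDir_re]
  · simp [rayDir_im]

theorem exp_neg_pi_third :
    Complex.exp (((-(Real.pi / 3) : ℝ) : ℂ) * Complex.I) = 1 - rayDir := by
  rw [Complex.exp_mul_I, ← Complex.ofReal_cos, ← Complex.ofReal_sin, Real.cos_neg, Real.sin_neg,
    Real.cos_pi_div_three, Real.sin_pi_div_three]
  apply Complex.ext
  · simp [rayDir_re]
    norm_num
  · simp [rayDir_im]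

theorem muR_eq (r : ℝ) : muR r = ((1 + |r| / 2 : ℝ) : ℂ) + ((√3 / 2 * r : ℝ) : ℂ) * Complex.I := by
  rw [muR]
  rcases lt_trichotomy r 0 with h | h | h
  · rw [Real.sign_of_neg h, abs_of_neg h, neg_one_mul, exp_neg_pi_third]
    apply Complex.ext
    · simp [rayDir_re]
      ring
    · simp [rayDir_im]
      ring
  · simp [h]
  · rw [Real.sign_of_pos h, abs_of_pos h, one_mul, exp_pi_third]
    apply Complex.ext
    · simp [rayDir_re]
      ring
    · simp [rayDir_im]
      ring

theorem lamL_eq (r : ℝ) : lamL r =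
    ((-1 - |r| / 2 : ℝ) : ℂ) + ((√3 / 2 * r : ℝ) : ℂ) * Complex.I := by
  rw [lamL]
  rcases lt_trichotomy r 0 with h | h | h
  · rw [Real.sign_of_neg h, abs_of_neg h, neg_one_mul, neg_neg, exp_pi_third]
    apply Complex.ext
    · simp [rayDir_re]
      ring
    · simp [rayDir_im]
      ring
  · simp [h]
  · rw [Real.sign_of_pos h, abs_of_pos h, one_mul, exp_neg_pi_third]
    apply Complex.ext
    · simp [rayDir_re]
      ring
    · simp [rayDir_im]
      ring

theorem rightPath_of_le {R r : ℝ} (h : |r| ≤ R) : rightPath R r = muR r := by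
  rw [rightPath, muR_eq, min_eq_left h]

theorem dmuR_eq {r : ℝ} (hr : r ≠ 0) :
    dmuR r = ((Real.sign r / 2 : ℝ) : ℂ) + ((√3 / 2 : ℝ) : ℂ) * Complex.I := by
  rw [dmuR]
  rcases hr.lt_or_gt with h | h
  · rw [Real.sign_of_neg h, neg_one_mul, exp_neg_pi_third]
    apply Complex.ext
    · simp [rayDir_re]
      ring
    · simp [rayDir_im]
  · rw [Real.sign_of_pos h, one_mul, exp_pi_third]
    apply Complex.ext
    · simp [rayDir_re]
    · simp [rayDir_im]

theorem dlamL_eq {r : ℝ} (hr : r ≠ 0) :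
    dlamL r = ((-(Real.sign r / 2) : ℝ) : ℂ) + ((√3 / 2 : ℝ) : ℂ) * Complex.I := by
  rw [dlamL]
  rcases hr.lt_or_gt with h | h
  · rw [Real.sign_of_neg h, neg_one_mul, neg_neg, exp_pi_third]
    apply Complex.ext
    · simp [rayDir_re]
      norm_num
    · simp [rayDir_im]
  · rw [Real.sign_of_pos h, one_mul, exp_neg_pi_third]
    apply Complex.ext
    · simp [rayDir_re]
      norm_num
    · simp [rayDir_im]

theorem exists_cubic_le_linear {K : ℝ} (hK : 0 ≤ K) :
    ∃ C : ℝ, 0 ≤ C ∧ ∀ κ r : ℝ, 2 ≤ κ → κ ≤ 4 → 0 ≤ r →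
      1 + κ * (12 * r - r ^ 3 / 2400) ≤ C - K * r := by
  set a : ℝ := 48 + K with ha
  have ha0 : 0 ≤ a := by positivity
  set b : ℝ := √(400 * a) with hb
  have hb0 : 0 ≤ b := Real.sqrt_nonneg _
  have hb2 : b ^ 2 = 400 * a := Real.sq_sqrt (by positivity)
  refine ⟨1 + b ^ 3 / 600, by positivity, fun κ r h2 h4 hr => ?_⟩
  have h : 0 ≤ (r - b) ^ 2 * (r + 2 * b) := by positivity
  have h' : (r - b) ^ 2 * (r + 2 * b) = r ^ 3 - 3 * b ^ 2 * r + 2 * b ^ 3 := by ring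
  rw [h', hb2] at h
  have h5 : 0 ≤ r ^ 3 := by positivity
  nlinarith

theorem abs_re_phase_le {p : ℝ} (hp : 0 < p) (hp1 : p ≤ 1 / 2) {e : ℝ} (he : |e| ≤ 1 / 100) :
    |(phase p e).re| ≤ |e| ^ 3 / 4 := by
  have h1 := norm_phase_sub_cubic_le hp (by linarith) (w := (e : ℂ)) (by
    rw [Complex.norm_real, Real.norm_eq_abs]; linarith)
  have h2 : ‖((1 - p) / 6 * (e : ℂ) ^ 3)‖ ≤ |e| ^ 3 / 6 := by
    have : ((1 - p) / 6 * (e : ℂ) ^ 3) = (((1 - p) / 6 * e ^ 3 : ℝ) : ℂ) := by push_cast; ring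
    rw [this, Complex.norm_real, Real.norm_eq_abs, abs_mul, abs_pow, abs_of_nonneg (by linarith)]
    have : 0 ≤ |e| ^ 3 := by positivity
    nlinarith
  rw [Complex.norm_real, Real.norm_eq_abs] at h1
  have h3 : ‖phase p e‖ ≤ ‖((1 - p) / 6 * (e : ℂ) ^ 3)‖ + 4 * |e| ^ 4 :=
    (norm_le_norm_add_norm_sub ((1 - p) / 6 * (e : ℂ) ^ 3) _).trans (by
      rw [norm_sub_rev ((1 - p) / 6 * (e : ℂ) ^ 3)]
      gcongr)
  have h4 : |e| ^ 4 ≤ |e| ^ 3 * (1 / 100) := by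
    rw [pow_succ]
    gcongr
  have h5 : 0 ≤ |e| ^ 3 := by positivity
  linarith [Complex.abs_re_le_norm (phase p e)]

theorem exists_right_phase_le {K : ℝ} (hK : 0 ≤ K) :
    ∃ C : ℝ, 0 ≤ C ∧ ∀ p N e : ℝ, 0 < p → p ≤ 1 / 2 → 0 < e → e ≤ 1 / 100 → 2 ≤ N * e ^ 3 →
      N * e ^ 3 ≤ 4 → 500 * K ≤ N * e → ∀ r : ℝ,
      N * (phase p (e * rightPath (9 / 10 / e) r)).re ≤ C - K * |r| := by
  obtain ⟨C, hC, h⟩ := exists_cubic_le_linear hK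
  refine ⟨C, hC, fun p N e hp hp1 he he1 h2 h4 hNK => ?_⟩
  have he3 : 0 < e ^ 3 := by positivity
  have hN : 0 < N := by
    by_contra hN
    nlinarith [mul_nonneg (sub_nonneg.2 (not_lt.1 hN)) he3.le]
  have s3 : √3 ^ 2 = 3 := Real.sq_sqrt (by norm_num)
  have s3' : 173 / 100 ≤ √3 := Real.le_sqrt_of_sq_le (by norm_num)
  have s3'' : √3 ≤ 174 / 100 := by
    rw [Real.sqrt_le_left (by norm_num)]
    norm_num
  have hRe : 9 / 10 / e * e = 9 / 10 := by field_simp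
  have near : ∀ r : ℝ, 0 ≤ r → r ≤ 9 / 10 / e →
      N * (phase p (e + r * (e * rayDir))).re ≤ C - K * r := by
    intro r hr hrR
    have h0 : N * (phase p (e : ℂ)).re ≤ 1 := by
      have := (le_abs_self _).trans (abs_re_phase_le hp hp1 (e := e) (by rwa [abs_of_pos he]))
      rw [abs_of_pos he] at this
      calc N * (phase p (e : ℂ)).re ≤ N * (e ^ 3 / 4) := by gcongr
        _ ≤ 1 := by linarith
    have hB : ∀ x : ℝ, HasDerivAt (fun x => N * e ^ 3 * (12 * x - x ^ 3 / 2400))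
        (N * e ^ 3 * (12 - x ^ 2 / 800)) x := by
      intro x
      have := (((hasDerivAt_id x).const_mul 12).sub
        ((hasDerivAt_pow 3 x).div_const 2400)).const_mul (N * e ^ 3)
      refine this.congr_deriv ?_
      push_cast
      ring
    have := mul_re_phase_sub_le hp (by linarith) (z := e) (d := e * rayDir) (c := N) hr hB
      (fun x hx => Or.inr (by
        simp [rayDir_re]
        have : 0 ≤ x * (e * (1 / 2)) := by have := hx.1; positivity
        linarith)) (fun x hx => by
        have hxe : x * e ≤ 9 / 10 := by
          rw [← hRe]
          exact mul_le_mul_of_nonneg_right (hx.2.trans hrR) he.le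
        have := re_rayDir_mul_phaseDeriv_le hp hp1 he.le he1 (mul_nonneg hx.1 he.le) hxe
        have e1 : (e : ℂ) + ((x * e : ℝ) : ℂ) * rayDir = e + x * (e * rayDir) := by
          push_cast; ring
        rw [e1] at this
        rw [mul_assoc, Complex.re_ofReal_mul]
        calc _ ≤ N * (e * (12 * e ^ 2 - (x * e) ^ 2 / 800)) := by gcongr
          _ = _ := by ring)
    simp only [Complex.ofReal_zero, zero_mul, add_zero] at this
    have := h (N * e ^ 3) r h2 h4 hr
    norm_num at *
    linarith
  have pos : ∀ r : ℝ, 0 ≤ r →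
      N * (phase p (e * rightPath (9 / 10 / e) r)).re ≤ C - K * r := by
    intro r hr
    rcases le_or_gt r (9 / 10 / e) with h | h
    · have e1 : (e : ℂ) * rightPath (9 / 10 / e) r = e + r * (e * rayDir) := by
        rw [rightPath, abs_of_nonneg hr, min_eq_left h]
        apply Complex.ext
        · simp [rayDir_re]; ring
        · simp [rayDir_im]; ring
      rw [e1]
      exact near r hr h
    · set R := 9 / 10 / e with hR
      have hR0 : 0 ≤ R := by positivity
      have e1 : ∀ x : ℝ, R ≤ x → (e : ℂ) * rightPath R x =
          ((e + 9 / 20 : ℝ) : ℂ) + x * ((e * (√3 / 2) : ℝ) * Complex.I) := by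
        intro x hx
        rw [rightPath, abs_of_nonneg (hR0.trans hx), min_eq_right hx]
        apply Complex.ext
        · simp
          linarith
        · simp
          ring
      have e2 : ((e + 9 / 20 : ℝ) : ℂ) + R * ((e * (√3 / 2) : ℝ) * Complex.I) =
          e + R * (e * rayDir) := by
        apply Complex.ext
        · simp [rayDir_re]
          linarith
        · simp [rayDir_im]
      have hB : ∀ x : ℝ, HasDerivAt (fun x => -K * x) (-K) x := by
        intro x
        simpa using (hasDerivAt_id x).const_mul (-K)
      have := mul_re_phase_sub_le hp (by linarith) (z := ((e + 9 / 20 : ℝ) : ℂ))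
        (d := (e * (√3 / 2) : ℝ) * Complex.I) (c := N) h.le hB
        (fun x hx => Or.inr (by
          simp
          linarith)) (fun x hx => by
          have hxe : 9 / 10 ≤ x * e := by
            rw [← hRe]
            exact mul_le_mul_of_nonneg_right hx.1 he.le
          have hi := im_phaseDeriv_ge hp hp1 (w := ((e + 9 / 20 : ℝ) : ℂ) +
            x * ((e * (√3 / 2) : ℝ) * Complex.I)) (by simp; linarith) (by simp; linarith)
            (by simp; nlinarith) (by
              rw [← sq_le_sq₀ (by norm_num) (norm_nonneg _), ← Complex.normSq_eq_norm_sq,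
                Complex.normSq_apply]
              have h1 : 81 / 100 * (3 / 4) ≤ (x * (e * (√3 / 2))) ^ 2 := by
                have : (x * (e * (√3 / 2))) ^ 2 = (x * e) ^ 2 * (3 / 4) := by
                  linear_combination (x * e) ^ 2 / 4 * s3
                rw [this]
                nlinarith
              simp
              nlinarith)
          generalize phaseDeriv p _ = D at hi ⊢
          have e3 : (((e * (√3 / 2) : ℝ) : ℂ) * Complex.I * D).re = -(e * (√3 / 2) * D.im) := by
            simp
          rw [e3]
          have h7 : e * (√3 / 2) * (1 / 400) ≤ e * (√3 / 2) * D.im := by gcongr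
          have h8 : e / 500 ≤ e * (√3 / 2) * (1 / 400) := by nlinarith
          have h9 : N * (e / 500) ≤ N * (e * (√3 / 2) * D.im) := by
            gcongr
            exact h8.trans h7
          linarith)
      rw [e2] at this
      rw [e1 r h.le]
      linarith [near R hR0 le_rfl]
  intro r
  rcases le_total 0 r with h | h
  · rw [abs_of_nonneg h]
    exact pos r h
  · have h' := pos (-r) (by linarith)
    rw [abs_of_nonpos h]
    have e1 : (e : ℂ) * rightPath (9 / 10 / e) r =
        (starRingEnd ℂ) (e * rightPath (9 / 10 / e) (-r)) := by
      apply Complex.ext <;> simp only [rightPath, abs_neg, Complex.conj_re, Complex.conj_im,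
        Complex.re_ofReal_mul, Complex.im_ofReal_mul, Complex.add_re, Complex.add_im,
        Complex.ofReal_re,
        Complex.ofReal_im, Complex.I_re, Complex.I_im] <;> ring
    have hre : 0 ≤ ((e : ℂ) * rightPath (9 / 10 / e) (-r)).re := by
      simp [rightPath]
      positivity
    rw [e1, phase_conj, Complex.conj_re]
    · exact h'
    · left
      rw [Complex.add_re, Complex.one_re, Complex.re_ofReal_mul]
      positivity
    · left
      rw [Complex.add_re, Complex.one_re]
      positivity

theorem exists_left_phase_le {K : ℝ} (hK : 0 ≤ K) :
    ∃ C : ℝ, 0 ≤ C ∧ ∀ p N e : ℝ, 0 < p → p ≤ 1 / 2 → 0 < e → e ≤ 1 / 100 → 2 ≤ N * e ^ 3 →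
      N * e ^ 3 ≤ 4 →
      (∀ q : ℝ, |q| ≤ 9 / 10 / e → -N * (phase p (e * lamL q)).re ≤ C - K * |q|) ∧
      ∀ a : ℝ, a ≤ -e - 9 / 20 → -(101 / 100) ≤ p * a →
        -N * (phase p (a + ((√3 / 2 * (9 / 10) : ℝ) : ℂ) * Complex.I)).re ≤
          C - K * (9 / 10 / e) := by
  obtain ⟨C, hC, h⟩ := exists_cubic_le_linear hK
  refine ⟨C, hC, fun p N e hp hp1 he he1 h2 h4 => ?_⟩
  have he3 : 0 < e ^ 3 := by positivity
  have hN : 0 < N := by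
    by_contra hN
    nlinarith [mul_nonneg (sub_nonneg.2 (not_lt.1 hN)) he3.le]
  have s3 : √3 ^ 2 = 3 := Real.sq_sqrt (by norm_num)
  have hRe : 9 / 10 / e * e = 9 / 10 := by field_simp
  have near : ∀ r : ℝ, 0 ≤ r → r ≤ 9 / 10 / e →
      -N * (phase p (((-e : ℝ) : ℂ) + r * (e * (rayDir - 1)))).re ≤ C - K * r := by
    intro r hr hrR
    have h0 : -N * (phase p ((-e : ℝ) : ℂ)).re ≤ 1 := by
      have := (neg_le_of_abs_le (abs_re_phase_le hp hp1 (e := -e) (by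
        rwa [abs_neg, abs_of_pos he])))
      rw [abs_neg, abs_of_pos he] at this
      have : N * -(e ^ 3 / 4) ≤ N * (phase p ((-e : ℝ) : ℂ)).re := by gcongr
      linarith
    have hB : ∀ x : ℝ, HasDerivAt (fun x => N * e ^ 3 * (12 * x - x ^ 3 / 2400))
        (N * e ^ 3 * (12 - x ^ 2 / 800)) x := by
      intro x
      have := (((hasDerivAt_id x).const_mul 12).sub
        ((hasDerivAt_pow 3 x).div_const 2400)).const_mul (N * e ^ 3)
      refine this.congr_deriv ?_
      push_cast
      ring
    have := mul_re_phase_sub_le hp (by linarith) (z := ((-e : ℝ) : ℂ)) (d := e * (rayDir - 1))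
      (c := -N) hr hB
      (fun x hx => Or.inr (by
        have hxe : x * e ≤ 9 / 10 := by
          rw [← hRe]
          exact mul_le_mul_of_nonneg_right (hx.2.trans hrR) he.le
        simp [rayDir_re]
        linarith)) (fun x hx => by
        have hxe : x * e ≤ 9 / 10 := by
          rw [← hRe]
          exact mul_le_mul_of_nonneg_right (hx.2.trans hrR) he.le
        have := re_neg_conj_rayDir_mul_phaseDeriv_ge hp hp1 he.le he1 (mul_nonneg hx.1 he.le) hxe
        have e1 : -(e : ℂ) + ((x * e : ℝ) : ℂ) * (rayDir - 1) =
            ((-e : ℝ) : ℂ) + x * (e * (rayDir - 1)) := by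
          push_cast; ring
        rw [e1] at this
        rw [mul_assoc, Complex.re_ofReal_mul]
        have h5 : N * (e * ((x * e) ^ 2 / 800 - 12 * e ^ 2)) ≤ N * (e * ((rayDir - 1) *
          phaseDeriv p (((-e : ℝ) : ℂ) + x * (e * (rayDir - 1)))).re) := by gcongr
        have h6 : N * (e * ((x * e) ^ 2 / 800 - 12 * e ^ 2)) =
            -(N * e ^ 3 * (12 - x ^ 2 / 800)) := by
          ring
        linarith)
    have h7 := h (N * e ^ 3) r h2 h4 hr
    rw [Complex.ofReal_zero, zero_mul, add_zero] at this
    norm_num at *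
    linarith
  have pos : ∀ q : ℝ, 0 ≤ q → q ≤ 9 / 10 / e →
      -N * (phase p (e * lamL q)).re ≤ C - K * q := by
    intro q hq hqR
    have e1 : (e : ℂ) * lamL q = ((-e : ℝ) : ℂ) + q * (e * (rayDir - 1)) := by
      rw [lamL_eq, abs_of_nonneg hq]
      apply Complex.ext
      · simp [rayDir_re]; ring
      · simp [rayDir_im]; ring
    rw [e1]
    exact near q hq hqR
  constructor
  · intro q hq
    rcases le_total 0 q with h | h
    · rw [abs_of_nonneg h] at hq ⊢
      exact pos q h hq
    · rw [abs_of_nonpos h] at hq ⊢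
      have h' := pos (-q) (by linarith) hq
      have e1 : (e : ℂ) * lamL q = (starRingEnd ℂ) (e * lamL (-q)) := by
        apply Complex.ext <;> simp only [lamL_eq, abs_neg, Complex.conj_re, Complex.conj_im,
          Complex.re_ofReal_mul, Complex.im_ofReal_mul, Complex.add_re, Complex.add_im,
          Complex.ofReal_re, Complex.ofReal_im, Complex.I_re, Complex.I_im] <;> ring
      have hqe : -q * e ≤ 9 / 10 := by
        rw [← hRe]
        exact mul_le_mul_of_nonneg_right hq he.le
      have hre : -1 < ((e : ℂ) * lamL (-q)).re := by
        simp [lamL_eq, abs_of_nonpos h]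
        linarith
      rw [e1, phase_conj, Complex.conj_re]
      · exact h'
      · left
        rw [Complex.add_re, Complex.one_re, Complex.re_ofReal_mul]
        nlinarith
      · left
        rw [Complex.add_re, Complex.one_re]
        linarith
  · intro a ha ha1
    have hc := near (9 / 10 / e) (by positivity) le_rfl
    have e1 : ((-e : ℝ) : ℂ) + ((9 / 10 / e : ℝ) : ℂ) * (e * (rayDir - 1)) =
        ((√3 / 2 * (9 / 10) : ℝ) : ℂ) * Complex.I + ((-e - 9 / 20 : ℝ) : ℂ) * 1 := by
      apply Complex.ext
      · simp [rayDir_re]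
        field_simp
        ring
      · simp [rayDir_im]
        field_simp
    have s3p : 0 < √3 := by positivity
    have := mul_re_phase_sub_le hp (by linarith) (z := ((√3 / 2 * (9 / 10) : ℝ) : ℂ) * Complex.I)
      (d := 1) (c := N) (B := fun _ => 0) (B' := fun _ => 0) ha (fun x => hasDerivAt_const x 0)
      (fun x hx => Or.inl (by
        simp
        )) (fun x hx => by
        have := re_phaseDeriv_nonpos hp hp1 (w := ((√3 / 2 * (9 / 10) : ℝ) : ℂ) * Complex.I + x * 1)
          (by simp; linarith [hx.2]) (by simp; nlinarith [hx.1]) (by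
            simp
            nlinarith)
        rw [one_mul]
        exact mul_nonpos_of_nonneg_of_nonpos hN.le this)
    rw [e1] at hc
    rw [mul_one, mul_one] at this
    rw [mul_one] at hc
    rw [add_comm (a : ℂ)]
    linarith

/-- The scale of the soft edge window in the variable of `ratio`. -/
noncomputable def edgeScale (M n : ℕ) : ℝ := (2 * (M + 1) / n) ^ (1 / 3 : ℝ)

/-- The scale of the soft edge window in the variable of `weight`. -/
noncomputable def edgeStep (M n : ℕ) : ℝ := critScale M n * edgeScale M n

theorem edgeScale_pos (M : ℕ) {n : ℕ} (hn : 1 ≤ n) : 0 < edgeScale M n := by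
  have : (0 : ℝ) < n := by exact_mod_cast hn
  rw [edgeScale]
  positivity

theorem edgeScale_pow_three (M n : ℕ) : edgeScale M n ^ 3 = 2 * (M + 1) / n := by
  rw [edgeScale, ← Real.rpow_natCast, ← Real.rpow_mul (by positivity)]
  norm_num

theorem critScale_mul_edgeScale_pow_three {M n : ℕ} (hM : 1 ≤ M) (hn : 1 ≤ n) :
    critScale M n * edgeScale M n ^ 3 = 2 * (M + 1) / M := by
  have h1 : (0 : ℝ) < n := by exact_mod_cast hn
  have h2 : (0 : ℝ) < M := by exact_mod_cast hM
  rw [edgeScale_pow_three, critScale]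
  field_simp

theorem tendsto_edgeScale (M : ℕ) : Tendsto (edgeScale M) atTop (𝓝 0) := by
  have h1 : Tendsto (fun n : ℕ => 2 * ((M : ℝ) + 1) / n) atTop (𝓝 0) :=
    tendsto_const_div_atTop_nhds_zero_nat _
  have h2 := h1.rpow_const (p := (1 / 3 : ℝ)) (Or.inr (by norm_num))
  rwa [Real.zero_rpow (by norm_num)] at h2

theorem tendsto_edgeStep {M : ℕ} (hM : 1 ≤ M) : Tendsto (edgeStep M) atTop atTop := by
  have hMr : (0 : ℝ) < M := by exact_mod_cast hM
  have h1 : Tendsto (fun n => edgeScale M n ^ 2) atTop (𝓝[>] 0) := by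
    refine tendsto_nhdsWithin_iff.2 ⟨?_, ?_⟩
    · simpa using (tendsto_edgeScale M).pow 2
    · filter_upwards [eventually_ge_atTop 1] with n hn
      have := edgeScale_pos M hn
      exact mem_Ioi.2 (by positivity)
  have h2 := (tendsto_inv_nhdsGT_zero.comp h1).const_mul_atTop
    (show 0 < 2 * ((M : ℝ) + 1) / M by positivity)
  refine h2.congr' ?_
  filter_upwards [eventually_ge_atTop 1] with n hn
  have h3 := edgeScale_pos M hn
  rw [Function.comp_apply, ← critScale_mul_edgeScale_pow_three hM hn, edgeStep]
  field_simp

theorem edgeStep_pos {M n : ℕ} (hM : 1 ≤ M) (hn : 1 ≤ n) : 0 < edgeStep M n :=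
  mul_pos (critScale_pos hM hn) (edgeScale_pos M hn)

theorem eventually_edgeScale {M : ℕ} (hM : 1 ≤ M) (B : ℝ) :
    ∀ᶠ n in atTop, 1 ≤ n ∧ 0 < edgeScale M n ∧ edgeScale M n ≤ 1 / 100 ∧
      (M + 1) * edgeScale M n * B ≤ 1 ∧ 2 ≤ critScale M n * edgeScale M n ^ 3 ∧
      critScale M n * edgeScale M n ^ 3 ≤ 4 ∧ B ≤ edgeStep M n := by
  have hMr : (1 : ℝ) ≤ M := by exact_mod_cast hM
  have h1 : Tendsto (fun n => (M + 1) * edgeScale M n * B) atTop (𝓝 0) := by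
    simpa using ((tendsto_edgeScale M).const_mul ((M : ℝ) + 1)).mul_const B
  filter_upwards [eventually_ge_atTop 1, (tendsto_edgeScale M).eventually_le_const
    (show (0 : ℝ) < 1 / 100 by norm_num), h1.eventually_le_const one_pos,
    (tendsto_edgeStep hM).eventually_ge_atTop B] with n hn a b c
  refine ⟨hn, edgeScale_pos M hn, a, b, ?_, ?_, c⟩
  · rw [critScale_mul_edgeScale_pow_three hM hn, le_div_iff₀ (by positivity)]
    linarith
  · rw [critScale_mul_edgeScale_pow_three hM hn, div_le_iff₀ (by positivity)]
    linarith

/-- The exponent recording the deviation `ξ` from the soft edge. -/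
noncomputable def edgeExponent (M n : ℕ) (ξ : ℝ) (z : ℂ) : ℂ :=
  (critPoint M n + edgeStep M n * z) * (Real.log (1 + ξ / edgeStep M n) : ℝ) -
    critPoint M n * (ξ / edgeStep M n : ℝ)

theorem abs_log_one_add_sub_le {u : ℝ} (hu : |u| ≤ 1 / 2) : |Real.log (1 + u) - u| ≤ u ^ 2 := by
  have h := Complex.norm_log_one_add_sub_self_le (z := (u : ℂ))
    (by rw [Complex.norm_real, Real.norm_eq_abs]; linarith)
  have hpos : 0 ≤ 1 + u := by linarith [neg_abs_le u]
  rw [show (1 : ℂ) + u = ((1 + u : ℝ) : ℂ) by push_cast; ring, ← Complex.ofReal_log hpos,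
    ← Complex.ofReal_sub, Complex.norm_real, Complex.norm_real, Real.norm_eq_abs, Real.norm_eq_abs,
    sq_abs] at h
  refine h.trans ?_
  have : (1 - |u|)⁻¹ ≤ 2 := by
    rw [inv_le_comm₀ (by linarith) (by norm_num)]
    linarith
  nlinarith [sq_nonneg u]

theorem norm_edgeExponent_sub_le {M n : ℕ} (hM : 1 ≤ M) (hn : 1 ≤ n) {ξ : ℝ}
    (hξ : |ξ| ≤ edgeStep M n / 2) (z : ℂ) :
    ‖edgeExponent M n ξ z - ξ * z‖ ≤
      ((M + 1) * edgeScale M n / (critScale M n * edgeScale M n ^ 3) + ‖z‖ / edgeStep M n) *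
        ξ ^ 2 := by
  have hs := edgeStep_pos hM hn
  have hN := critScale_pos hM hn
  have he := edgeScale_pos M hn
  have hsc : (edgeStep M n : ℂ) ≠ 0 := by exact_mod_cast hs.ne'
  set u := ξ / edgeStep M n with hu
  have hu1 : |u| ≤ 1 / 2 := by
    rw [hu, abs_div, abs_of_pos hs, div_le_iff₀ hs]
    linarith
  have hl := abs_log_one_add_sub_le hu1
  have e1 : edgeExponent M n ξ z - ξ * z =
      (critPoint M n + edgeStep M n * z) * ((Real.log (1 + u) - u : ℝ) : ℂ) := by
    rw [edgeExponent, ← hu, show (ξ : ℂ) = edgeStep M n * (u : ℂ) by rw [hu]; push_cast; field_simp]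
    push_cast
    ring
  have hT : 0 ≤ critPoint M n := by rw [critPoint]; positivity
  have e2 : ‖(critPoint M n + edgeStep M n * z : ℂ)‖ ≤ critPoint M n + edgeStep M n * ‖z‖ := by
    refine (norm_add_le _ _).trans_eq ?_
    rw [norm_mul, Complex.norm_real, Complex.norm_real, Real.norm_eq_abs, Real.norm_eq_abs,
      abs_of_nonneg hT, abs_of_pos hs]
  rw [e1, norm_mul, Complex.norm_real, Real.norm_eq_abs]
  calc ‖(critPoint M n + edgeStep M n * z : ℂ)‖ * |Real.log (1 + u) - u|
      ≤ (critPoint M n + edgeStep M n * ‖z‖) * u ^ 2 := by gcongr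
    _ = _ := by
      rw [hu, critPoint, edgeStep]
      field_simp

theorem edgeExponent_re (M n : ℕ) (ξ : ℝ) (z : ℂ) :
    (edgeExponent M n ξ z).re = (edgeExponent M n ξ z.re).re := by
  simp [edgeExponent]

theorem edgeExponent_conj (M n : ℕ) (ξ : ℝ) (z : ℂ) :
    edgeExponent M n ξ ((starRingEnd ℂ) z) = (starRingEnd ℂ) (edgeExponent M n ξ z) := by
  simp [edgeExponent, Complex.conj_ofReal]

theorem eventually_abs_re_edgeExponent_le {M : ℕ} (hM : 1 ≤ M) {H : ℝ} (hH : 0 ≤ H) :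
    ∀ᶠ n in atTop, ∀ ξ : ℝ, |ξ| ≤ H → ∀ z : ℂ,
      |(edgeExponent M n ξ z).re| ≤ 1 + (1 + H) * |z.re| := by
  filter_upwards [eventually_edgeScale hM (2 * H + H ^ 2)] with n ⟨hn, he, he1, hB, h2, h4, hs⟩
    ξ hξ z
  have hs0 := edgeStep_pos hM hn
  have h1 := norm_edgeExponent_sub_le hM hn (ξ := ξ) (by nlinarith) z.re
  have hξ2 : ξ ^ 2 ≤ H ^ 2 := by rw [← sq_abs]; gcongr
  rw [edgeExponent_re]
  have h3 := (Complex.abs_re_le_norm _).trans h1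
  have h5 : (M + 1) * edgeScale M n / (critScale M n * edgeScale M n ^ 3) ≤
      (M + 1) * edgeScale M n / 2 := by gcongr
  have h6 : (M + 1) * edgeScale M n / (critScale M n * edgeScale M n ^ 3) * ξ ^ 2 ≤ 1 := by
    have : 0 ≤ (M + 1) * edgeScale M n := by positivity
    nlinarith [sq_nonneg ξ, mul_nonneg this hH]
  have h7 : ‖(z.re : ℂ)‖ / edgeStep M n * ξ ^ 2 ≤ |z.re| := by
    rw [Complex.norm_real, Real.norm_eq_abs, div_mul_eq_mul_div, div_le_iff₀ hs0]
    gcongr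
    nlinarith
  have h8 : |((ξ : ℂ) * z.re).re| ≤ H * |z.re| := by
    rw [← Complex.ofReal_mul, Complex.ofReal_re, abs_mul]
    gcongr
  rw [Complex.sub_re] at h3
  have := abs_le.1 (h3.trans (add_mul _ _ _).le)
  have := abs_le.1 h8
  exact abs_le.2 ⟨by linarith, by linarith⟩

theorem weight_conj (M : ℕ) (ν : ℕ → ℕ) (n : ℕ) (z : ℂ) :
    weight M ν n ((starRingEnd ℂ) z) = (starRingEnd ℂ) (weight M ν n z) := by
  rw [weight, weight, map_mul, map_prod, map_prod]
  congr 1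
  · simp
  · refine Finset.prod_congr rfl fun j _ => ?_
    rw [← Complex.Gamma_conj]
    simp

theorem ratio_conj (M : ℕ) (ν : ℕ → ℕ) (n : ℕ) (w : ℂ) :
    ratio M ν n ((starRingEnd ℂ) w) = (starRingEnd ℂ) (ratio M ν n w) := by
  have h0 : (starRingEnd ℂ) (weight M ν n (critPoint M n)) = weight M ν n (critPoint M n) := by
    rw [← weight_conj, Complex.conj_ofReal]
  rw [ratio, ratio, map_mul, map_div₀, h0, ← weight_conj, ← Complex.exp_conj]
  simp [Complex.conj_ofReal]

theorem tendsto_ratio {M : ℕ} (hM : 1 ≤ M) (ν : ℕ → ℕ) (z : ℂ) :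
    Tendsto (fun n => ratio M ν n (edgeScale M n * z)) atTop (𝓝 (Complex.exp (z ^ 3 / 3))) := by
  wlog hz : 0 ≤ z.im generalizing z with hw
  · have h := hw ((starRingEnd ℂ) z) (by rw [Complex.conj_im]; linarith)
    have h' := (Complex.continuous_conj.tendsto _).comp h
    convert h' using 1
    · ext n
      rw [Function.comp_apply, ← ratio_conj]
      simp [Complex.conj_ofReal]
    · rw [← Complex.exp_conj]
      simp [map_ofNat]
  have hMr : (1 : ℝ) ≤ M := by exact_mod_cast hM
  obtain ⟨n₀, C, hn₀, hC, h⟩ := exists_ratio_eq hM ν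
  set p : ℝ := 1 / (M + 1) with hp
  have p0 : 0 < p := by positivity
  have p1 : p ≤ 1 / 2 := by
    rw [hp]
    gcongr
    linarith
  have hw0 : Tendsto (fun n => (edgeScale M n : ℂ) * z) atTop (𝓝 0) := by
    have : Tendsto (fun n => (edgeScale M n : ℂ)) atTop (𝓝 0) := by
      exact_mod_cast (Complex.continuous_ofReal.tendsto _).comp (tendsto_edgeScale M)
    simpa using this.mul_const z
  have hw1 : Tendsto (fun n => ‖(edgeScale M n : ℂ) * z‖) atTop (𝓝 0) := by
    simpa using hw0.norm
  have hreg : ∀ᶠ n in atTop, StirlingRegion M n (edgeScale M n * z) := by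
    filter_upwards [eventually_ge_atTop 1, hw1.eventually_le_const
        (show (0 : ℝ) < 1 / 2 by norm_num)]
      with n hn h1
    have hN := critScale_pos hM hn
    have he := edgeScale_pos M hn
    have h2 := (abs_le.1 (Complex.abs_re_le_norm (edgeScale M n * z))).1
    refine ⟨?_, ?_, Or.inl (by linarith)⟩
    · rw [Complex.im_ofReal_mul]
      exact mul_nonneg he.le hz
    · rw [critPoint]
      nlinarith
  have key : ∀ n, ∃ e : ℂ, n₀ ≤ n → StirlingRegion M n (edgeScale M n * z) → ‖e‖ ≤ C / n ∧
      ratio M ν n (edgeScale M n * z) =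
        Complex.exp (critScale M n * phase p (edgeScale M n * z)) *
          slowFactor M ν n (edgeScale M n * z) e := by
    intro n
    by_cases h1 : n₀ ≤ n ∧ StirlingRegion M n (edgeScale M n * z)
    · obtain ⟨e, he⟩ := h n h1.1 _ h1.2
      exact ⟨e, fun _ _ => he⟩
    · exact ⟨0, fun a b => absurd ⟨a, b⟩ h1⟩
  choose e he using key
  have he0 : Tendsto e atTop (𝓝 0) := by
    refine squeeze_zero_norm' ?_ (tendsto_const_div_atTop_nhds_zero_nat C)
    filter_upwards [eventually_ge_atTop n₀, hreg] with n h1 h2 using (he n h1 h2).1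
  have hslow := tendsto_slowFactor hM ν hw0 he0
  have hphase : Tendsto (fun n => (critScale M n : ℂ) * phase p (edgeScale M n * z)) atTop
      (𝓝 (z ^ 3 / 3)) := by
    rw [tendsto_iff_norm_sub_tendsto_zero]
    have hlim : Tendsto (fun n => 16 * ‖z‖ ^ 4 * edgeScale M n) atTop (𝓝 0) := by
      simpa using (tendsto_edgeScale M).const_mul (16 * ‖z‖ ^ 4)
    refine squeeze_zero' (Eventually.of_forall fun n => norm_nonneg _) ?_ hlim
    filter_upwards [eventually_edgeScale hM 0,
      hw1.eventually_le_const (show (0 : ℝ) < 1 / 2 by norm_num)] with n ⟨hn, h1, _, _, _, h4, _⟩ h2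
    have hN := critScale_pos hM hn
    have h3 := norm_phase_sub_cubic_le p0 p1 h2
    have e1 : (critScale M n : ℂ) * ((1 - p) / 6 * (edgeScale M n * z) ^ 3) = z ^ 3 / 3 := by
      have h5 : critScale M n * ((1 - p) / 6) * edgeScale M n ^ 3 = 1 / 3 := by
        rw [mul_right_comm, critScale_mul_edgeScale_pow_three hM hn, hp]
        field_simp
        ring
      have h6 : (critScale M n : ℂ) * ((1 - p) / 6) * (edgeScale M n : ℂ) ^ 3 = 1 / 3 := by
        have := congrArg ((↑) : ℝ → ℂ) h5
        push_cast at this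
        exact this
      linear_combination z ^ 3 * h6
    rw [← e1, ← mul_sub, norm_mul, Complex.norm_real, Real.norm_eq_abs, abs_of_pos hN]
    calc critScale M n * ‖phase p (edgeScale M n * z) - (1 - p) / 6 * (edgeScale M n * z) ^ 3‖
        ≤ critScale M n * (4 * ‖(edgeScale M n * z : ℂ)‖ ^ 4) := by gcongr
      _ = 4 * (critScale M n * edgeScale M n ^ 3) * ‖z‖ ^ 4 * edgeScale M n := by
        rw [norm_mul, Complex.norm_real, Real.norm_eq_abs, abs_of_pos h1]
        ring
      _ ≤ 4 * 4 * ‖z‖ ^ 4 * edgeScale M n := by gcongr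
      _ = _ := by ring
  have := ((Complex.continuous_exp.tendsto _).comp hphase).mul hslow
  rw [mul_one] at this
  refine this.congr' ?_
  filter_upwards [eventually_ge_atTop n₀, hreg] with n h1 h2
  exact (he n h1 h2).2.symm

/-- The normalised weight at the soft edge, in the local variable of the Airy contours. -/
noncomputable def edgeWeight (M : ℕ) (ν : ℕ → ℕ) (n : ℕ) (ξ : ℝ) (z : ℂ) : ℂ :=
  ratio M ν n (edgeScale M n * z) * Complex.exp (-edgeExponent M n ξ z)

theorem edgeWeight_conj (M : ℕ) (ν : ℕ → ℕ) (n : ℕ) (ξ : ℝ) (z : ℂ) :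
    edgeWeight M ν n ξ ((starRingEnd ℂ) z) = (starRingEnd ℂ) (edgeWeight M ν n ξ z) := by
  rw [edgeWeight, edgeWeight, map_mul, ← ratio_conj, edgeExponent_conj, ← Complex.exp_conj]
  simp [Complex.conj_ofReal]

theorem tendsto_edgeWeight {M : ℕ} (hM : 1 ≤ M) (ν : ℕ → ℕ) (ξ₀ : ℝ) (z : ℂ) :
    Tendsto (fun i : ℕ × ℝ => edgeWeight M ν i.1 i.2 z) (atTop ×ˢ 𝓝 ξ₀)
      (𝓝 (Complex.exp (z ^ 3 / 3 - ξ₀ * z))) := by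
  rw [sub_eq_add_neg, Complex.exp_add]
  refine ((tendsto_ratio hM ν z).comp tendsto_fst).mul ?_
  refine (Complex.continuous_exp.tendsto _).comp (Tendsto.neg ?_)
  have h1 : Tendsto (fun i : ℕ × ℝ => (i.2 : ℂ) * z) (atTop ×ˢ 𝓝 ξ₀) (𝓝 (ξ₀ * z)) :=
    ((Complex.continuous_ofReal.tendsto _).comp tendsto_snd).mul_const z
  have h2 : Tendsto (fun i : ℕ × ℝ => edgeExponent M i.1 i.2 z - i.2 * z)
      (atTop ×ˢ 𝓝 ξ₀) (𝓝 0) := by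
    have hb : Tendsto (fun i : ℕ × ℝ => ((M + 1) * edgeScale M i.1 / 2 + ‖z‖ / edgeStep M i.1) *
        i.2 ^ 2) (atTop ×ˢ 𝓝 ξ₀) (𝓝 (((M + 1) * 0 / 2 + 0) * ξ₀ ^ 2)) := by
      refine Tendsto.mul (Tendsto.add ?_ ?_) (tendsto_snd.pow 2)
      · exact (((tendsto_edgeScale M).const_mul _).div_const _).comp tendsto_fst
      · exact ((tendsto_edgeStep hM).const_div_atTop _).comp tendsto_fst
    simp only [mul_zero, zero_div, add_zero, zero_mul] at hb
    refine squeeze_zero_norm' ?_ hb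
    have hA : ∀ᶠ i : ℕ × ℝ in atTop ×ˢ 𝓝 ξ₀, |i.2| ≤ |ξ₀| + 1 :=
      tendsto_snd.eventually (continuous_abs.tendsto ξ₀ |>.eventually_le_const (by linarith))
    filter_upwards [tendsto_fst.eventually (eventually_edgeScale hM (2 * (|ξ₀| + 1))), hA]
      with i ⟨hn, he, _, _, h3, _, h5⟩ h6
    refine (norm_edgeExponent_sub_le hM hn (by linarith) z).trans ?_
    gcongr
  simpa using h2.add h1

theorem rightPath_neg (R r : ℝ) : rightPath R (-r) = (starRingEnd ℂ) (rightPath R r) := by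
  simp [rightPath, Complex.conj_ofReal, map_ofNat]

theorem lamL_neg (q : ℝ) : lamL (-q) = (starRingEnd ℂ) (lamL q) := by
  simp [lamL_eq, Complex.conj_ofReal, map_ofNat]

theorem norm_rightPath_le (R r : ℝ) (hR : 0 ≤ R) : ‖rightPath R r‖ ≤ 1 + 2 * |r| := by
  have s3 : √3 ≤ 2 := Real.sqrt_le_iff.2 ⟨by norm_num, by norm_num⟩
  have h0 : 0 ≤ min |r| R := le_min (abs_nonneg r) hR
  have h1 : min |r| R ≤ |r| := min_le_left _ _
  refine (norm_add_le _ _).trans ?_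
  rw [norm_mul, Complex.norm_real, Complex.norm_real, Complex.norm_I, mul_one, Real.norm_eq_abs,
    Real.norm_eq_abs, abs_mul, abs_of_nonneg (show 0 ≤ √3 / 2 by positivity),
    abs_of_nonneg (show 0 ≤ 1 + min |r| R / 2 by positivity)]
  nlinarith [abs_nonneg r]

theorem norm_edgeWeight (M : ℕ) (ν : ℕ → ℕ) (n : ℕ) (ξ : ℝ) (z : ℂ) :
    ‖edgeWeight M ν n ξ z‖ =
      ‖ratio M ν n (edgeScale M n * z)‖ * Real.exp (-(edgeExponent M n ξ z).re) := by
  rw [edgeWeight, norm_mul, Complex.norm_exp, Complex.neg_re]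

theorem exists_norm_edgeWeight_le {M : ℕ} (hM : 1 ≤ M) (ν : ℕ → ℕ) {H : ℝ} (hH : 0 ≤ H) :
    ∃ C : ℝ, 0 ≤ C ∧ ∀ᶠ n in atTop, ∀ ξ : ℝ, |ξ| ≤ H → ∀ r : ℝ,
      ‖edgeWeight M ν n ξ (rightPath (9 / 10 / edgeScale M n) r)‖ ≤ C * Real.exp (-|r|) := by
  have hMr : (1 : ℝ) ≤ M := by exact_mod_cast hM
  have p0 : (0 : ℝ) < 1 / (M + 1) := by positivity
  have p1 : (1 : ℝ) / (M + 1) ≤ 1 / 2 := by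
    gcongr
    linarith
  obtain ⟨n₀, C, hn₀, hC, h⟩ := exists_ratio_eq hM ν
  set A : ℕ := 2 + ∑ j ∈ Finset.range M, (ν (j + 1) + 1) with hA
  set K : ℝ := 2 * A + 2 * (1 + H) + 1 with hK
  obtain ⟨D, hD, hphase⟩ := exists_right_phase_le (K := K) (by positivity)
  refine ⟨Real.exp (D + C + A + 2 + H), (Real.exp_pos _).le, ?_⟩
  filter_upwards [eventually_ge_atTop n₀, eventually_edgeScale hM (500 * K),
    eventually_abs_re_edgeExponent_le hM hH] with n hn ⟨hn1, he, he1, _, h2, h4, hs⟩ hE ξ hξ r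
  wlog hr : 0 ≤ r generalizing r with hw
  · have h5 := hw (-r) (by linarith)
    rwa [rightPath_neg, edgeWeight_conj, RCLike.norm_conj, abs_neg] at h5
  have hR : 0 ≤ 9 / 10 / edgeScale M n := by positivity
  have hN := critScale_pos hM hn1
  set z := rightPath (9 / 10 / edgeScale M n) r with hz
  have hzre : 0 ≤ z.re := by
    have : 0 ≤ min |r| (9 / 10 / edgeScale M n) := le_min (abs_nonneg r) hR
    simp [hz, rightPath]
    positivity
  have hzim : 0 ≤ z.im := by
    simp [hz, rightPath]
    positivity
  have hznorm : ‖z‖ ≤ 1 + 2 * |r| := norm_rightPath_le _ _ hR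
  have hw : 0 ≤ ((edgeScale M n : ℂ) * z).re := by
    rw [Complex.re_ofReal_mul]
    positivity
  have hreg : StirlingRegion M n (edgeScale M n * z) := by
    refine ⟨?_, ?_, Or.inl (by linarith)⟩
    · rw [Complex.im_ofReal_mul]
      positivity
    · have : 0 ≤ critPoint M n + critScale M n * ((edgeScale M n : ℂ) * z).re := by
        rw [critPoint]
        positivity
      linarith
  obtain ⟨e, hen, hrat⟩ := h n hn _ hreg
  have heC : ‖e‖ ≤ C := hen.trans (div_le_self hC (by exact_mod_cast hn1))
  have hslow := norm_slowFactor_le hM ν hn1 (e := e) hw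
  rw [← hA] at hslow
  have hwn : ‖(edgeScale M n : ℂ) * z‖ ≤ 1 + 2 * |r| := by
    rw [norm_mul, Complex.norm_real, Real.norm_eq_abs, abs_of_pos he]
    nlinarith [norm_nonneg z]
  have hpow : (1 + ‖(edgeScale M n : ℂ) * z‖) ^ A ≤ Real.exp (A * (1 + 2 * |r|)) := by
    rw [Real.exp_nat_mul]
    refine pow_le_pow_left₀ (by positivity) ?_ _
    have := Real.add_one_le_exp (1 + 2 * |r|)
    linarith
  have hph := hphase (1 / (M + 1)) _ _ p0 p1 he he1 h2 h4 hs r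
  have hEz := (abs_le.1 (hE ξ hξ z)).1
  have hzre' : |z.re| ≤ 1 + 2 * |r| := (Complex.abs_re_le_norm z).trans hznorm
  rw [norm_edgeWeight, hrat, norm_mul, Complex.norm_exp, Complex.re_ofReal_mul]
  calc _ ≤ Real.exp (D - K * |r|) * (Real.exp C * Real.exp (A * (1 + 2 * |r|))) *
        Real.exp (1 + (1 + H) * (1 + 2 * |r|)) := by
        gcongr
        · refine hslow.trans ?_
          gcongr
        · nlinarith
    _ = _ := by
      rw [← Real.exp_add, ← Real.exp_add, ← Real.exp_add, ← Real.exp_add, hK]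
      congr 1
      ring

theorem exists_norm_inv_edgeWeight_lamL_le {M : ℕ} (hM : 1 ≤ M) (ν : ℕ → ℕ) {H : ℝ} (hH : 0 ≤ H) :
    ∃ C : ℝ, 0 ≤ C ∧ ∀ᶠ n in atTop, ∀ ξ : ℝ, |ξ| ≤ H → ∀ q : ℝ, |q| ≤ 9 / 10 / edgeScale M n →
      ‖(edgeWeight M ν n ξ (lamL q))⁻¹‖ ≤ C * Real.exp (-|q|) := by
  have hMr : (1 : ℝ) ≤ M := by exact_mod_cast hM
  have p0 : (0 : ℝ) < 1 / (M + 1) := by positivity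
  have p1 : (1 : ℝ) / (M + 1) ≤ 1 / 2 := by
    gcongr
    linarith
  obtain ⟨n₀, C, hn₀, hC, h⟩ := exists_ratio_eq hM ν
  obtain ⟨S, hS, hslow⟩ := exists_norm_inv_slowFactor_le hM ν 3
  obtain ⟨D, hD, hphase⟩ := exists_left_phase_le (K := 2 + H) (by positivity)
  refine ⟨S * Real.exp (D + C + 2 + H), by positivity, ?_⟩
  filter_upwards [eventually_ge_atTop n₀, eventually_ge_atTop M, eventually_edgeScale hM 0,
    eventually_abs_re_edgeExponent_le hM hH] with n hn hnM ⟨hn1, he, he1, _, h2, h4, _⟩ hE ξ hξ q hq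
  wlog hq0 : 0 ≤ q generalizing q with hw
  · have h5 := hw (-q) (by rwa [abs_neg]) (by linarith)
    rwa [lamL_neg, edgeWeight_conj, norm_inv, RCLike.norm_conj, abs_neg, ← norm_inv] at h5
  have hN := critScale_pos hM hn1
  set z := lamL q with hz
  have hzre : z.re = -1 - q / 2 := by
    simp [hz, lamL_eq, abs_of_nonneg hq0]
  have hzim : z.im = √3 / 2 * q := by
    simp [hz, lamL_eq]
  have heq : edgeScale M n * q ≤ 9 / 10 := by
    rw [abs_of_nonneg hq0, le_div_iff₀ he] at hq
    linarith
  have heq0 : 0 ≤ edgeScale M n * q := by positivity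
  have s3 : √3 ≤ 2 := Real.sqrt_le_iff.2 ⟨by norm_num, by norm_num⟩
  have hwre : -(1 / 2) ≤ ((edgeScale M n : ℂ) * z).re := by
    rw [Complex.re_ofReal_mul, hzre]
    linarith
  have hreg : StirlingRegion M n (edgeScale M n * z) := by
    refine ⟨?_, ?_, Or.inl hwre⟩
    · rw [Complex.im_ofReal_mul, hzim]
      positivity
    · rw [critPoint]
      nlinarith
  obtain ⟨e, hen, hrat⟩ := h n hn _ hreg
  have heC : ‖e‖ ≤ C := hen.trans (div_le_self hC (by exact_mod_cast hn1))
  have hwn : ‖(edgeScale M n : ℂ) * z‖ ≤ 3 := by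
    have h5 := Complex.norm_le_abs_re_add_abs_im ((edgeScale M n : ℂ) * z)
    rw [Complex.re_ofReal_mul, Complex.im_ofReal_mul, hzre, hzim] at h5
    have h6 : |edgeScale M n * (-1 - q / 2)| ≤ 1 := abs_le.2 ⟨by linarith, by linarith⟩
    have h7 : |edgeScale M n * (√3 / 2 * q)| ≤ 1 := by
      rw [abs_of_nonneg (by positivity)]
      nlinarith
    linarith
  have hsl := hslow n _ e hnM hreg hwn
  have hph := (hphase (1 / (M + 1)) _ _ p0 p1 he he1 h2 h4).1 q hq
  have hEz := (abs_le.1 (hE ξ hξ z)).2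
  have hzre' : |z.re| = 1 + |q| / 2 := by
    rw [hzre, abs_of_nonneg hq0, abs_of_nonpos (by linarith)]
    ring
  rw [hzre'] at hEz
  rw [norm_inv, norm_edgeWeight, hrat, norm_mul, Complex.norm_exp, Complex.re_ofReal_mul, mul_inv,
    mul_inv, ← norm_inv (slowFactor _ _ _ _ _), ← Real.exp_neg, ← Real.exp_neg, neg_neg, ← neg_mul]
  calc _ ≤ Real.exp (D - (2 + H) * |q|) * (S * Real.exp C) *
        Real.exp (1 + (1 + H) * (1 + |q| / 2)) := by
        gcongr
        refine hsl.trans ?_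
        gcongr
    _ = S * Real.exp (D - (2 + H) * |q| + C + (1 + (1 + H) * (1 + |q| / 2))) := by
      rw [Real.exp_add _ (1 + _), Real.exp_add _ C]
      ring
    _ ≤ S * Real.exp (D + C + 2 + H + -|q|) := by
      refine mul_le_mul_of_nonneg_left (Real.exp_le_exp.2 ?_) hS
      nlinarith [abs_nonneg q, mul_nonneg hH (abs_nonneg q)]
    _ = _ := by rw [Real.exp_add _ (-|q|), mul_assoc]

theorem exists_norm_inv_edgeWeight_far_le {M : ℕ} (hM : 1 ≤ M) (ν : ℕ → ℕ) {H K : ℝ} (hH : 0 ≤ H)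
    (hK : 0 ≤ K) :
    ∃ C : ℝ, 0 ≤ C ∧ ∀ᶠ n in atTop, ∀ ξ : ℝ, |ξ| ≤ H → ∀ z : ℂ,
      z.im = √3 / 2 * (9 / 10 / edgeScale M n) → z.re ≤ -1 - 9 / 20 / edgeScale M n →
      -(1 / 2) ≤ critPoint M n + edgeStep M n * z.re →
      ‖(edgeWeight M ν n ξ z)⁻¹‖ ≤ C * Real.exp (-(K / edgeScale M n)) := by
  have hMr : (1 : ℝ) ≤ M := by exact_mod_cast hM
  have p0 : (0 : ℝ) < 1 / (M + 1) := by positivity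
  have p1 : (1 : ℝ) / (M + 1) ≤ 1 / 2 := by
    gcongr
    linarith
  obtain ⟨n₀, C, hn₀, hC, h⟩ := exists_ratio_eq hM ν
  obtain ⟨S, hS, hslow⟩ := exists_norm_inv_slowFactor_le hM ν (2 * M + 4)
  set L : ℝ := (1 + H) * (2 * (M + 1)) + K with hL
  obtain ⟨D, hD, hphase⟩ := exists_left_phase_le (K := 10 / 9 * L) (by positivity)
  refine ⟨S * Real.exp (D + C + 1), by positivity, ?_⟩
  filter_upwards [eventually_ge_atTop n₀, eventually_ge_atTop M, eventually_ge_atTop 50,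
    eventually_edgeScale hM 0, eventually_abs_re_edgeExponent_le hM hH]
    with n hn hnM hn50 ⟨hn1, he, he1, _, h2, h4, _⟩ hE ξ hξ z hzim hzre hzre2
  have hN := critScale_pos hM hn1
  have hN1 : (1 : ℝ) ≤ critScale M n := by
    rw [critScale, le_div_iff₀ (by positivity), one_mul]
    exact_mod_cast hnM
  have hn50' : (50 : ℝ) ≤ n := by exact_mod_cast hn50
  have hT : 50 ≤ critPoint M n := by
    rw [critPoint_eq M n hM]
    linarith
  set a := edgeScale M n * z.re with ha
  have ha1 : a ≤ -edgeScale M n - 9 / 20 := by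
    have := mul_le_mul_of_nonneg_left hzre he.le
    have h5 : edgeScale M n * (9 / 20 / edgeScale M n) = 9 / 20 := by field_simp
    rw [ha]
    linarith
  have ha2 : -(1 / 2) ≤ critPoint M n + critScale M n * a := by
    rw [ha, ← mul_assoc]
    exact hzre2
  have ha3 : -(101 / 100) ≤ 1 / (M + 1) * a := by
    rw [div_mul_eq_mul_div, one_mul, le_div_iff₀ (by positivity)]
    rw [critPoint] at ha2 hT
    have : 0 ≤ critScale M n * (a + 101 / 100 * (M + 1)) := by nlinarith
    have := (mul_nonneg_iff_of_pos_left hN).1 this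
    linarith
  have ha4 : |a| ≤ 2 * (M + 1) := by
    rw [div_mul_eq_mul_div, one_mul, le_div_iff₀ (by positivity)] at ha3
    exact abs_le.2 ⟨by linarith, by linarith⟩
  have s3 : √3 ≤ 2 := Real.sqrt_le_iff.2 ⟨by norm_num, by norm_num⟩
  have s3' : 173 / 100 ≤ √3 := Real.le_sqrt_of_sq_le (by norm_num)
  have hb : edgeScale M n * z.im = √3 / 2 * (9 / 10) := by
    rw [hzim]
    field_simp
  have hw : (edgeScale M n : ℂ) * z = a + ((√3 / 2 * (9 / 10) : ℝ) : ℂ) * Complex.I := by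
    rw [← hb, ha]
    apply Complex.ext <;> simp
  have hwre : ((edgeScale M n : ℂ) * z).re = a := by rw [Complex.re_ofReal_mul]
  have hwim : ((edgeScale M n : ℂ) * z).im = √3 / 2 * (9 / 10) := by rw [Complex.im_ofReal_mul, hb]
  have hreg : StirlingRegion M n (edgeScale M n * z) := by
    refine ⟨?_, ?_, Or.inr ?_⟩
    · rw [hwim]
      positivity
    · rwa [hwre]
    · rw [hwim]
      linarith
  obtain ⟨e, hen, hrat⟩ := h n hn _ hreg
  have heC : ‖e‖ ≤ C := hen.trans (div_le_self hC (by exact_mod_cast hn1))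
  have hwn : ‖(edgeScale M n : ℂ) * z‖ ≤ 2 * M + 4 := by
    have h5 := Complex.norm_le_abs_re_add_abs_im ((edgeScale M n : ℂ) * z)
    rw [hwre, hwim, abs_of_nonneg (show 0 ≤ √3 / 2 * (9 / 10) by positivity)] at h5
    linarith
  have hsl := hslow n _ e hnM hreg hwn
  have hph := (hphase (1 / (M + 1)) _ _ p0 p1 he he1 h2 h4).2 a ha1 ha3
  rw [← hw] at hph
  have hEz := (abs_le.1 (hE ξ hξ z)).2
  have hzre' : |z.re| ≤ 2 * (M + 1) / edgeScale M n := by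
    rwa [le_div_iff₀ he, mul_comm, ← abs_of_pos he, ← abs_mul]
  rw [norm_inv, norm_edgeWeight, hrat, norm_mul, Complex.norm_exp, Complex.re_ofReal_mul, mul_inv,
    mul_inv, ← norm_inv (slowFactor _ _ _ _ _), ← Real.exp_neg, ← Real.exp_neg, neg_neg, ← neg_mul]
  calc _ ≤ Real.exp (D - 10 / 9 * L * (9 / 10 / edgeScale M n)) * (S * Real.exp C) *
        Real.exp (1 + (1 + H) * (2 * (M + 1) / edgeScale M n)) := by
        gcongr
        · refine hsl.trans ?_
          gcongr
        · refine hEz.trans ?_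
          gcongr
    _ = S * Real.exp (D - 10 / 9 * L * (9 / 10 / edgeScale M n) + C +
        (1 + (1 + H) * (2 * (M + 1) / edgeScale M n))) := by
      rw [Real.exp_add _ (1 + _), Real.exp_add _ C]
      ring
    _ = S * Real.exp (D + C + 1 + -(K / edgeScale M n)) := by
      congr 2
      rw [hL]
      ring
    _ = _ := by rw [Real.exp_add _ (-(K / edgeScale M n)), mul_assoc]

theorem norm_Gamma_le_norm_Gamma {x y Y : ℝ} (hx : 0 < x) (h : |y| ≤ |Y|) :
    ‖Complex.Gamma (x + Y * Complex.I)‖ ≤ ‖Complex.Gamma (x + y * Complex.I)‖ := by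
  refine le_of_tendsto_of_tendsto (Complex.GammaSeq_tendsto_Gamma _).norm
    (Complex.GammaSeq_tendsto_Gamma _).norm ?_
  filter_upwards [eventually_ge_atTop 1] with n hn
  have hn0 : 0 < n := hn
  have hle : ∀ k : ℕ, ‖(x + y * Complex.I + k : ℂ)‖ ≤ ‖(x + Y * Complex.I + k : ℂ)‖ := by
    intro k
    rw [← sq_le_sq₀ (norm_nonneg _) (norm_nonneg _), ← Complex.normSq_eq_norm_sq,
      ← Complex.normSq_eq_norm_sq, Complex.normSq_apply, Complex.normSq_apply]
    have := sq_le_sq.2 h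
    simp
    nlinarith
  have hpos : ∀ k : ℕ, 0 < ‖(x + y * Complex.I + k : ℂ)‖ := by
    intro k
    refine norm_pos_iff.2 fun h0 => ?_
    have := congrArg Complex.re h0
    simp at this
    have : (0 : ℝ) ≤ k := k.cast_nonneg
    linarith
  rw [Complex.GammaSeq, Complex.GammaSeq, norm_div, norm_div, norm_mul, norm_mul, norm_prod,
    norm_prod,
    Complex.norm_natCast_cpow_of_pos hn0, Complex.norm_natCast_cpow_of_pos hn0]
  have hre : (x + Y * Complex.I : ℂ).re = (x + y * Complex.I : ℂ).re := by simp
  rw [hre]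
  gcongr with k hk
  · exact Finset.prod_pos fun k _ => hpos k
  · exact hle k

theorem Gamma_add_natCast {z : ℂ} (hz : ∀ k : ℕ, z + k ≠ 0) (m : ℕ) :
    Complex.Gamma (z + m) = Complex.Gamma z * ∏ i ∈ Finset.range m, (z + i) := by
  cases m with
  | zero => simp
  | succ m =>
    rw [← Gamma_add_natCast_add_one hz]
    push_cast
    ring_nf

theorem norm_weight_line_le {M : ℕ} (hM : 1 ≤ M) (ν : ℕ → ℕ) (n : ℕ) {y Y : ℝ} (h : |y| ≤ |Y|) :
    ‖weight M ν n (((-(1 / 2) : ℝ) : ℂ) + Y * Complex.I)‖ ≤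
      (1 + 2 * |Y|) ^ ν 1 * ‖weight M ν n (((-(1 / 2) : ℝ) : ℂ) + y * Complex.I)‖ := by
  obtain ⟨m, rfl⟩ : ∃ m, M = m + 1 := ⟨M - 1, by omega⟩
  have hne : ∀ (v : ℝ) (k : ℕ), (((1 / 2 : ℝ) : ℂ) + v * Complex.I) + k ≠ 0 := by
    intro v k h0
    have := congrArg Complex.re h0
    simp at this
    have : (0 : ℝ) ≤ k := k.cast_nonneg
    linarith
  have hfirst : ∀ v : ℝ, ‖weight (m + 1) ν n (((-(1 / 2) : ℝ) : ℂ) + v * Complex.I)‖ =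
      (‖Complex.Gamma (((1 / 2 + n : ℝ) : ℂ) + v * Complex.I)‖ *
        ∏ k ∈ Finset.range (ν 1), ‖(((1 / 2 : ℝ) : ℂ) + v * Complex.I) + k‖) *
      ∏ j ∈ Finset.range m, ‖Complex.Gamma (((1 / 2 + ν (j + 2) : ℝ) : ℂ) + v * Complex.I)‖ := by
    intro v
    have e1 : ∏ k ∈ Finset.range n, ‖((((-(1 / 2) : ℝ) : ℂ) + v * Complex.I) - k : ℂ)‖ =
        ∏ k ∈ Finset.range n, ‖(((1 / 2 : ℝ) : ℂ) + v * Complex.I) + k‖ := by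
      refine Finset.prod_congr rfl fun k _ => ?_
      rw [← RCLike.norm_conj, ← norm_neg]
      congr 1
      simp [Complex.conj_ofReal, map_ofNat]
      ring
    have e2 : Complex.Gamma ((((-(1 / 2) : ℝ) : ℂ) + v * Complex.I) + ν (0 + 1) + 1) =
        Complex.Gamma (((1 / 2 : ℝ) : ℂ) + v * Complex.I) *
          ∏ k ∈ Finset.range (ν 1), ((((1 / 2 : ℝ) : ℂ) + v * Complex.I) + k) := by
      rw [← Gamma_add_natCast (hne v)]
      congr 1
      push_cast
      ring
    have e3 : Complex.Gamma (((1 / 2 + n : ℝ) : ℂ) + v * Complex.I) =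
        Complex.Gamma (((1 / 2 : ℝ) : ℂ) + v * Complex.I) *
          ∏ k ∈ Finset.range n, ((((1 / 2 : ℝ) : ℂ) + v * Complex.I) + k) := by
      rw [← Gamma_add_natCast (hne v)]
      congr 1
      push_cast
      ring
    have e4 : ∏ j ∈ Finset.range m,
        ‖Complex.Gamma ((((-(1 / 2) : ℝ) : ℂ) + v * Complex.I) + ν (j + 1 + 1) + 1)‖ =
        ∏ j ∈ Finset.range m, ‖Complex.Gamma (((1 / 2 + ν (j + 2) : ℝ) : ℂ) + v * Complex.I)‖ := by
      refine Finset.prod_congr rfl fun j _ => ?_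
      congr 2
      push_cast
      ring
    rw [weight, Finset.prod_range_succ', norm_mul, norm_mul, norm_prod, norm_prod, e1, e2, e3, e4,
      norm_mul, norm_mul, norm_prod, norm_prod]
    ring
  rw [hfirst, hfirst]
  have hA := norm_Gamma_le_norm_Gamma (x := 1 / 2 + n) (by positivity) h
  have hB : ∏ k ∈ Finset.range (ν 1), ‖(((1 / 2 : ℝ) : ℂ) + Y * Complex.I) + k‖ ≤
      (1 + 2 * |Y|) ^ ν 1 * ∏ k ∈ Finset.range (ν 1),
        ‖(((1 / 2 : ℝ) : ℂ) + y * Complex.I) + k‖ := by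
    rw [← Finset.card_range (ν 1), ← Finset.prod_const, Finset.card_range,
      ← Finset.prod_mul_distrib]
    refine Finset.prod_le_prod (fun k _ => norm_nonneg _) fun k _ => ?_
    have h1 : (1 / 2 : ℝ) + k ≤ ‖(((1 / 2 : ℝ) : ℂ) + y * Complex.I) + k‖ := by
      refine le_trans (le_of_eq ?_) (Complex.re_le_norm _)
      simp
    have h2 : ‖(((1 / 2 : ℝ) : ℂ) + Y * Complex.I) + k‖ ≤ 1 / 2 + k + |Y| := by
      rw [add_right_comm]
      refine (norm_add_le _ _).trans ?_
      rw [norm_mul, Complex.norm_real, Complex.norm_I, mul_one, Real.norm_eq_abs]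
      gcongr
      rw [← Complex.ofReal_natCast, ← Complex.ofReal_add, Complex.norm_real, Real.norm_eq_abs,
        abs_of_nonneg (by positivity)]
    have : (0 : ℝ) ≤ k := k.cast_nonneg
    nlinarith [abs_nonneg Y, mul_nonneg this (abs_nonneg Y)]
  have hC : ∏ j ∈ Finset.range m, ‖Complex.Gamma (((1 / 2 + ν (j + 2) : ℝ) : ℂ) + Y * Complex.I)‖ ≤
      ∏ j ∈ Finset.range m, ‖Complex.Gamma (((1 / 2 + ν (j + 2) : ℝ) : ℂ) + y * Complex.I)‖ :=
    Finset.prod_le_prod (fun _ _ => norm_nonneg _) fun j _ =>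
      norm_Gamma_le_norm_Gamma (by positivity) h
  calc _ ≤ (‖Complex.Gamma (((1 / 2 + n : ℝ) : ℂ) + y * Complex.I)‖ *
        ((1 + 2 * |Y|) ^ ν 1 *
          ∏ k ∈ Finset.range (ν 1), ‖(((1 / 2 : ℝ) : ℂ) + y * Complex.I) + k‖)) *
      ∏ j ∈ Finset.range m, ‖Complex.Gamma (((1 / 2 + ν (j + 2) : ℝ) : ℂ) + y * Complex.I)‖ := by
        gcongr
    _ = _ := by ring

theorem weight_ne_zero (M : ℕ) (ν : ℕ → ℕ) {n : ℕ} {z : ℂ} (hz : -1 < z.re) (h : ∀ k < n, z ≠ k) :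
    weight M ν n z ≠ 0 := by
  refine mul_ne_zero (Finset.prod_ne_zero_iff.2 fun k hk => sub_ne_zero.2
      (h k (Finset.mem_range.1 hk)))
    (Finset.prod_ne_zero_iff.2 fun j _ => Complex.Gamma_ne_zero_of_re_pos ?_)
  have : (0 : ℝ) ≤ ν (j + 1) := Nat.cast_nonneg _
  simp
  linarith

theorem norm_ratio_eq (M : ℕ) (ν : ℕ → ℕ) (n : ℕ) (w : ℂ) :
    ‖ratio M ν n w‖ = ‖weight M ν n (critPoint M n + critScale M n * w)‖ *
      (‖weight M ν n (critPoint M n)‖⁻¹ * Real.exp (-(critScale M n * w.re * logEdge M n))) := by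
  rw [ratio, norm_mul, norm_div, Complex.norm_exp, div_mul_eq_mul_div, div_eq_mul_inv]
  have : (-(critScale M n * w * logEdge M n : ℂ)).re = -(critScale M n * w.re * logEdge M n) := by
    simp
  rw [this]
  ring

theorem exists_norm_inv_edgeWeight_line_le {M : ℕ} (hM : 1 ≤ M) (ν : ℕ → ℕ) {H K : ℝ} (hH : 0 ≤ H)
    (hK : 0 ≤ K) :
    ∃ C : ℝ, 0 ≤ C ∧ ∀ᶠ n in atTop, ∀ ξ : ℝ, |ξ| ≤ H → ∀ z : ℂ,
      |z.im| ≤ √3 / 2 * (9 / 10 / edgeScale M n) →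
      critPoint M n + edgeStep M n * z.re = -(1 / 2) →
      ‖(edgeWeight M ν n ξ z)⁻¹‖ ≤ C * Real.exp (-(K / edgeScale M n)) := by
  have hMr : (1 : ℝ) ≤ M := by exact_mod_cast hM
  obtain ⟨C, hC, hfar⟩ := exists_norm_inv_edgeWeight_far_le hM ν hH
    (K := K + ν 1) (by positivity)
  refine ⟨49 ^ ν 1 * C, by positivity, ?_⟩
  filter_upwards [hfar, eventually_edgeScale hM 0] with n hn ⟨hn1, he, he1, _, h2, h4, _⟩
    ξ hξ z hzim hzre
  have hN := critScale_pos hM hn1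
  have hs := edgeStep_pos hM hn1
  set b : ℝ := √3 / 2 * (9 / 10 / edgeScale M n) with hb
  set x := 1 / edgeScale M n with hx
  have hx0 : 100 ≤ x := by
    rw [hx, le_div_iff₀ he]
    linarith
  have hb0 : 0 ≤ b := by positivity
  set z' : ℂ := z.re + b * Complex.I with hz'
  have re' : z'.re = z.re := by simp [hz']
  have im' : z'.im = b := by simp [hz']
  have hre : z.re ≤ -1 - 9 / 20 / edgeScale M n := by
    have h5 : edgeStep M n * (z.re + (M + 1) * x) ≤ 0 := by
      have : edgeStep M n * ((M + 1) * x) = critPoint M n := by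
        rw [edgeStep, critPoint, hx]
        field_simp
      linarith
    have h6 : z.re + (M + 1) * x ≤ 0 := nonpos_of_mul_nonpos_right h5 hs
    have h7 : 9 / 20 / edgeScale M n = 9 / 20 * x := by rw [hx]; ring
    nlinarith
  have key := hn ξ hξ z' im' (by rw [re']; exact hre) (by rw [re']; exact hzre.ge)
  have arg : ∀ u : ℂ, u.re = z.re → (critPoint M n + critScale M n * (edgeScale M n * u) : ℂ) =
      ((-(1 / 2) : ℝ) : ℂ) + ((edgeStep M n * u.im : ℝ) : ℂ) * Complex.I := by
    intro u hu
    rw [← hzre, ← hu, edgeStep]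
    apply Complex.ext <;> simp <;> ring
  have hY : |edgeStep M n * b| ≤ 4 * x ^ 3 := by
    have s3 : √3 ≤ 2 := Real.sqrt_le_iff.2 ⟨by norm_num, by norm_num⟩
    have e1 : edgeStep M n * b = critScale M n * (√3 / 2 * (9 / 10)) := by
      rw [hb, edgeStep]
      field_simp
    have e2 : critScale M n ≤ 4 * x ^ 3 := by
      rw [hx, div_pow, one_pow, mul_one_div, le_div_iff₀ (by positivity)]
      exact h4
    rw [e1, abs_of_nonneg (by positivity)]
    nlinarith
  have hw := norm_weight_line_le hM ν n (y := edgeStep M n * z.im) (Y := edgeStep M n * b) (by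
    rw [abs_mul, abs_mul, abs_of_nonneg hb0]
    gcongr)
  rw [← im', ← arg z' re', ← arg z rfl, im'] at hw
  have hpoly : (1 + 2 * |edgeStep M n * b|) ^ ν 1 ≤ 49 ^ ν 1 * Real.exp (ν 1 * x) := by
    rw [Real.exp_nat_mul, ← mul_pow]
    refine pow_le_pow_left₀ (by positivity) ?_ _
    have e1 := Real.pow_div_factorial_le_exp x (by linarith) 3
    have e2 := Real.add_one_le_exp x
    norm_num [Nat.factorial] at e1
    linarith
  have hE : (edgeExponent M n ξ z').re = (edgeExponent M n ξ z).re := by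
    rw [edgeExponent_re, re', ← edgeExponent_re]
  have hcmp : ‖edgeWeight M ν n ξ z'‖ ≤
      49 ^ ν 1 * Real.exp (ν 1 * x) * ‖edgeWeight M ν n ξ z‖ := by
    rw [norm_edgeWeight, norm_edgeWeight, hE, norm_ratio_eq, norm_ratio_eq, Complex.re_ofReal_mul,
      Complex.re_ofReal_mul, re']
    refine (mul_le_mul_of_nonneg_right (mul_le_mul_of_nonneg_right (hw.trans
      (mul_le_mul_of_nonneg_right hpoly (norm_nonneg _))) (by positivity))
      (Real.exp_pos _).le).trans_eq ?_
    ring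
  have hpos : 0 < ‖edgeWeight M ν n ξ z'‖ := by
    refine norm_pos_iff.2 (mul_ne_zero ?_ (Complex.exp_ne_zero _))
    rw [← norm_ne_zero_iff, norm_ratio_eq]
    refine mul_ne_zero ?_ (mul_ne_zero (inv_ne_zero ?_) (Real.exp_ne_zero _))
    · rw [norm_ne_zero_iff, arg z' re']
      refine weight_ne_zero M ν (by simp; norm_num) fun k _ h => ?_
      have := congrArg Complex.re h
      simp at this
      have : (0 : ℝ) ≤ k := k.cast_nonneg
      linarith
    · rw [norm_ne_zero_iff]
      refine weight_ne_zero M ν ?_ fun k hk h => ?_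
      · rw [Complex.ofReal_re, critPoint]
        have : 0 ≤ (M + 1) * critScale M n := by positivity
        linarith
      · have h3 := congrArg Complex.re h
        rw [Complex.ofReal_re, Complex.natCast_re, critPoint_eq M n hM] at h3
        have : (k : ℝ) < n := by exact_mod_cast hk
        linarith
  have hpos2 : 0 < ‖edgeWeight M ν n ξ z‖ := by
    by_contra h
    have h5 : ‖edgeWeight M ν n ξ z‖ = 0 := le_antisymm (not_lt.1 h) (norm_nonneg _)
    rw [h5, mul_zero] at hcmp
    linarith
  rw [norm_inv] at key ⊢
  have hinv : ‖edgeWeight M ν n ξ z‖⁻¹ ≤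
      49 ^ ν 1 * Real.exp (ν 1 * x) * ‖edgeWeight M ν n ξ z'‖⁻¹ := by
    rw [← div_eq_mul_inv, le_div_iff₀ hpos, inv_mul_le_iff₀ hpos2]
    linarith
  calc _ ≤ _ := hinv
    _ ≤ 49 ^ ν 1 * Real.exp (ν 1 * x) * (C * Real.exp (-((K + ν 1) / edgeScale M n))) := by gcongr
    _ = 49 ^ ν 1 * C * (Real.exp (ν 1 * x) * Real.exp (-((K + ν 1) / edgeScale M n))) := by ring
    _ = _ := by
      rw [← Real.exp_add, hx]
      congr 2
      ring

/-! ### Contour integrals over segments and symmetric hexagons -/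

/-- The contour integral of `f` over the oriented segment from `a` to `b`. -/
noncomputable def segInt (f : ℂ → ℂ) (a b : ℂ) : ℂ :=
  (b - a) * ∫ u in (0 : ℝ)..1, f (a + u * (b - a))

theorem mem_segment_of_mem_uIcc {a b : ℂ} {u : ℝ} (hu : u ∈ Set.uIcc (0 : ℝ) 1) :
    a + u * (b - a) ∈ segment ℝ a b := by
  rw [Set.uIcc_of_le zero_le_one] at hu
  rw [segment_eq_image']
  exact ⟨u, hu, by simp⟩

theorem segInt_congr {f g : ℂ → ℂ} {a b : ℂ} (h : Set.EqOn f g (segment ℝ a b)) :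
    segInt f a b = segInt g a b := by
  unfold segInt
  congr 1
  exact intervalIntegral.integral_congr fun u hu => h (mem_segment_of_mem_uIcc hu)

theorem continuousOn_segment_comp {f : ℂ → ℂ} {a b : ℂ} (hf : ContinuousOn f (segment ℝ a b)) :
    ContinuousOn (fun u : ℝ => f (a + u * (b - a))) (Set.uIcc (0 : ℝ) 1) :=
  hf.comp (by fun_prop) fun _ hu => mem_segment_of_mem_uIcc hu

theorem segInt_eq_sub {f Φ : ℂ → ℂ} {a b : ℂ}
    (h : ∀ z ∈ segment ℝ a b, HasDerivAt Φ (f z) z) (hf : ContinuousOn f (segment ℝ a b)) :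
    segInt f a b = Φ b - Φ a := by
  have key : ∫ u in (0 : ℝ)..1, f (a + u * (b - a)) * (b - a)
      = Φ (a + (1 : ℝ) * (b - a)) - Φ (a + (0 : ℝ) * (b - a)) := by
    refine intervalIntegral.integral_eq_sub_of_hasDerivAt
      (f := fun u : ℝ => Φ (a + u * (b - a))) (fun u hu => ?_)
      ((continuousOn_segment_comp hf).mul continuousOn_const).intervalIntegrable
    have h1 : HasDerivAt (fun u : ℝ => a + (u : ℂ) * (b - a)) (b - a) u := by
      simpa using ((Complex.ofRealCLM.hasDerivAt (x := u)).mul_const (b - a)).const_add a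
    exact (h _ (mem_segment_of_mem_uIcc hu)).comp u h1
  rw [intervalIntegral.integral_mul_const] at key
  unfold segInt
  rw [mul_comm, key]
  simp

theorem segInt_finset_sum {ι : Type*} (s : Finset ι) {f : ι → ℂ → ℂ} (c : ι → ℂ) {a b : ℂ}
    (hf : ∀ i ∈ s, ContinuousOn (f i) (segment ℝ a b)) :
    segInt (fun z => ∑ i ∈ s, c i * f i z) a b = ∑ i ∈ s, c i * segInt (f i) a b := by
  simp only [segInt]
  rw [intervalIntegral.integral_finsetSum (f := fun i (u : ℝ) => c i * f i (a + u * (b - a)))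
    fun i hi => (continuousOn_const.mul (continuousOn_segment_comp (hf i hi))).intervalIntegrable,
    Finset.mul_sum]
  refine Finset.sum_congr rfl fun i _ => ?_
  rw [intervalIntegral.integral_const_mul]
  ring

theorem segInt_add {f g : ℂ → ℂ} {a b : ℂ} (hf : ContinuousOn f (segment ℝ a b))
    (hg : ContinuousOn g (segment ℝ a b)) :
    segInt (fun z => f z + g z) a b = segInt f a b + segInt g a b := by
  unfold segInt
  rw [intervalIntegral.integral_add (continuousOn_segment_comp hf).intervalIntegrable
    (continuousOn_segment_comp hg).intervalIntegrable, mul_add]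

theorem segInt_inv_sub (c k : ℂ) (hc : c ≠ 0) {a b : ℂ}
    (h : ∀ z ∈ segment ℝ a b, c * (z - k) ∈ Complex.slitPlane) :
    segInt (fun z => (z - k)⁻¹) a b = Complex.log (c * (b - k)) - Complex.log (c * (a - k)) := by
  have hne : ∀ z ∈ segment ℝ a b, z - k ≠ 0 := fun z hz h0 => by
    have := Complex.slitPlane_ne_zero (h z hz)
    simp [h0] at this
  refine segInt_eq_sub (Φ := fun z => Complex.log (c * (z - k))) (fun z hz => ?_) ?_
  · have h1 : HasDerivAt (fun z => c * (z - k)) c z := by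
      simpa using ((hasDerivAt_id z).sub_const k).const_mul c
    have := h1.clog (h z hz)
    convert this using 1
    have := hne z hz
    field_simp
  · exact ContinuousOn.inv₀ (by fun_prop) hne

/-- The contour integral of `f` over the closed hexagon with vertices
`a, p, q, b, conj q, conj p`. -/
noncomputable def hexInt (f : ℂ → ℂ) (a p q b : ℂ) : ℂ :=
  segInt f a p + segInt f p q + segInt f q b + segInt f b (starRingEnd ℂ q) +
    segInt f (starRingEnd ℂ q) (starRingEnd ℂ p) + segInt f (starRingEnd ℂ p) a

/-- The hexagon with vertices `a, p, q, b, conj q, conj p`. -/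
def hexagon (a p q b : ℂ) : Set ℂ :=
  segment ℝ a p ∪ segment ℝ p q ∪ segment ℝ q b ∪ segment ℝ b (starRingEnd ℂ q) ∪
    segment ℝ (starRingEnd ℂ q) (starRingEnd ℂ p) ∪ segment ℝ (starRingEnd ℂ p) a

section hexagon

variable {f g : ℂ → ℂ} {a p q b : ℂ}

theorem hexagon_subset (U : Set ℂ) (hU : Convex ℝ U) (ha : a ∈ U) (hp : p ∈ U) (hq : q ∈ U)
    (hb : b ∈ U) (hp' : starRingEnd ℂ p ∈ U) (hq' : starRingEnd ℂ q ∈ U) :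
    hexagon a p q b ⊆ U := by
  unfold hexagon
  simp only [Set.union_subset_iff]
  exact ⟨⟨⟨⟨⟨hU.segment_subset ha hp, hU.segment_subset hp hq⟩, hU.segment_subset hq hb⟩,
    hU.segment_subset hb hq'⟩, hU.segment_subset hq' hp'⟩, hU.segment_subset hp' ha⟩

theorem segments_subset_hexagon :
    segment ℝ a p ⊆ hexagon a p q b ∧ segment ℝ p q ⊆ hexagon a p q b ∧
      segment ℝ q b ⊆ hexagon a p q b ∧ segment ℝ b (starRingEnd ℂ q) ⊆ hexagon a p q b ∧
      segment ℝ (starRingEnd ℂ q) (starRingEnd ℂ p) ⊆ hexagon a p q b ∧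
      segment ℝ (starRingEnd ℂ p) a ⊆ hexagon a p q b := by
  unfold hexagon
  refine ⟨?_, ?_, ?_, ?_, ?_, ?_⟩ <;> intro z hz <;> simp only [Set.mem_union] <;> tauto

theorem hexInt_congr (h : Set.EqOn f g (hexagon a p q b)) :
    hexInt f a p q b = hexInt g a p q b := by
  obtain ⟨h1, h2, h3, h4, h5, h6⟩ := segments_subset_hexagon (a := a) (p := p) (q := q) (b := b)
  unfold hexInt
  rw [segInt_congr (h.mono h1), segInt_congr (h.mono h2), segInt_congr (h.mono h3),
    segInt_congr (h.mono h4), segInt_congr (h.mono h5), segInt_congr (h.mono h6)]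

theorem hexInt_eq_zero {Φ : ℂ → ℂ} (h : ∀ z ∈ hexagon a p q b, HasDerivAt Φ (f z) z)
    (hf : ContinuousOn f (hexagon a p q b)) : hexInt f a p q b = 0 := by
  obtain ⟨h1, h2, h3, h4, h5, h6⟩ := segments_subset_hexagon (a := a) (p := p) (q := q) (b := b)
  unfold hexInt
  rw [segInt_eq_sub (fun z hz => h z (h1 hz)) (hf.mono h1),
    segInt_eq_sub (fun z hz => h z (h2 hz)) (hf.mono h2),
    segInt_eq_sub (fun z hz => h z (h3 hz)) (hf.mono h3),
    segInt_eq_sub (fun z hz => h z (h4 hz)) (hf.mono h4),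
    segInt_eq_sub (fun z hz => h z (h5 hz)) (hf.mono h5),
    segInt_eq_sub (fun z hz => h z (h6 hz)) (hf.mono h6)]
  ring

theorem hexInt_finset_sum {ι : Type*} (s : Finset ι) {f : ι → ℂ → ℂ} (c : ι → ℂ)
    (hf : ∀ i ∈ s, ContinuousOn (f i) (hexagon a p q b)) :
    hexInt (fun z => ∑ i ∈ s, c i * f i z) a p q b = ∑ i ∈ s, c i * hexInt (f i) a p q b := by
  obtain ⟨h1, h2, h3, h4, h5, h6⟩ := segments_subset_hexagon (a := a) (p := p) (q := q) (b := b)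
  unfold hexInt
  rw [segInt_finset_sum s c fun i hi => (hf i hi).mono h1,
    segInt_finset_sum s c fun i hi => (hf i hi).mono h2,
    segInt_finset_sum s c fun i hi => (hf i hi).mono h3,
    segInt_finset_sum s c fun i hi => (hf i hi).mono h4,
    segInt_finset_sum s c fun i hi => (hf i hi).mono h5,
    segInt_finset_sum s c fun i hi => (hf i hi).mono h6]
  simp only [← Finset.sum_add_distrib, mul_add]

theorem hexInt_add (hf : ContinuousOn f (hexagon a p q b))
    (hg : ContinuousOn g (hexagon a p q b)) :
    hexInt (fun z => f z + g z) a p q b = hexInt f a p q b + hexInt g a p q b := by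
  obtain ⟨h1, h2, h3, h4, h5, h6⟩ := segments_subset_hexagon (a := a) (p := p) (q := q) (b := b)
  unfold hexInt
  rw [segInt_add (hf.mono h1) (hg.mono h1), segInt_add (hf.mono h2) (hg.mono h2),
    segInt_add (hf.mono h3) (hg.mono h3), segInt_add (hf.mono h4) (hg.mono h4),
    segInt_add (hf.mono h5) (hg.mono h5), segInt_add (hf.mono h6) (hg.mono h6)]
  ring

end hexagon

theorem im_mem_segment {a b z : ℂ} (hz : z ∈ segment ℝ a b) (ha : 0 ≤ a.im) (hb : 0 < b.im) :
    z = a ∨ 0 < z.im := by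
  rw [segment_eq_image'] at hz
  obtain ⟨u, hu, rfl⟩ := hz
  rcases hu.1.eq_or_lt with h | h
  · left; simp [← h]
  · right
    have : (a + u • (b - a)).im = (1 - u) * a.im + u * b.im := by
      simp; ring
    rw [this]
    have h1 : 0 ≤ (1 - u) * a.im := mul_nonneg (by linarith [hu.2]) ha
    have h2 : 0 < u * b.im := mul_pos h hb
    linarith

theorem conj_mem_segment {a b z : ℂ}
    (hz : z ∈ segment ℝ (starRingEnd ℂ a) (starRingEnd ℂ b)) :
    starRingEnd ℂ z ∈ segment ℝ a b := by
  rw [segment_eq_image'] at hz ⊢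
  obtain ⟨u, hu, rfl⟩ := hz
  exact ⟨u, hu, by simp⟩

theorem mem_hexagon_cases {α β : ℝ} {p q z : ℂ} (hp : 0 < p.im) (hq : 0 < q.im)
    (hz : z ∈ hexagon α p q β) : z = α ∨ z = β ∨ z.im ≠ 0 := by
  have key : ∀ w : ℂ, w ∈ segment ℝ (α : ℂ) p ∨ w ∈ segment ℝ p q ∨ w ∈ segment ℝ q (β : ℂ) →
      w = α ∨ w = β ∨ w.im ≠ 0 := by
    rintro w (h | h | h)
    · rcases im_mem_segment h (by simp) hp with h | h
      · exact Or.inl h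
      · exact Or.inr (Or.inr h.ne')
    · rcases im_mem_segment h hp.le hq with h | h
      · exact Or.inr (Or.inr (h ▸ hp.ne'))
      · exact Or.inr (Or.inr h.ne')
    · rw [segment_symm] at h
      rcases im_mem_segment h (by simp) hq with h | h
      · exact Or.inr (Or.inl h)
      · exact Or.inr (Or.inr h.ne')
  have key' : ∀ w : ℂ, starRingEnd ℂ w ∈ segment ℝ (α : ℂ) p ∨ starRingEnd ℂ w ∈ segment ℝ p q ∨
      starRingEnd ℂ w ∈ segment ℝ q (β : ℂ) → w = α ∨ w = β ∨ w.im ≠ 0 := fun w hw => by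
    rcases key _ hw with h | h | h
    · left; simpa using congrArg (starRingEnd ℂ) h
    · right; left; simpa using congrArg (starRingEnd ℂ) h
    · right; right; simpa using h
  unfold hexagon at hz
  simp only [Set.mem_union] at hz
  have hα : starRingEnd ℂ (α : ℂ) = α := Complex.conj_ofReal α
  have hβ : starRingEnd ℂ (β : ℂ) = β := Complex.conj_ofReal β
  rcases hz with ((((h | h) | h) | h) | h) | h
  · exact key z (Or.inl h)
  · exact key z (Or.inr (Or.inl h))
  · exact key z (Or.inr (Or.inr h))
  · refine key' z (Or.inr (Or.inr ?_))
    rw [segment_symm, ← hβ] at h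
    exact conj_mem_segment h
  · refine key' z (Or.inr (Or.inl ?_))
    rw [segment_symm] at h
    exact conj_mem_segment h
  · refine key' z (Or.inl ?_)
    rw [segment_symm, ← hα] at h
    exact conj_mem_segment h

theorem hexInt_inv_sub {α β k : ℝ} {p q : ℂ} (hα : k < α) (hβ : β < k) (hp : 0 < p.im)
    (hq : 0 < q.im) : hexInt (fun z => (z - k)⁻¹) α p q β = 2 * Real.pi * Complex.I := by
  have up : ∀ z : ℂ, (z = α ∨ z = β ∨ 0 < z.im) → -Complex.I * (z - k) ∈ Complex.slitPlane := by
    rintro z (rfl | rfl | h) <;> rw [Complex.mem_slitPlane_iff]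
    · right; simp; intro h; linarith
    · right; simp; intro h; linarith
    · left; simpa using h
  have dn : ∀ z : ℂ, (z = α ∨ z = β ∨ z.im < 0) → Complex.I * (z - k) ∈ Complex.slitPlane := by
    rintro z (rfl | rfl | h) <;> rw [Complex.mem_slitPlane_iff]
    · right; simp; intro h; linarith
    · right; simp; intro h; linarith
    · left; simpa using h
  have hα' : starRingEnd ℂ (α : ℂ) = α := Complex.conj_ofReal α
  have hβ' : starRingEnd ℂ (β : ℂ) = β := Complex.conj_ofReal β
  have lo : ∀ (a b z : ℂ), 0 ≤ a.im → 0 < b.im →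
      z ∈ segment ℝ (starRingEnd ℂ a) (starRingEnd ℂ b) → z = starRingEnd ℂ a ∨ z.im < 0 := by
    intro a b z ha hb hz
    rcases im_mem_segment (conj_mem_segment hz) ha hb with h | h
    · left; simpa using congrArg (starRingEnd ℂ) h
    · right; simpa using h
  unfold hexInt
  have hI : (-Complex.I) ≠ 0 := neg_ne_zero.2 Complex.I_ne_zero
  rw [segInt_inv_sub (-Complex.I) k hI, segInt_inv_sub (-Complex.I) k hI,
    segInt_inv_sub (-Complex.I) k hI, segInt_inv_sub Complex.I k Complex.I_ne_zero,
    segInt_inv_sub Complex.I k Complex.I_ne_zero, segInt_inv_sub Complex.I k Complex.I_ne_zero]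
  · have e1 : -Complex.I * ((β : ℂ) - k) = ((k - β : ℝ) : ℂ) * Complex.I := by push_cast; ring
    have e2 : -Complex.I * ((α : ℂ) - k) = ((α - k : ℝ) : ℂ) * -Complex.I := by push_cast; ring
    have e3 : Complex.I * ((β : ℂ) - k) = ((k - β : ℝ) : ℂ) * -Complex.I := by push_cast; ring
    have e4 : Complex.I * ((α : ℂ) - k) = ((α - k : ℝ) : ℂ) * Complex.I := by push_cast; ring
    rw [e1, e2, e3, e4, Complex.log_ofReal_mul (by linarith) Complex.I_ne_zero,
      Complex.log_ofReal_mul (by linarith) Complex.I_ne_zero,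
      Complex.log_ofReal_mul (by linarith) hI, Complex.log_ofReal_mul (by linarith) hI,
      Complex.log_I, Complex.log_neg_I]
    ring
  · intro z hz
    refine dn z ?_
    rw [segment_symm, ← hα'] at hz
    rcases lo _ _ z (by simp) hp hz with h | h
    · left; rw [h, hα']
    · right; right; exact h
  · intro z hz
    refine dn z ?_
    rcases lo _ _ z hq.le hp hz with h | h
    · right; right; rw [h]; simpa using hq
    · right; right; exact h
  · intro z hz
    refine dn z ?_
    rw [← hβ'] at hz
    rcases lo _ _ z (by simp) hq hz with h | h
    · right; left; rw [h, hβ']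
    · right; right; exact h
  · intro z hz
    refine up z ?_
    rw [segment_symm] at hz
    rcases im_mem_segment hz (by simp) hq with h | h
    · right; left; exact h
    · right; right; exact h
  · intro z hz
    refine up z ?_
    rcases im_mem_segment hz hp.le hq with h | h
    · right; right; rw [h]; exact hp
    · right; right; exact h
  · intro z hz
    refine up z ?_
    rcases im_mem_segment hz (by simp) hp with h | h
    · left; exact h
    · right; right; exact h

/-! ### Residue sums at `0, 1, …, n-1` -/

/-- The sum of the residues of `g(t) / (t (t-1) ⋯ (t-n+1))` at `0, 1, …, n-1`. -/
noncomputable def residueSum (n : ℕ) (g : ℂ → ℂ) : ℂ :=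
  ∑ k ∈ Finset.range n, Lagrange.nodalWeight (Finset.range n) (fun k : ℕ => (k : ℂ)) k * g k

theorem inv_prod_sub_eq {n : ℕ} (hn : 1 ≤ n) {t : ℂ} (ht : ∀ k < n, t ≠ k) :
    (∏ k ∈ Finset.range n, (t - k))⁻¹ = ∑ k ∈ Finset.range n,
      Lagrange.nodalWeight (Finset.range n) (fun k : ℕ => (k : ℂ)) k * (t - k)⁻¹ := by
  have h := Lagrange.eval_interpolate_not_at_node (s := Finset.range n)
    (v := fun k : ℕ => (k : ℂ)) (x := t) 1 (fun i hi => ht i (Finset.mem_range.1 hi))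
  rw [Lagrange.interpolate_one (fun i _ j _ h => by simpa using h)
    (Finset.nonempty_range_iff.2 (by omega)), Lagrange.eval_nodal] at h
  simp only [Polynomial.eval_one, Pi.one_apply, mul_one] at h
  exact inv_eq_of_mul_eq_one_right h.symm

theorem div_prod_sub_eq {n : ℕ} (hn : 1 ≤ n) {t : ℂ} (ht : ∀ k < n, t ≠ k) (g : ℂ → ℂ) :
    g t / ∏ k ∈ Finset.range n, (t - k) = ∑ k ∈ Finset.range n,
      Lagrange.nodalWeight (Finset.range n) (fun k : ℕ => (k : ℂ)) k * ((t - k)⁻¹ * g t) := by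
  rw [div_eq_mul_inv, inv_prod_sub_eq hn ht, Finset.mul_sum]
  exact Finset.sum_congr rfl fun k _ => by ring

theorem hexInt_inv_sub_mul {c : ℂ} {ρ α β : ℝ} {k : ℝ} {p q : ℂ} {g : ℂ → ℂ}
    (hg : DifferentiableOn ℂ g (Metric.ball c ρ))
    (hα : k < α) (hβ : β < k) (hp : 0 < p.im) (hq : 0 < q.im)
    (hk : (k : ℂ) ∈ Metric.ball c ρ) (hsub : hexagon α p q β ⊆ Metric.ball c ρ) :
    hexInt (fun z => (z - k)⁻¹ * g z) α p q β = 2 * Real.pi * Complex.I * g k := by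
  have hnb : Metric.ball c ρ ∈ 𝓝 (k : ℂ) := Metric.isOpen_ball.mem_nhds hk
  have hd := (Complex.differentiableOn_dslope hnb).2 hg
  obtain ⟨Φ, hΦ⟩ := hd.isExactOn_ball
  have hne : ∀ z ∈ hexagon α p q β, z ≠ k := by
    intro z hz h
    rcases mem_hexagon_cases hp hq hz with h' | h' | h'
    · rw [h] at h'; exact hα.ne (by exact_mod_cast h')
    · rw [h] at h'; exact hβ.ne' (by exact_mod_cast h')
    · rw [h] at h'; simp at h'
  have hinv : ContinuousOn (fun z : ℂ => (z - k)⁻¹) (hexagon α p q β) :=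
    ContinuousOn.inv₀ (by fun_prop) fun z hz => sub_ne_zero.2 (hne z hz)
  have h1 : Set.EqOn (fun z : ℂ => (z - k)⁻¹ * g z)
      (fun z : ℂ => dslope g k z + ∑ _i ∈ ({()} : Finset Unit), g k * (z - k)⁻¹)
      (hexagon α p q β) := by
    intro z hz
    have := sub_ne_zero.2 (hne z hz)
    simp only [dslope_of_ne _ (hne z hz), slope, vsub_eq_sub, smul_eq_mul, Finset.sum_singleton]
    field_simp
    ring
  rw [hexInt_congr h1, hexInt_add (hd.continuousOn.mono hsub)
    (by simp only [Finset.sum_singleton]; exact continuousOn_const.mul hinv),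
    hexInt_finset_sum _ _ fun _ _ => hinv,
    hexInt_eq_zero (fun z hz => hΦ z (hsub hz)) (hd.continuousOn.mono hsub),
    hexInt_inv_sub hα hβ hp hq]
  simp
  ring

theorem hexInt_div_prod_eq {c : ℂ} {ρ α β : ℝ} {n : ℕ} (hn : 1 ≤ n) {p q : ℂ} {g : ℂ → ℂ}
    (hg : DifferentiableOn ℂ g (Metric.ball c ρ))
    (hα : (n : ℝ) - 1 < α) (hβ : β < 0) (hp : 0 < p.im) (hq : 0 < q.im)
    (hsub : hexagon α p q β ⊆ Metric.ball c ρ) (hαb : (α : ℂ) ∈ Metric.ball c ρ)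
    (hβb : (β : ℂ) ∈ Metric.ball c ρ) :
    hexInt (fun t => g t / ∏ k ∈ Finset.range n, (t - k)) α p q β
      = 2 * Real.pi * Complex.I * residueSum n g := by
  have hkn : ∀ k : ℕ, k < n → (k : ℝ) ≤ n - 1 := fun k hk => by
    have : (k : ℝ) + 1 ≤ n := by exact_mod_cast hk
    linarith
  have hne : ∀ z ∈ hexagon α p q β, ∀ k : ℕ, k < n → z ≠ k := by
    intro z hz k hk h
    have h0 : (0 : ℝ) ≤ k := k.cast_nonneg
    rcases mem_hexagon_cases hp hq hz with h' | h' | h'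
    · rw [h] at h'
      have : (k : ℝ) = α := by exact_mod_cast h'
      linarith [hkn k hk]
    · rw [h] at h'
      have : (k : ℝ) = β := by exact_mod_cast h'
      linarith
    · rw [h] at h'; simp at h'
  have hkb : ∀ k : ℕ, k < n → ((k : ℝ) : ℂ) ∈ Metric.ball c ρ := by
    intro k hk
    have h0 : (0 : ℝ) ≤ k := k.cast_nonneg
    have hk1 := hkn k hk
    have hpos : 0 < α - β := by linarith
    refine (convex_ball c ρ).segment_subset hβb hαb ?_
    rw [segment_eq_image']
    refine ⟨(k - β) / (α - β), ⟨by apply div_nonneg <;> linarith,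
      (div_le_one hpos).2 (by linarith)⟩, ?_⟩
    simp only [Complex.real_smul]
    rw [← Complex.ofReal_sub, ← Complex.ofReal_mul, ← Complex.ofReal_add]
    congr 1
    field_simp
    ring
  rw [hexInt_congr fun z hz => div_prod_sub_eq hn (hne z hz) g,
    hexInt_finset_sum _ _ fun k hk => ?_, residueSum, Finset.mul_sum]
  · refine Finset.sum_congr rfl fun k hk => ?_
    have hk' := Finset.mem_range.1 hk
    have := hexInt_inv_sub_mul hg (k := (k : ℝ)) (by linarith [hkn k hk'])
      (by linarith [(k.cast_nonneg : (0 : ℝ) ≤ k)]) hp hq (hkb k hk') hsub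
    simp only [Complex.ofReal_natCast] at this
    rw [this]
    ring
  · refine ContinuousOn.mul (ContinuousOn.inv₀ (by fun_prop) fun z hz => ?_)
      (hg.continuousOn.mono hsub)
    exact sub_ne_zero.2 (hne z hz k (Finset.mem_range.1 hk))

theorem circleIntegral_div_prod_eq {c : ℂ} {ρ : ℝ} {n : ℕ} (hn : 1 ≤ n) {g : ℂ → ℂ}
    (hρ : 0 < ρ) (hg : DiffContOnCl ℂ g (Metric.ball c ρ))
    (hk : ∀ k : ℕ, k < n → (k : ℂ) ∈ Metric.ball c ρ) :
    (∮ t in C(c, ρ), g t / ∏ k ∈ Finset.range n, (t - k))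
      = 2 * Real.pi * Complex.I * residueSum n g := by
  have hne : ∀ z ∈ Metric.sphere c ρ, ∀ k : ℕ, k < n → z ≠ k := by
    intro z hz k hkn h
    have h1 := hk k hkn
    rw [← h, Metric.mem_ball] at h1
    rw [Metric.mem_sphere] at hz
    linarith
  rw [circleIntegral.integral_congr hρ.le fun z hz => div_prod_sub_eq hn (hne z hz) g,
    circleIntegral.integral_fun_sum fun k hk => ?_, residueSum, Finset.mul_sum]
  · refine Finset.sum_congr rfl fun k hkn => ?_
    have := hg.circleIntegral_sub_inv_smul (hk k (Finset.mem_range.1 hkn))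
    simp only [smul_eq_mul] at this
    rw [circleIntegral.integral_const_mul, this]
    ring
  · refine ContinuousOn.circleIntegrable hρ.le (continuousOn_const.mul
      (ContinuousOn.mul (ContinuousOn.inv₀ (by fun_prop) fun z hz => ?_) ?_))
    · exact sub_ne_zero.2 (hne z hz k (Finset.mem_range.1 hk))
    · exact hg.continuousOn_ball.mono Metric.sphere_subset_closedBall

/-! ### Decay of the Gamma function and shifting vertical contours -/

theorem exists_norm_Gamma_mul_le (a b : ℝ) (ha : 0 < a) (m : ℕ) :
    ∃ C : ℝ, 0 ≤ C ∧ ∀ z : ℂ, a ≤ z.re → z.re ≤ b →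
      ‖Complex.Gamma z‖ * (1 + |z.im|) ^ m ≤ C := by
  have bound : ∀ m : ℕ, ∃ C : ℝ, 0 ≤ C ∧ ∀ z : ℂ, a ≤ z.re → z.re ≤ b →
      ‖Complex.Gamma z‖ * |z.im| ^ m ≤ C := by
    intro m
    have hcont : ContinuousOn (fun x : ℝ => ‖Complex.Gamma x‖) (Set.Icc a (b + m)) := by
      refine ContinuousOn.norm fun x hx => ?_
      refine ContinuousAt.continuousWithinAt ?_
      refine ContinuousAt.comp (f := fun x : ℝ => (x : ℂ)) (g := Complex.Gamma) ?_
        Complex.continuous_ofReal.continuousAt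
      refine (Complex.differentiableAt_Gamma _ fun k hk => ?_).continuousAt
      have : x = -(k : ℝ) := by exact_mod_cast hk
      linarith [hx.1, (k.cast_nonneg : (0 : ℝ) ≤ k)]
    obtain ⟨C, hC⟩ := isCompact_Icc.bddAbove_image hcont
    refine ⟨max C 0, le_max_right _ _, fun z hz1 hz2 => (le_trans ?_ (hC ⟨z.re + m,
      ⟨by linarith [(m.cast_nonneg : (0 : ℝ) ≤ m)], by linarith⟩, rfl⟩)).trans (le_max_left _ _)⟩
    have hz : ∀ k : ℕ, z + k ≠ 0 := fun k h => by
      have := congrArg Complex.re h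
      simp at this
      linarith [(k.cast_nonneg : (0 : ℝ) ≤ k)]
    have h1 : ‖Complex.Gamma (z + m)‖ ≤ ‖Complex.Gamma ((z.re + m : ℝ) : ℂ)‖ := by
      have := norm_Gamma_le_norm_Gamma (x := z.re + m) (y := 0) (Y := z.im)
        (by linarith [(m.cast_nonneg : (0 : ℝ) ≤ m)]) (by simp)
      convert this using 3
      · apply Complex.ext <;> simp
      · simp
    refine le_trans ?_ h1
    rw [Gamma_add_natCast hz, norm_mul, norm_prod]
    refine mul_le_mul_of_nonneg_left ?_ (norm_nonneg _)
    calc |z.im| ^ m = ∏ _i ∈ Finset.range m, |z.im| := by simp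
      _ ≤ _ := Finset.prod_le_prod (fun _ _ => abs_nonneg _) fun i _ => by
        simpa using Complex.abs_im_le_norm (z + i)
  obtain ⟨C0, hC0, h0⟩ := bound 0
  obtain ⟨C1, hC1, h1⟩ := bound m
  refine ⟨2 ^ (m - 1) * (C0 + C1), by positivity, fun z hz1 hz2 => ?_⟩
  have h2 := add_pow_le (zero_le_one (α := ℝ)) (abs_nonneg z.im) m
  have h3 := h0 z hz1 hz2
  have h4 := h1 z hz1 hz2
  simp only [pow_zero, mul_one] at h3
  calc ‖Complex.Gamma z‖ * (1 + |z.im|) ^ m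
      ≤ ‖Complex.Gamma z‖ * (2 ^ (m - 1) * (1 ^ m + |z.im| ^ m)) := by gcongr
    _ = 2 ^ (m - 1) * (‖Complex.Gamma z‖ + ‖Complex.Gamma z‖ * |z.im| ^ m) := by
      rw [one_pow]; ring
    _ ≤ _ := by gcongr

/-- The integral along the vertical line `Re s = -1/2` equals the integral along any
piecewise smooth graph `a + i c r` in the right half-plane that stays in a strip. -/
theorem integral_line_eq_integral_graph {H : ℂ → ℂ} {a a' : ℝ → ℝ} {b c C L : ℝ} {D : Set ℝ}
    (hc : 0 < c) (hH : DifferentiableOn ℂ H {z | -1 < z.re})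
    (hbd : ∀ z : ℂ, -(1 / 2) ≤ z.re → z.re ≤ b → ‖H z‖ ≤ C * (1 + z.im ^ 2)⁻¹)
    (ha : Continuous a) (ha1 : ∀ r, -(1 / 2) ≤ a r) (ha2 : ∀ r, a r ≤ b)
    (hD : D.Countable) (ha' : ∀ r ∉ D, HasDerivAt a (a' r) r) (hm : Measurable a')
    (hL : ∀ r, |a' r| ≤ L) :
    (∫ σ : ℝ, Complex.I * H (((-(1 / 2) : ℝ) : ℂ) + (σ : ℂ) * Complex.I)) =
      ∫ r : ℝ, ((a' r : ℂ) + (c : ℂ) * Complex.I) *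
        H ((a r : ℂ) + ((c * r : ℝ) : ℂ) * Complex.I) := by
  have hb : -(1 / 2) ≤ b := (ha1 0).trans (ha2 0)
  have hopen : IsOpen {z : ℂ | -1 < z.re} := isOpen_lt continuous_const Complex.continuous_re
  have hC : 0 ≤ C := by
    have := (norm_nonneg _).trans (hbd ((-(1 / 2) : ℝ) : ℂ) (by simp) (by simpa using hb))
    simpa using this
  have hL0 : 0 ≤ L := (abs_nonneg _).trans (hL 0)
  -- both integrands are integrable
  have hI : ∀ (α α' : ℝ → ℝ), Continuous α → (∀ r, -(1 / 2) ≤ α r) → (∀ r, α r ≤ b) →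
      Measurable α' → (∀ r, |α' r| ≤ L) → Integrable (fun r : ℝ => ((α' r : ℂ) + (c : ℂ) *
        Complex.I) * H ((α r : ℂ) + ((c * r : ℝ) : ℂ) * Complex.I)) := by
    intro α α' hα hα1 hα2 hm hL
    have h1 : Integrable (fun r : ℝ => (L + c) * (C * (1 + (c * r) ^ 2)⁻¹)) :=
      ((integrable_inv_one_add_sq.comp_mul_left' hc.ne').const_mul C).const_mul _
    refine h1.mono' ?_ (Eventually.of_forall fun r => ?_)
    · refine AEStronglyMeasurable.mul (by
        exact ((Complex.measurable_ofReal.comp hm).add_const _).aestronglyMeasurable) ?_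
      refine Continuous.aestronglyMeasurable ?_
      refine hH.continuousOn.comp_continuous (by fun_prop) fun r => ?_
      simp
      linarith [hα1 r]
    · rw [norm_mul]
      refine mul_le_mul ?_ ?_ (norm_nonneg _) (by positivity)
      · refine (norm_add_le _ _).trans ?_
        simp [abs_of_pos hc]
        exact hL r
      · have := hbd ((α r : ℂ) + ((c * r : ℝ) : ℂ) * Complex.I) (by simpa using hα1 r)
          (by simpa using hα2 r)
        simpa using this
  have hI1 := hI a a' ha ha1 ha2 hm hL
  have hI0 := hI (fun _ => -(1 / 2)) (fun _ => 0) continuous_const (fun _ => le_rfl)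
    (fun _ => hb) measurable_const (fun _ => by simpa using hL0)
  have hscale : (∫ σ : ℝ, Complex.I * H (((-(1 / 2) : ℝ) : ℂ) + (σ : ℂ) * Complex.I)) =
      ∫ r : ℝ, (((0 : ℝ) : ℂ) + (c : ℂ) * Complex.I) *
        H (((-(1 / 2) : ℝ) : ℂ) + ((c * r : ℝ) : ℂ) * Complex.I) := by
    have := Measure.integral_comp_mul_left
      (fun σ : ℝ => Complex.I * H (((-(1 / 2) : ℝ) : ℂ) + (σ : ℂ) * Complex.I)) c
    rw [abs_of_pos (inv_pos.2 hc)] at this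
    have h2 : ∀ r : ℝ, (((0 : ℝ) : ℂ) + (c : ℂ) * Complex.I) *
        H (((-(1 / 2) : ℝ) : ℂ) + ((c * r : ℝ) : ℂ) * Complex.I) = (c : ℂ) * (Complex.I *
          H (((-(1 / 2) : ℝ) : ℂ) + ((c * r : ℝ) : ℂ) * Complex.I)) := fun r => by
      push_cast; ring
    simp only [h2]
    refine Eq.trans ?_ (integral_const_mul (c : ℂ) fun r : ℝ => Complex.I *
      H (((-(1 / 2) : ℝ) : ℂ) + ((c * r : ℝ) : ℂ) * Complex.I)).symm
    rw [this, Complex.real_smul, ← mul_assoc, ← Complex.ofReal_mul,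
      mul_inv_cancel₀ hc.ne', Complex.ofReal_one, one_mul]
  rw [hscale]
  -- the truncated integrals differ by two horizontal segments
  have hdiff : ∀ A : ℝ, 0 < A →
      ‖(∫ r in (-A)..A, (((0 : ℝ) : ℂ) + (c : ℂ) * Complex.I) *
        H (((-(1 / 2) : ℝ) : ℂ) + ((c * r : ℝ) : ℂ) * Complex.I)) -
      ∫ r in (-A)..A, ((a' r : ℂ) + (c : ℂ) * Complex.I) *
        H ((a r : ℂ) + ((c * r : ℝ) : ℂ) * Complex.I)‖ ≤
      2 * (b + 1) * (C * (1 + (c * A) ^ 2)⁻¹) := by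
    intro A hA
    set ρ : ℝ := 1 + b ^ 2 + c ^ 2 * A ^ 2 with hρ
    have hball : Metric.ball (ρ : ℂ) (ρ + 1) ⊆ {z | -1 < z.re} := by
      intro z hz
      have h1 := Complex.abs_re_le_norm (z - ρ)
      rw [Metric.mem_ball, dist_eq_norm] at hz
      simp at h1
      have := neg_abs_le (z.re - ρ)
      simp only [Set.mem_ofPred_eq]
      linarith
    have hmem : ∀ z : ℂ, -(1 / 2) ≤ z.re → z.re ≤ b → |z.im| ≤ c * A →
        z ∈ Metric.ball (ρ : ℂ) (ρ + 1) := by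
      intro z h1 h2 h3
      rw [Metric.mem_ball, dist_eq_norm]
      refine lt_of_pow_lt_pow_left₀ 2 (by positivity) ?_
      rw [Complex.sq_norm, Complex.normSq_apply]
      simp only [Complex.sub_re, Complex.sub_im, Complex.ofReal_re, Complex.ofReal_im, sub_zero]
      have h4 : z.im ^ 2 ≤ (c * A) ^ 2 := sq_le_sq' (by linarith [neg_abs_le z.im])
        (by linarith [le_abs_self z.im])
      have h5 : z.re ^ 2 ≤ b ^ 2 + 1 / 4 := by
        rcases le_or_gt 0 z.re with h | h
        · nlinarith
        · nlinarith [sq_nonneg b]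
      have hρ1 : 0 < ρ := by positivity
      nlinarith
    obtain ⟨Φ, hΦ⟩ := (hH.mono hball).isExactOn_ball
    have key : ∀ (α α' : ℝ → ℝ), Continuous α → (∀ r, -(1 / 2) ≤ α r) → (∀ r, α r ≤ b) →
        (∀ r ∉ D, HasDerivAt α (α' r) r) → Integrable (fun r : ℝ => ((α' r : ℂ) + (c : ℂ) *
          Complex.I) * H ((α r : ℂ) + ((c * r : ℝ) : ℂ) * Complex.I)) →
        ∫ r in (-A)..A, ((α' r : ℂ) + (c : ℂ) * Complex.I) *
          H ((α r : ℂ) + ((c * r : ℝ) : ℂ) * Complex.I) =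
        Φ ((α A : ℂ) + ((c * A : ℝ) : ℂ) * Complex.I) -
          Φ ((α (-A) : ℂ) + ((c * (-A) : ℝ) : ℂ) * Complex.I) := by
      intro α α' hα hα1 hα2 hd hi
      have hin : ∀ r ∈ Set.Icc (-A) A, (α r : ℂ) + ((c * r : ℝ) : ℂ) * Complex.I ∈
          Metric.ball (ρ : ℂ) (ρ + 1) := fun r hr => hmem _ (by simpa using hα1 r)
        (by simpa using hα2 r) (by
          simp only [Complex.add_im, Complex.ofReal_im, Complex.mul_im, Complex.ofReal_re,
            Complex.I_im, Complex.I_re, mul_one, mul_zero, add_zero, zero_add]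
          rw [abs_mul, abs_of_pos hc]
          exact mul_le_mul_of_nonneg_left (abs_le.2 hr) hc.le)
      refine integral_eq_of_hasDerivAt_off_countable
        (fun r => Φ ((α r : ℂ) + ((c * r : ℝ) : ℂ) * Complex.I)) _ hD ?_ ?_
        hi.intervalIntegrable
      · rw [Set.uIcc_of_le (by linarith)]
        intro r hr
        refine ContinuousAt.continuousWithinAt ?_
        exact ContinuousAt.comp (g := Φ) (hΦ _ (hin r hr)).continuousAt (by fun_prop)
      · rw [min_eq_left (by linarith), max_eq_right (by linarith)]
        intro r hr
        have h1 := hΦ _ (hin r ⟨hr.1.1.le, hr.1.2.le⟩)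
        have h2 : HasDerivAt (fun r : ℝ => (α r : ℂ) + ((c * r : ℝ) : ℂ) * Complex.I)
            ((α' r : ℂ) + (c : ℂ) * Complex.I) r := by
          refine (hd r hr.2).ofReal_comp.add ?_
          have := (((hasDerivAt_id r).const_mul c).ofReal_comp).mul_const Complex.I
          simpa using this
        rw [mul_comm]
        exact h1.comp r h2
    rw [key a a' ha ha1 ha2 ha' hI1, key (fun _ => -(1 / 2)) (fun _ => 0) continuous_const
      (fun _ => le_rfl) (fun _ => hb) (fun r _ => hasDerivAt_const _ _) hI0]
    have hseg : ∀ r : ℝ, |r| = A → ‖Φ (((-(1 / 2) : ℝ) : ℂ) + ((c * r : ℝ) : ℂ) * Complex.I) -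
        Φ ((a r : ℂ) + ((c * r : ℝ) : ℂ) * Complex.I)‖ ≤ (b + 1) * (C * (1 + (c * A) ^ 2)⁻¹) := by
      intro r hr
      set S : Set ℂ := {z | (-(1 / 2) ≤ z.re ∧ z.re ≤ b) ∧ z.im = c * r} with hS
      have hconv : Convex ℝ S := by
        refine Convex.inter (Convex.inter ?_ ?_) ?_
        · exact convex_halfSpace_re_ge _
        · exact convex_halfSpace_re_le _
        · exact convex_hyperplane (f := Complex.im) ⟨fun _ _ => rfl, fun _ _ => by simp⟩ _
      have hSmem : ∀ z ∈ S, z ∈ Metric.ball (ρ : ℂ) (ρ + 1) := fun z hz =>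
        hmem z hz.1.1 hz.1.2 (by rw [hz.2, abs_mul, abs_of_pos hc, hr])
      have := hconv.norm_image_sub_le_of_norm_hasDerivWithin_le (f := Φ) (f' := H)
        (C := C * (1 + (c * A) ^ 2)⁻¹) (fun z hz => (hΦ z (hSmem z hz)).hasDerivWithinAt)
        (fun z hz => by
          have h := hbd z hz.1.1 hz.1.2
          rw [hz.2, mul_pow, ← sq_abs r, hr, ← mul_pow] at h
          exact h)
        (x := (a r : ℂ) + ((c * r : ℝ) : ℂ) * Complex.I)
        (y := ((-(1 / 2) : ℝ) : ℂ) + ((c * r : ℝ) : ℂ) * Complex.I)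
        (by simpa [hS] using ⟨by simpa using ha1 r, ha2 r⟩)
        (by simpa [hS] using by simpa using hb)
      refine this.trans ?_
      rw [mul_comm]
      refine mul_le_mul_of_nonneg_right ?_ (by positivity)
      rw [add_sub_add_right_eq_sub, ← Complex.ofReal_sub, Complex.norm_real, Real.norm_eq_abs,
        abs_le]
      constructor <;> linarith [ha1 r, ha2 r]
    calc _ = ‖(Φ (((-(1 / 2) : ℝ) : ℂ) + ((c * A : ℝ) : ℂ) * Complex.I) -
        Φ ((a A : ℂ) + ((c * A : ℝ) : ℂ) * Complex.I)) -
        (Φ (((-(1 / 2) : ℝ) : ℂ) + ((c * (-A) : ℝ) : ℂ) * Complex.I) -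
        Φ ((a (-A) : ℂ) + ((c * (-A) : ℝ) : ℂ) * Complex.I))‖ := by congr 1; ring
      _ ≤ _ := (norm_sub_le _ _).trans (add_le_add (hseg A (abs_of_pos hA))
        (hseg (-A) (by rw [abs_neg, abs_of_pos hA])))
      _ = _ := by ring
  have hlim := ((intervalIntegral_tendsto_integral hI0 tendsto_neg_atTop_atBot tendsto_id).sub
    (intervalIntegral_tendsto_integral hI1 tendsto_neg_atTop_atBot tendsto_id)).norm
  have hz : Tendsto (fun A : ℝ => 2 * (b + 1) * (C * (1 + (c * A) ^ 2)⁻¹)) atTop (𝓝 0) := by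
    have h1 : Tendsto (fun A : ℝ => 1 + (c * A) ^ 2) atTop atTop :=
      tendsto_atTop_add_const_left _ _
        ((tendsto_pow_atTop two_ne_zero).comp (tendsto_id.const_mul_atTop hc))
    simpa using (h1.inv_tendsto_atTop.const_mul C).const_mul (2 * (b + 1))
  have h0 := le_of_tendsto_of_tendsto hlim hz
    ((eventually_gt_atTop 0).mono fun A hA => hdiff A hA)
  exact sub_eq_zero.1 (norm_le_zero_iff.1 h0)

/-! ### The finite-`n` kernel as a single contour integral -/

/-- The entire factor of the integrand in the variable `t`. -/
noncomputable def entirePart (M : ℕ) (ν : ℕ → ℕ) (x : ℝ) (t : ℂ) : ℂ :=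
  Complex.exp (t * Real.log x) * ∏ j ∈ Finset.range M, (Complex.Gamma (t + ν (j + 1) + 1))⁻¹

theorem differentiable_entirePart (M : ℕ) (ν : ℕ → ℕ) (x : ℝ) :
    Differentiable ℂ (entirePart M ν x) := by
  unfold entirePart
  refine Differentiable.mul (by fun_prop) (Differentiable.fun_finsetProd fun j _ => ?_)
  exact Complex.differentiable_one_div_Gamma.comp
    (f := fun t : ℂ => t + ν (j + 1) + 1) (by fun_prop)

/-- The kernel after evaluating the inner contour integral by residues. -/
noncomputable def kernelFun (M : ℕ) (ν : ℕ → ℕ) (n : ℕ) (x y : ℝ) (s : ℂ) : ℂ :=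
  (∏ j ∈ Finset.range M, Complex.Gamma (s + ν (j + 1) + 1)) *
    Complex.exp (-(s + 1) * Real.log y) *
    ∑ k ∈ Finset.range n, Lagrange.nodalWeight (Finset.range n) (fun k : ℕ => (k : ℂ)) k *
      entirePart M ν x k * ∏ j ∈ (Finset.range n).erase k, (s - j)

theorem differentiableOn_kernelFun (M : ℕ) (ν : ℕ → ℕ) (n : ℕ) (x y : ℝ) :
    DifferentiableOn ℂ (kernelFun M ν n x y) {z | -1 < z.re} := by
  unfold kernelFun
  refine (DifferentiableOn.mul (DifferentiableOn.fun_finsetProd fun j _ z hz => ?_)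
    (Differentiable.differentiableOn (by fun_prop))).mul
    (Differentiable.differentiableOn (Differentiable.fun_sum fun k _ =>
      (Differentiable.const_mul (Differentiable.fun_finsetProd fun j _ => by fun_prop) _)))
  refine DifferentiableAt.differentiableWithinAt ?_
  refine DifferentiableAt.comp (f := fun t : ℂ => t + ν (j + 1) + 1) (g := Complex.Gamma) z
    (Complex.differentiableAt_Gamma _ fun k hk => ?_) (by fun_prop)
  have h1 := congrArg Complex.re hk
  simp at h1
  have hz' : -1 < z.re := hz
  linarith [(k.cast_nonneg : (0 : ℝ) ≤ k), ((ν (j + 1)).cast_nonneg : (0 : ℝ) ≤ ν (j + 1))]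

theorem exists_norm_kernelFun_le {M : ℕ} (hM : 1 ≤ M) (ν : ℕ → ℕ) (n : ℕ) (x y b : ℝ) :
    ∃ C : ℝ, ∀ z : ℂ, -(1 / 2) ≤ z.re → z.re ≤ b →
      ‖kernelFun M ν n x y z‖ ≤ C * (1 + z.im ^ 2)⁻¹ := by
  have hG : ∀ j m : ℕ, ∃ C : ℝ, 0 ≤ C ∧ ∀ z : ℂ, -(1 / 2) ≤ z.re → z.re ≤ b →
      ‖Complex.Gamma (z + ν (j + 1) + 1)‖ * (1 + |z.im|) ^ m ≤ C := by
    intro j m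
    obtain ⟨C, hC0, hC⟩ := exists_norm_Gamma_mul_le (1 / 2) (b + ν (j + 1) + 1) (by norm_num) m
    refine ⟨C, hC0, fun z h1 h2 => ?_⟩
    have := hC (z + ν (j + 1) + 1) (by
      simp; linarith [((ν (j + 1)).cast_nonneg : (0 : ℝ) ≤ ν (j + 1))]) (by simpa using h2)
    simpa using this
  choose C hC0 hC using hG
  set K : ℝ := |b| + n + 1 with hK
  have hK1 : 1 ≤ K := by
    linarith [abs_nonneg b, (n.cast_nonneg : (0 : ℝ) ≤ n)]
  set W : ℝ := ∑ k ∈ Finset.range n, ‖Lagrange.nodalWeight (Finset.range n)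
    (fun k : ℕ => (k : ℂ)) k * entirePart M ν x k‖ with hW
  have hW0 : 0 ≤ W := Finset.sum_nonneg fun _ _ => norm_nonneg _
  obtain ⟨M', rfl⟩ : ∃ M', M = M' + 1 := ⟨M - 1, by omega⟩
  set G : ℝ := ∏ j ∈ Finset.range M', C (j + 1) 0 with hGdef
  have hG0 : 0 ≤ G := Finset.prod_nonneg fun _ _ => hC0 _ _
  refine ⟨G * C 0 (n + 2) * Real.exp ((|b| + 1) * |Real.log y|) * (W * K ^ n),
    fun z h1 h2 => ?_⟩
  have hb1 : |z.re| ≤ |b| + 1 / 2 := by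
    rw [abs_le]
    constructor <;> linarith [le_abs_self b, abs_nonneg b]
  have hE : ‖Complex.exp (-(z + 1) * Real.log y)‖ ≤ Real.exp ((|b| + 1) * |Real.log y|) := by
    rw [Complex.norm_exp]
    refine Real.exp_le_exp.2 ((le_abs_self _).trans ?_)
    rw [Complex.re_mul_ofReal, abs_mul]
    refine mul_le_mul_of_nonneg_right ?_ (abs_nonneg _)
    simp only [Complex.neg_re, Complex.add_re, Complex.one_re, abs_neg]
    rw [abs_le]
    constructor <;> linarith [le_abs_self b, abs_nonneg b]
  have hS : ‖∑ k ∈ Finset.range n, Lagrange.nodalWeight (Finset.range n)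
      (fun k : ℕ => (k : ℂ)) k * entirePart (M' + 1) ν x k *
        ∏ j ∈ (Finset.range n).erase k, (z - j)‖ ≤ W * (K ^ n * (1 + |z.im|) ^ n) := by
    refine (norm_sum_le _ _).trans ?_
    rw [hW, Finset.sum_mul]
    refine Finset.sum_le_sum fun k hk => ?_
    rw [norm_mul]
    refine mul_le_mul_of_nonneg_left ?_ (norm_nonneg _)
    rw [norm_prod, ← mul_pow]
    have hbase : 1 ≤ K * (1 + |z.im|) := by nlinarith [abs_nonneg z.im]
    calc ∏ j ∈ (Finset.range n).erase k, ‖z - j‖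
        ≤ ∏ _j ∈ (Finset.range n).erase k, (K * (1 + |z.im|)) := by
          refine Finset.prod_le_prod (fun _ _ => norm_nonneg _) fun j hj => ?_
          have hj' : (j : ℝ) + 1 ≤ n := by
            exact_mod_cast Finset.mem_range.1 (Finset.mem_of_mem_erase hj)
          have h3 : ‖z - j‖ ≤ |z.re| + |z.im| + j := by
            refine (norm_sub_le _ _).trans ?_
            rw [Complex.norm_natCast]
            linarith [Complex.norm_le_abs_re_add_abs_im z]
          nlinarith [abs_nonneg z.im]
      _ = (K * (1 + |z.im|)) ^ (n - 1) := by
          rw [Finset.prod_const, Finset.card_erase_of_mem hk, Finset.card_range]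
      _ ≤ (K * (1 + |z.im|)) ^ n := pow_le_pow_right₀ hbase (Nat.sub_le _ _)
  have hP : ‖∏ j ∈ Finset.range (M' + 1), Complex.Gamma (z + ν (j + 1) + 1)‖ ≤
      G * ‖Complex.Gamma (z + ν (0 + 1) + 1)‖ := by
    rw [Finset.prod_range_succ', norm_mul, norm_prod]
    refine mul_le_mul_of_nonneg_right ?_ (norm_nonneg _)
    refine Finset.prod_le_prod (fun _ _ => norm_nonneg _) fun j _ => ?_
    simpa using hC (j + 1) 0 z h1 h2
  have hpos : 0 < 1 + z.im ^ 2 := by positivity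
  rw [← div_eq_mul_inv, le_div_iff₀ hpos]
  unfold kernelFun
  rw [norm_mul, norm_mul]
  calc _ ≤ G * ‖Complex.Gamma (z + ν (0 + 1) + 1)‖ *
        Real.exp ((|b| + 1) * |Real.log y|) * (W * (K ^ n * (1 + |z.im|) ^ n)) *
        (1 + |z.im|) ^ 2 := by
        gcongr
        nlinarith [abs_nonneg z.im, sq_abs z.im]
    _ = G * (‖Complex.Gamma (z + ν (0 + 1) + 1)‖ * (1 + |z.im|) ^ (n + 2)) *
        Real.exp ((|b| + 1) * |Real.log y|) * (W * K ^ n) := by ring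
    _ ≤ _ := by
        gcongr
        exact hC 0 (n + 2) z h1 h2

theorem kernelFun_eq (M : ℕ) (ν : ℕ → ℕ) (n : ℕ) (x y : ℝ) {s : ℂ} (hs : ∀ k < n, s ≠ k) :
    kernelFun M ν n x y s = weight M ν n s * Complex.exp (-(s + 1) * Real.log y) *
      residueSum n (fun t => entirePart M ν x t / (s - t)) := by
  unfold kernelFun weight residueSum
  have : ∑ k ∈ Finset.range n, Lagrange.nodalWeight (Finset.range n) (fun k : ℕ => (k : ℂ)) k *
      entirePart M ν x k * ∏ j ∈ (Finset.range n).erase k, (s - j) =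
      (∏ k ∈ Finset.range n, (s - k)) * ∑ k ∈ Finset.range n,
        Lagrange.nodalWeight (Finset.range n) (fun k : ℕ => (k : ℂ)) k *
          (entirePart M ν x k / (s - k)) := by
    rw [Finset.mul_sum]
    refine Finset.sum_congr rfl fun k hk => ?_
    rw [← Finset.mul_prod_erase _ _ hk]
    have := sub_ne_zero.2 (hs k (Finset.mem_range.1 hk))
    field_simp
  rw [this]
  ring

theorem Gamma_add_one_eq_prod_mul {z : ℂ} (hz : ∀ k : ℤ, z ≠ k) (n : ℕ) :
    Complex.Gamma (z + 1) = (∏ k ∈ Finset.range n, (z - k)) * Complex.Gamma (z - n + 1) := by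
  induction n with
  | zero => simp
  | succ n ih =>
    rw [ih, Finset.prod_range_succ, Complex.Gamma_add_one (z - n) (sub_ne_zero.2 (by
      exact_mod_cast hz n))]
    push_cast
    rw [show z - ((n : ℂ) + 1) + 1 = z - n by ring]
    ring

theorem integrand_eq (M : ℕ) (ν : ℕ → ℕ) (hν0 : ν 0 = 0) (n : ℕ) (x y : ℝ) {s t : ℂ}
    (hs : ∀ k : ℤ, s ≠ k) (ht : ∀ k : ℤ, t ≠ k) :
    integrand M ν n x y s t = weight M ν n s * Complex.exp (-(s + 1) * Real.log y) *
      (entirePart M ν x t / (s - t) / ∏ k ∈ Finset.range n, (t - k)) := by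
  have hG : ∀ z : ℂ, (∀ k : ℤ, z ≠ k) → Complex.Gamma (z - n + 1) ≠ 0 := fun z hz =>
    Complex.Gamma_ne_zero fun m hm => hz (n - 1 - m) (by
      push_cast; linear_combination hm)
  have hPt : ∏ k ∈ Finset.range n, (t - k) ≠ 0 := Finset.prod_ne_zero_iff.2 fun k _ =>
    sub_ne_zero.2 (by exact_mod_cast ht k)
  have h1 := hG s hs
  have h2 := hG t ht
  unfold integrand weight entirePart
  rw [Finset.prod_range_succ', hν0]
  simp only [Nat.cast_zero, add_zero, Finset.prod_div_distrib, Finset.prod_inv_distrib]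
  rw [Gamma_add_one_eq_prod_mul hs n, Gamma_add_one_eq_prod_mul ht n]
  field_simp

theorem ne_intCast_of_mem_sphere {n : ℕ} {t : ℂ}
    (ht : t ∈ Metric.sphere (((n : ℂ) - 1) / 2) ((n : ℝ) / 2 - 1 / 8)) (k : ℤ) : t ≠ k := by
  rintro rfl
  rw [Metric.mem_sphere, dist_eq_norm] at ht
  have h1 : ((k : ℂ) - ((n : ℂ) - 1) / 2) = (((k : ℝ) - ((n : ℝ) - 1) / 2 : ℝ) : ℂ) := by
    push_cast; ring
  rw [h1, Complex.norm_real, Real.norm_eq_abs] at ht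
  rcases abs_choice ((k : ℝ) - ((n : ℝ) - 1) / 2) with h | h <;> rw [h] at ht
  · have : (8 * k : ℤ) = 8 * (n : ℤ) - 5 := by
      have : (8 * k : ℝ) = 8 * (n : ℝ) - 5 := by linarith
      exact_mod_cast this
    omega
  · have : (8 * k : ℤ) = -3 := by
      have : (8 * k : ℝ) = -3 := by linarith
      exact_mod_cast this
    omega

theorem sC_eq (σ : ℝ) : sC σ = ((-(1 / 2) : ℝ) : ℂ) + (σ : ℂ) * Complex.I := by
  unfold sC; push_cast; ring

theorem sC_ne_intCast (σ : ℝ) (k : ℤ) : sC σ ≠ k := by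
  intro h
  have h1 := congrArg Complex.re h
  rw [sC_eq] at h1
  simp at h1
  have : (2 * k : ℤ) = -1 := by
    have : (2 * k : ℝ) = -1 := by linarith
    exact_mod_cast this
  omega

theorem Kn_eq (M : ℕ) (ν : ℕ → ℕ) (hν0 : ν 0 = 0) {n : ℕ} (hn : 1 ≤ n) (x y : ℝ) :
    Kn M ν n x y = (1 / (2 * (Real.pi : ℂ) * Complex.I) ^ 2) *
      ∫ σ : ℝ, Complex.I * (2 * Real.pi * Complex.I *
        kernelFun M ν n x y (((-(1 / 2) : ℝ) : ℂ) + (σ : ℂ) * Complex.I)) := by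
  unfold Kn
  congr 1
  refine integral_congr_ae (Eventually.of_forall fun σ => ?_)
  simp only
  congr 1
  rw [← sC_eq]
  have hn1 : (1 : ℝ) ≤ n := by exact_mod_cast hn
  set c : ℂ := ((n : ℂ) - 1) / 2 with hc
  set ρ : ℝ := (n : ℝ) / 2 - 1 / 8 with hρ
  have hρ0 : 0 < ρ := by rw [hρ]; linarith
  have htC : ∀ θ : ℝ, tC n θ = circleMap c ρ θ := fun θ => by
    unfold tC circleMap; rw [hc, hρ]; push_cast; ring
  have h1 : (∫ θ in (0 : ℝ)..(2 * Real.pi), (((n : ℂ) / 2 - 1/8) * Complex.I *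
      Complex.exp (θ * Complex.I)) * integrand M ν n x y (sC σ) (tC n θ)) =
      ∮ t in C(c, ρ), integrand M ν n x y (sC σ) t := by
    unfold circleIntegral
    refine intervalIntegral.integral_congr fun θ _ => ?_
    simp only [htC, deriv_circleMap, smul_eq_mul]
    congr 1
    unfold circleMap
    rw [hρ]; push_cast; ring
  rw [h1, circleIntegral.integral_congr hρ0.le fun t ht => integrand_eq M ν hν0 n x y
    (sC_ne_intCast σ) (ne_intCast_of_mem_sphere ht), circleIntegral.integral_const_mul,
    circleIntegral_div_prod_eq hn hρ0, kernelFun_eq M ν n x y fun k _ => by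
      exact_mod_cast sC_ne_intCast σ k]
  · ring
  · refine DifferentiableOn.diffContOnCl_ball (U := {t : ℂ | t ≠ sC σ}) ?_ ?_
    · refine DifferentiableOn.div (differentiable_entirePart M ν x).differentiableOn
        (by fun_prop) fun t ht => sub_ne_zero.2 (Ne.symm ht)
    · rintro t ht rfl
      rw [Metric.mem_closedBall, dist_eq_norm] at ht
      have h2 := Complex.abs_re_le_norm (sC σ - c)
      have h3 : (sC σ - c).re = -(n / 2 : ℝ) := by
        rw [hc, sC_eq]
        have : (((n : ℂ) - 1) / 2).re = ((n : ℝ) - 1) / 2 := by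
          rw [show ((n : ℂ) - 1) / 2 = (((n : ℝ) - 1) / 2 : ℝ) by push_cast; ring]
          exact Complex.ofReal_re _
        rw [Complex.sub_re, this]
        simp
        ring
      rw [h3, abs_neg, abs_of_pos (by linarith)] at h2
      linarith
  · intro k hk
    have hk' : (k : ℝ) + 1 ≤ n := by exact_mod_cast hk
    rw [Metric.mem_ball, dist_eq_norm]
    have : ((k : ℂ) - c) = (((k : ℝ) - ((n : ℝ) - 1) / 2 : ℝ) : ℂ) := by
      rw [hc]; push_cast; ring
    rw [this, Complex.norm_real, Real.norm_eq_abs, abs_lt]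
    have := (k.cast_nonneg : (0 : ℝ) ≤ k)
    constructor <;> rw [hρ] <;> linarith

/-! ### The kernel in edge coordinates -/

theorem segInt_const_mul (c : ℂ) (f : ℂ → ℂ) (a b : ℂ) :
    segInt (fun z => c * f z) a b = c * segInt f a b := by
  simp only [segInt, intervalIntegral.integral_const_mul]
  ring

theorem hexInt_const_mul (c : ℂ) (f : ℂ → ℂ) (a p q b : ℂ) :
    hexInt (fun z => c * f z) a p q b = c * hexInt f a p q b := by
  simp only [hexInt, segInt_const_mul]
  ring

theorem segInt_affine (T κ : ℂ) (f : ℂ → ℂ) (a b : ℂ) :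
    segInt f (T + κ * a) (T + κ * b) = κ * segInt (fun z => f (T + κ * z)) a b := by
  have h : ∀ u : ℝ, T + κ * a + u * (T + κ * b - (T + κ * a)) = T + κ * (a + u * (b - a)) :=
    fun u => by ring
  simp only [segInt, h]
  ring

theorem hexInt_affine (T κ : ℝ) (f : ℂ → ℂ) (a p q b : ℂ) :
    hexInt f (T + κ * a) (T + κ * p) (T + κ * q) (T + κ * b) =
      κ * hexInt (fun z => f (T + κ * z)) a p q b := by
  have h : ∀ z : ℂ, starRingEnd ℂ (T + κ * z) = T + κ * starRingEnd ℂ z := fun z => by simp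
  simp only [hexInt, h, segInt_affine]
  ring

/-- The parameter at which the edge contours turn. -/
noncomputable def edgeRadius (M n : ℕ) : ℝ := 9 / 10 / edgeScale M n

/-- The real coordinate of the point `-1/2` in edge coordinates. -/
noncomputable def edgeLeft (M n : ℕ) : ℝ := -(critPoint M n + 1 / 2) / edgeStep M n

/-- The upper left corner of the hexagon in edge coordinates. -/
noncomputable def edgeCorner (M n : ℕ) : ℂ :=
  (edgeLeft M n : ℂ) + ((√3 / 2 * edgeRadius M n : ℝ) : ℂ) * Complex.I

/-- The integral over the left contour, in edge coordinates. -/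
noncomputable def edgeInner (M : ℕ) (ν : ℕ → ℕ) (n : ℕ) (ξ : ℝ) (m : ℂ) : ℂ :=
  hexInt (fun l => (edgeWeight M ν n ξ l)⁻¹ / (m - l)) ((-1 : ℝ) : ℂ)
    (lamL (edgeRadius M n)) (edgeCorner M n) (edgeLeft M n)

/-- The slope of the real part of `rightPath`. -/
noncomputable def rightSlope (R r : ℝ) : ℝ := if |r| < R then Real.sign r / 2 else 0

theorem abs_sign_le_one (r : ℝ) : |Real.sign r| ≤ 1 := by
  rcases Real.sign_apply_eq r with h | h | h <;> simp [h]

theorem measurable_sign : Measurable Real.sign := by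
  unfold Real.sign
  exact Measurable.ite measurableSet_Iio measurable_const
    (Measurable.ite measurableSet_Ioi measurable_const measurable_const)

theorem abs_rightSlope_le (R r : ℝ) : |rightSlope R r| ≤ 1 / 2 := by
  unfold rightSlope
  split_ifs
  · rw [abs_div, abs_two]
    linarith [abs_sign_le_one r]
  · norm_num

theorem measurable_rightSlope (R : ℝ) : Measurable (rightSlope R) := by
  unfold rightSlope
  exact Measurable.ite (measurableSet_lt measurable_id.abs measurable_const)
    (measurable_sign.div_const 2) measurable_const

theorem hasDerivAt_min_abs {R r : ℝ} (h0 : r ≠ 0) (h1 : |r| ≠ R) :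
    HasDerivAt (fun r => 1 + min |r| R / 2) (rightSlope R r) r := by
  unfold rightSlope
  split_ifs with h
  · have h2 : HasDerivAt (fun r : ℝ => 1 + |r| / 2) (Real.sign r / 2) r := by
      refine ((?_ : HasDerivAt (fun r : ℝ => |r|) (Real.sign r) r).div_const 2).const_add 1
      rcases lt_or_gt_of_ne h0 with h | h
      · rw [Real.sign_of_neg h]; exact hasDerivAt_abs_neg h
      · rw [Real.sign_of_pos h]; exact hasDerivAt_abs_pos h
    refine h2.congr_of_eventuallyEq ?_
    filter_upwards [continuous_abs.continuousAt.eventually_lt continuousAt_const h] with x hx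
    rw [min_eq_left hx.le]
  · have h' : R < |r| := lt_of_le_of_ne (not_lt.1 h) (Ne.symm h1)
    refine (hasDerivAt_const r (1 + R / 2)).congr_of_eventuallyEq ?_
    filter_upwards [continuousAt_const.eventually_lt continuous_abs.continuousAt h'] with x hx
    rw [min_eq_right hx.le]

theorem edgeWeight_eq {M : ℕ} (ν : ℕ → ℕ) (n : ℕ) (ξ : ℝ) (z : ℂ) :
    edgeWeight M ν n ξ z = weight M ν n (critPoint M n + edgeStep M n * z) /
      weight M ν n (critPoint M n) *
      Complex.exp (-((critPoint M n + edgeStep M n * z) *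
        ((logEdge M n + Real.log (1 + ξ / edgeStep M n) : ℝ) : ℂ))) *
      Complex.exp (critPoint M n * ((logEdge M n + ξ / edgeStep M n : ℝ) : ℂ)) := by
  unfold edgeWeight ratio edgeExponent
  have h : (critScale M n : ℂ) * (edgeScale M n * z) = edgeStep M n * z := by
    rw [edgeStep]; push_cast; ring
  rw [h]
  simp only [mul_assoc, ← Complex.exp_add]
  congr 2
  push_cast
  ring

section

variable {M n : ℕ}

theorem weight_critPoint_ne_zero (hM : 1 ≤ M) (ν : ℕ → ℕ) (hn : 1 ≤ n) :
    weight M ν n (critPoint M n) ≠ 0 := by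
  have hN := critScale_pos hM hn
  have hT := critPoint_eq M n hM
  have hn1 : (1 : ℝ) ≤ n := by exact_mod_cast hn
  refine weight_ne_zero M ν (by rw [Complex.ofReal_re]; linarith) fun k hk h => ?_
  have h1 : critPoint M n = (k : ℝ) := by exact_mod_cast h
  have : (k : ℝ) < n := by exact_mod_cast hk
  linarith

theorem edgeRadius_pos (hn : 1 ≤ n) : 0 < edgeRadius M n :=
  div_pos (by norm_num) (edgeScale_pos M hn)

theorem edgeStep_mul_edgeLeft (hM : 1 ≤ M) (hn : 1 ≤ n) :
    critPoint M n + edgeStep M n * edgeLeft M n = -(1 / 2) := by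
  have := (edgeStep_pos hM hn).ne'
  unfold edgeLeft
  field_simp
  ring

theorem two_pi_I_mul_kernelFun (hM : 1 ≤ M) (ν : ℕ → ℕ) (hn : 1 ≤ n) (hε : edgeScale M n < 1)
    (x y : ℝ) {m : ℂ} (hm : 0 < m.re) :
    2 * Real.pi * Complex.I * kernelFun M ν n x y (critPoint M n + edgeStep M n * m) =
      edgeStep M n * (weight M ν n (critPoint M n + edgeStep M n * m) *
        Complex.exp (-(critPoint M n + edgeStep M n * m + 1) * Real.log y) *
        hexInt (fun l => Complex.exp ((critPoint M n + edgeStep M n * l) * Real.log x) /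
          weight M ν n (critPoint M n + edgeStep M n * l) / (edgeStep M n * (m - l)))
          ((-1 : ℝ) : ℂ) (lamL (edgeRadius M n)) (edgeCorner M n) (edgeLeft M n)) := by
  have hκ := edgeStep_pos hM hn
  have hN := critScale_pos hM hn
  have hT := critPoint_eq M n hM
  have hR := edgeRadius_pos (M := M) hn
  have hn1 : (1 : ℝ) ≤ n := by exact_mod_cast hn
  have hL := edgeStep_mul_edgeLeft hM hn
  have hs3 : 0 < √3 := by positivity
  have hκN : edgeStep M n < critScale M n := by
    rw [edgeStep]; nlinarith
  set T := critPoint M n with hTdef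
  set κ := edgeStep M n with hκdef
  set R := edgeRadius M n with hRdef
  set s : ℂ := T + κ * m with hs
  have hsre : s.re = T + κ * m.re := by simp [hs]
  have hsT : T < s.re := by rw [hsre]; linarith [mul_pos hκ hm]
  rw [kernelFun_eq M ν n x y fun k hk h => by
    have h1 := congrArg Complex.re h
    rw [Complex.natCast_re] at h1
    have : (k : ℝ) < n := by exact_mod_cast hk
    linarith]
  set p : ℂ := T + κ * lamL R with hp
  set q : ℂ := T + κ * edgeCorner M n with hq
  have hpre : p.re = T + κ * (-1 - R / 2) := by
    rw [hp, lamL_eq, abs_of_pos hR]; simp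
  have hpim : p.im = κ * (√3 / 2 * R) := by
    rw [hp, lamL_eq, abs_of_pos hR]; simp
  have hqre : q.re = -(1 / 2) := by
    rw [← hL, hq, edgeCorner]; simp
  have hqim : q.im = κ * (√3 / 2 * R) := by
    rw [hq, edgeCorner]; simp; left; rfl
  have hy : 0 < κ * (√3 / 2 * R) := by positivity
  set A : ℝ := κ * (√3 / 2 * R) with hA
  -- a disc to the left of `s` containing the hexagon
  have hpl : -|p.re| ≤ p.re ∧ p.re ≤ T := ⟨neg_abs_le _, by rw [hpre]; nlinarith⟩
  set d : ℝ := s.re - T with hd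
  have hd0 : 0 < d := by rw [hd]; linarith
  set ρ : ℝ := ((s.re + |p.re| + 1) ^ 2 + A ^ 2 + 1) / d with hρ
  have hρ0 : 0 < ρ := by positivity
  have hρd : ρ * d = (s.re + |p.re| + 1) ^ 2 + A ^ 2 + 1 := div_mul_cancel₀ _ hd0.ne'
  have hmem : ∀ z : ℂ, -(|p.re| + 1) ≤ z.re → z.re ≤ T → z.im ^ 2 ≤ A ^ 2 →
      z ∈ Metric.ball ((s.re - ρ : ℝ) : ℂ) ρ := by
    intro z h1 h2 h3
    rw [Metric.mem_ball, dist_eq_norm]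
    refine lt_of_pow_lt_pow_left₀ 2 hρ0.le ?_
    rw [Complex.sq_norm, Complex.normSq_apply]
    simp only [Complex.sub_re, Complex.sub_im, Complex.ofReal_re, Complex.ofReal_im, sub_zero]
    have h4 : (s.re - z.re) ^ 2 ≤ (s.re + |p.re| + 1) ^ 2 := by
      refine pow_le_pow_left₀ (by linarith) (by linarith) 2
    have h5 : ρ * d ≤ ρ * (s.re - z.re) := mul_le_mul_of_nonneg_left (by linarith) hρ0.le
    have h6 : 0 < ρ * d := mul_pos hρ0 hd0
    nlinarith
  have hball : DifferentiableOn ℂ (fun t => entirePart M ν x t / (s - t))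
      (Metric.ball ((s.re - ρ : ℝ) : ℂ) ρ) := by
    refine (differentiable_entirePart M ν x).differentiableOn.div (by fun_prop) fun t ht => ?_
    rintro h
    rw [← sub_eq_zero.1 h, Metric.mem_ball, dist_eq_norm] at ht
    have := (Complex.re_le_norm _).trans_lt ht
    simp at this
  have hα : ((T - κ : ℝ) : ℂ) = T + κ * ((-1 : ℝ) : ℂ) := by push_cast; ring
  have hβ : ((-(1 / 2) : ℝ) : ℂ) = T + κ * (edgeLeft M n : ℂ) := by
    rw [← hL]; push_cast; ring
  have hp0 := abs_nonneg p.re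
  have hαm := hmem ((T - κ : ℝ) : ℂ) (by rw [Complex.ofReal_re]; linarith)
    (by rw [Complex.ofReal_re]; linarith) (by rw [Complex.ofReal_im]; nlinarith)
  have hβm := hmem ((-(1 / 2) : ℝ) : ℂ) (by rw [Complex.ofReal_re]; linarith)
    (by rw [Complex.ofReal_re]; linarith) (by rw [Complex.ofReal_im]; nlinarith)
  have hres := hexInt_div_prod_eq (p := p) (q := q) hn hball (α := T - κ) (β := -(1 / 2))
    (by linarith) (by norm_num) (by rw [hpim]; exact hy) (by rw [hqim]; exact hy)
    (hexagon_subset _ (convex_ball _ _) hαm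
      (hmem p (by linarith) hpl.2 (by rw [hpim])) (hmem q (by rw [hqre]; linarith)
      (by rw [hqre]; linarith) (by rw [hqim])) hβm
      (hmem _ (by rw [Complex.conj_re]; linarith) (by rw [Complex.conj_re]; exact hpl.2)
        (by rw [Complex.conj_im, neg_sq, hpim]))
      (hmem _ (by rw [Complex.conj_re, hqre]; linarith)
        (by rw [Complex.conj_re, hqre]; linarith) (by rw [Complex.conj_im, neg_sq, hqim])))
    hαm hβm
  rw [hα, hβ, hp, hq, hexInt_affine] at hres
  have hfun : ∀ l : ℂ, entirePart M ν x (T + κ * l) / (s - (T + κ * l)) /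
      ∏ k ∈ Finset.range n, (T + κ * l - k) = Complex.exp ((T + κ * l) * Real.log x) /
        weight M ν n (T + κ * l) / (κ * (m - l)) := fun l => by
    rw [show s - (T + κ * l) = κ * (m - l) by rw [hs]; ring]
    unfold entirePart weight
    rw [Finset.prod_inv_distrib]
    simp only [div_eq_mul_inv, mul_inv]
    ring
  simp only [hfun] at hres
  rw [show ∀ a b c d : ℂ, a * (b * c * d) = b * c * (a * d) from fun a b c d => by ring, ← hres]
  ring

theorem Kn_edge_eq (hM : 1 ≤ M) (ν : ℕ → ℕ) (hν0 : ν 0 = 0) (hn : 1 ≤ n)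
    (hε : edgeScale M n < 1) {ξ η : ℝ} (hξ : 0 < 1 + ξ / edgeStep M n)
    (hη : 0 < 1 + η / edgeStep M n) :
    ((Real.exp (-(critPoint M n * (ξ / edgeStep M n - η / edgeStep M n))) *
      (Real.exp (logEdge M n) / edgeStep M n) : ℝ) : ℂ) *
      Kn M ν n (Real.exp (logEdge M n) * (1 + ξ / edgeStep M n))
        (Real.exp (logEdge M n) * (1 + η / edgeStep M n)) =
    ((1 + η / edgeStep M n : ℝ) : ℂ)⁻¹ * ((1 / (2 * (Real.pi : ℂ) * Complex.I) ^ 2) *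
      ∫ r : ℝ, ((rightSlope (edgeRadius M n) r : ℂ) + ((√3 / 2 : ℝ) : ℂ) * Complex.I) *
        (edgeWeight M ν n η (rightPath (edgeRadius M n) r) *
          edgeInner M ν n ξ (rightPath (edgeRadius M n) r))) := by
  have hκ := edgeStep_pos hM hn
  have hN := critScale_pos hM hn
  have hT := critPoint_eq M n hM
  have hR := edgeRadius_pos (M := M) hn
  have hn1 : (1 : ℝ) ≤ n := by exact_mod_cast hn
  have hs3 : 0 < √3 := by positivity
  have hw := weight_critPoint_ne_zero hM ν hn
  set T := critPoint M n with hTdef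
  set κ := edgeStep M n with hκdef
  set R := edgeRadius M n with hRdef
  have hlog : ∀ ζ : ℝ, 0 < 1 + ζ / κ → Real.log (Real.exp (logEdge M n) * (1 + ζ / κ)) =
      logEdge M n + Real.log (1 + ζ / κ) := fun ζ hζ => by
    rw [Real.log_mul (Real.exp_ne_zero _) hζ.ne', Real.log_exp]
  set x := Real.exp (logEdge M n) * (1 + ξ / κ) with hx
  set y := Real.exp (logEdge M n) * (1 + η / κ) with hy
  have hy0 : 0 < y := by positivity
  obtain ⟨C, hC⟩ := exists_norm_kernelFun_le hM ν n x y (T + κ * (1 + R / 2))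
  have hshift := integral_line_eq_integral_graph (H := fun s => 2 * Real.pi * Complex.I *
    kernelFun M ν n x y s) (a := fun r => T + κ * (1 + min |r| R / 2))
    (a' := fun r => κ * rightSlope R r) (b := T + κ * (1 + R / 2)) (c := κ * (√3 / 2))
    (C := ‖2 * (Real.pi : ℂ) * Complex.I‖ * C) (L := κ * (1 / 2)) (D := {0, R, -R})
    (by positivity) ((differentiableOn_kernelFun M ν n x y).const_mul _)
    (fun z h1 h2 => by
      rw [norm_mul, mul_assoc ‖2 * (Real.pi : ℂ) * Complex.I‖]
      exact mul_le_mul_of_nonneg_left (hC z h1 h2) (norm_nonneg _))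
    (by fun_prop)
    (fun r => by
      have : 0 ≤ min |r| R := le_min (abs_nonneg _) hR.le
      have : 0 ≤ κ * (1 + min |r| R / 2) := by positivity
      linarith)
    (fun r => by
      have : min |r| R ≤ R := min_le_right _ _
      nlinarith)
    (Set.toFinite _).countable
    (fun r hr => by
      simp only [Set.mem_insert_iff, Set.mem_singleton_iff, not_or] at hr
      refine ((hasDerivAt_min_abs hr.1 fun h => ?_).const_mul κ).const_add T
      rcases (abs_eq hR.le).1 h with h | h
      · exact hr.2.1 h
      · exact hr.2.2 h)
    ((measurable_rightSlope R).const_mul κ)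
    (fun r => by
      rw [abs_mul, abs_of_pos hκ]
      exact mul_le_mul_of_nonneg_left (abs_rightSlope_le R r) hκ.le)
  rw [Kn_eq M ν hν0 hn, hshift]
  have hpt : ∀ r : ℝ, (((κ * rightSlope R r : ℝ) : ℂ) + ((κ * (√3 / 2) : ℝ) : ℂ) * Complex.I) *
      (2 * Real.pi * Complex.I * kernelFun M ν n x y (((T + κ * (1 + min |r| R / 2) : ℝ) : ℂ) +
        ((κ * (√3 / 2) * r : ℝ) : ℂ) * Complex.I)) =
      ((κ / y * Real.exp (T * (ξ / κ - η / κ)) : ℝ) : ℂ) *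
      (((rightSlope R r : ℂ) + ((√3 / 2 : ℝ) : ℂ) * Complex.I) *
        (edgeWeight M ν n η (rightPath R r) * edgeInner M ν n ξ (rightPath R r))) := by
    intro r
    have hs : ((T + κ * (1 + min |r| R / 2) : ℝ) : ℂ) +
        ((κ * (√3 / 2) * r : ℝ) : ℂ) * Complex.I = T + κ * rightPath R r := by
      rw [rightPath]; push_cast; ring
    have hm : 0 < (rightPath R r).re := by
      have h0 : 0 ≤ min |r| R := le_min (abs_nonneg _) hR.le
      have : (rightPath R r).re = 1 + min |r| R / 2 := by simp [rightPath]
      rw [this]; linarith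
    rw [hs, two_pi_I_mul_kernelFun hM ν hn hε x y hm]
    set m := rightPath R r with hmdef
    have hin : ∀ l : ℂ, Complex.exp ((T + κ * l) * Real.log x) /
        weight M ν n (T + κ * l) / (κ * (m - l)) =
        (Complex.exp (T * ((logEdge M n + ξ / κ : ℝ) : ℂ)) / weight M ν n T / κ) *
          ((edgeWeight M ν n ξ l)⁻¹ / (m - l)) := by
      intro l
      rw [edgeWeight_eq, hlog ξ hξ, ← hTdef, ← hκdef]
      simp only [mul_inv, ← Complex.exp_neg, neg_neg, div_eq_mul_inv]
      rw [Complex.exp_neg]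
      have := Complex.exp_ne_zero (T * ((logEdge M n + ξ * κ⁻¹ : ℝ) : ℂ))
      field_simp
    simp only [← hTdef, ← hκdef, hin]
    rw [hexInt_const_mul]
    change _ * (_ * (_ * (_ * edgeInner M ν n ξ m))) = _
    rw [edgeWeight_eq, hlog η hη, ← hTdef, ← hκdef]
    have hκc : (κ : ℂ) ≠ 0 := by exact_mod_cast hκ.ne'
    have hyc : (y : ℂ)⁻¹ = Complex.exp (-((logEdge M n + Real.log (1 + η / κ) : ℝ) : ℂ)) := by
      rw [← hlog η hη, ← Complex.ofReal_neg, ← Complex.ofReal_exp, Real.exp_neg,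
        Real.exp_log hy0, Complex.ofReal_inv]
    have hexp : Complex.exp (-(T + κ * m + 1) * ((logEdge M n + Real.log (1 + η / κ) : ℝ) : ℂ)) *
        Complex.exp (T * ((logEdge M n + ξ / κ : ℝ) : ℂ)) =
        (y : ℂ)⁻¹ * ((Real.exp (T * (ξ / κ - η / κ)) : ℝ) : ℂ) *
          (Complex.exp (-((T + κ * m) * ((logEdge M n + Real.log (1 + η / κ) : ℝ) : ℂ))) *
          Complex.exp (T * ((logEdge M n + η / κ : ℝ) : ℂ))) := by
      rw [hyc, Complex.ofReal_exp, ← Complex.exp_add, ← Complex.exp_add, ← Complex.exp_add,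
        ← Complex.exp_add]
      congr 1
      push_cast
      ring
    generalize Complex.exp (-(T + κ * m + 1) *
      ((logEdge M n + Real.log (1 + η / κ) : ℝ) : ℂ)) = e1 at hexp ⊢
    generalize Complex.exp (T * ((logEdge M n + ξ / κ : ℝ) : ℂ)) = e2 at hexp ⊢
    rw [show ∀ a b c d f g : ℂ, a * (b * (c * e1 * (e2 / d / f * g))) =
      (e1 * e2) * (a * b * c / d / f * g) from fun a b c d f g => by ring, hexp]
    push_cast
    field_simp
  simp only [hpt]
  rw [integral_const_mul]
  have hX : ((Real.exp (-(T * (ξ / κ - η / κ))) * (Real.exp (logEdge M n) / κ) : ℝ) : ℂ) *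
      ((κ / y * Real.exp (T * (ξ / κ - η / κ)) : ℝ) : ℂ) = ((1 + η / κ : ℝ) : ℂ)⁻¹ := by
    rw [← Complex.ofReal_mul, ← Complex.ofReal_inv, hy, Real.exp_neg]
    congr 1
    have := Real.exp_pos (T * (ξ / κ - η / κ))
    have := Real.exp_pos (logEdge M n)
    field_simp
  rw [← hX]
  ring

end

/-! ### Splitting the inner integral into its main part and a negligible remainder -/

theorem integrable_exp_neg_abs : Integrable (fun x : ℝ => Real.exp (-|x|)) := by
  refine (integrable_inv_one_add_sq.const_mul 2).mono'
    (by fun_prop) (Eventually.of_forall fun x => ?_)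
  rw [Real.norm_eq_abs, abs_of_pos (Real.exp_pos _), Real.exp_neg]
  have h := Real.quadratic_le_exp_of_nonneg (abs_nonneg x)
  rw [sq_abs] at h
  rw [show (2 : ℝ) * (1 + x ^ 2)⁻¹ = ((1 + x ^ 2) / 2)⁻¹ by rw [inv_div]; ring]
  exact inv_anti₀ (by positivity) (by nlinarith [abs_nonneg x])

theorem measurable_Gamma : Measurable Complex.Gamma := by
  have h := Complex.differentiable_one_div_Gamma.continuous.measurable.inv
  rwa [show (fun s => (Complex.Gamma s)⁻¹)⁻¹ = Complex.Gamma by ext z; simp] at h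

theorem measurable_weight (M : ℕ) (ν : ℕ → ℕ) (n : ℕ) : Measurable (weight M ν n) := by
  unfold weight
  refine Measurable.mul (Finset.measurable_fun_prod _ fun k _ => by fun_prop)
    (Finset.measurable_fun_prod _ fun j _ => measurable_Gamma.comp (by fun_prop))

theorem measurable_edgeWeight (M : ℕ) (ν : ℕ → ℕ) (n : ℕ) (ξ : ℝ) :
    Measurable (edgeWeight M ν n ξ) := by
  unfold edgeWeight ratio edgeExponent
  refine Measurable.mul (Measurable.mul (Measurable.div_const
    ((measurable_weight M ν n).comp (by fun_prop)) _) (by fun_prop)) (by fun_prop)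

theorem measurable_dlamL : Measurable dlamL := by
  unfold dlamL
  refine Measurable.mul ?_ ?_
  · exact (Complex.measurable_ofReal.comp measurable_sign).neg
  · refine Complex.measurable_exp.comp (Measurable.mul_const (Complex.measurable_ofReal.comp ?_) _)
    exact (measurable_sign.mul_const _).neg

theorem measurable_dmuR : Measurable dmuR := by
  unfold dmuR
  refine Measurable.mul ?_ ?_
  · exact Complex.measurable_ofReal.comp measurable_sign
  · refine Complex.measurable_exp.comp (Measurable.mul_const (Complex.measurable_ofReal.comp ?_) _)
    exact measurable_sign.mul_const _

theorem continuous_lamL : Continuous lamL := by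
  rw [show lamL = _ from funext lamL_eq]
  fun_prop

theorem continuous_muR : Continuous muR := by
  rw [show muR = _ from funext muR_eq]
  fun_prop

theorem continuous_rightPath (R : ℝ) : Continuous (rightPath R) := by
  unfold rightPath
  fun_prop

theorem norm_half_add_le {a : ℝ} (ha : |a| ≤ 1 / 2) :
    ‖(a : ℂ) + ((√3 / 2 : ℝ) : ℂ) * Complex.I‖ ≤ 2 := by
  have s3 : √3 ≤ 2 := Real.sqrt_le_iff.2 ⟨by norm_num, by norm_num⟩
  refine (norm_add_le _ _).trans ?_
  rw [norm_mul, Complex.norm_real, Complex.norm_real, Complex.norm_I, mul_one, Real.norm_eq_abs,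
    Real.norm_eq_abs, abs_of_nonneg (show 0 ≤ √3 / 2 by positivity)]
  linarith

theorem norm_dlamL_le (q : ℝ) : ‖dlamL q‖ ≤ 2 := by
  rcases eq_or_ne q 0 with rfl | hq
  · simp [dlamL]
  · rw [dlamL_eq hq]
    refine norm_half_add_le ?_
    rw [abs_neg, abs_div, abs_two]
    linarith [abs_sign_le_one q]

theorem norm_dmuR_le (q : ℝ) : ‖dmuR q‖ ≤ 2 := by
  rcases eq_or_ne q 0 with rfl | hq
  · simp [dmuR]
  · rw [dmuR_eq hq]
    refine norm_half_add_le ?_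
    rw [abs_div, abs_two]
    linarith [abs_sign_le_one q]

theorem segInt_symm (f : ℂ → ℂ) (a b : ℂ) : segInt f b a = -segInt f a b := by
  unfold segInt
  have := intervalIntegral.integral_comp_sub_left (a := 0) (b := 1)
    (fun u : ℝ => f (a + u * (b - a))) 1
  simp only [sub_self, sub_zero] at this
  rw [← this]
  have h : ∀ u : ℝ, b + u * (a - b) = a + ((1 - u : ℝ) : ℂ) * (b - a) := fun u => by
    push_cast; ring
  simp only [h]
  ring

theorem norm_segInt_le {f : ℂ → ℂ} {a b : ℂ} {C : ℝ} (h : ∀ z ∈ segment ℝ a b, ‖f z‖ ≤ C) :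
    ‖segInt f a b‖ ≤ ‖b - a‖ * C := by
  unfold segInt
  rw [norm_mul]
  refine mul_le_mul_of_nonneg_left ?_ (norm_nonneg _)
  have := intervalIntegral.norm_integral_le_of_norm_le_const (a := 0) (b := 1)
    (f := fun u : ℝ => f (a + u * (b - a))) (C := C) fun u hu =>
      h _ (mem_segment_of_mem_uIcc (Set.uIoc_subset_uIcc hu))
  simpa using this

theorem segInt_lamL (f : ℂ → ℂ) (v : ℝ) :
    segInt f ((-1 : ℝ) : ℂ) (lamL v) = ∫ q in (0 : ℝ)..v, dlamL q * f (lamL q) := by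
  have h := intervalIntegral.smul_integral_comp_mul_left (a := 0) (b := 1)
    (fun q : ℝ => dlamL q * f (lamL q)) v
  rw [mul_zero, mul_one] at h
  rw [← h]
  rcases eq_or_ne v 0 with rfl | hv
  · simp [segInt, lamL_eq]
  have hd : lamL v - ((-1 : ℝ) : ℂ) = v * dlamL v := by
    rw [lamL_eq, dlamL_eq hv]
    rcases lt_or_gt_of_ne hv with h | h
    · rw [abs_of_neg h, Real.sign_of_neg h]; push_cast; ring
    · rw [abs_of_pos h, Real.sign_of_pos h]; push_cast; ring
  have h2 : ∫ u in (0 : ℝ)..1, dlamL (v * u) * f (lamL (v * u)) =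
      ∫ u in (0 : ℝ)..1, dlamL v * f (((-1 : ℝ) : ℂ) + u * (lamL v - ((-1 : ℝ) : ℂ))) := by
    refine intervalIntegral.integral_congr_ae (Eventually.of_forall fun u hu => ?_)
    rw [Set.uIoc_of_le zero_le_one] at hu
    have h3 : dlamL (v * u) = dlamL v := by
      rw [dlamL_eq hv, dlamL_eq (mul_ne_zero hv hu.1.ne')]
      rcases lt_or_gt_of_ne hv with h | h
      · rw [Real.sign_of_neg h, Real.sign_of_neg (mul_neg_of_neg_of_pos h hu.1)]
      · rw [Real.sign_of_pos h, Real.sign_of_pos (mul_pos h hu.1)]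
    have h4 : lamL (v * u) = ((-1 : ℝ) : ℂ) + u * (lamL v - ((-1 : ℝ) : ℂ)) := by
      rw [lamL_eq, lamL_eq, abs_mul, abs_of_pos hu.1]
      push_cast
      ring
    rw [h3, h4]
  rw [h2, intervalIntegral.integral_const_mul, segInt, hd, Complex.real_smul]
  ring

/-- The integrand of the main part of the inner integral. -/
noncomputable def innerIntegrand (M : ℕ) (ν : ℕ → ℕ) (n : ℕ) (ξ : ℝ) (m : ℂ) (q : ℝ) : ℂ :=
  (Set.Ioc (-edgeRadius M n) (edgeRadius M n)).indicator
    (fun q => dlamL q * ((edgeWeight M ν n ξ (lamL q))⁻¹ / (m - lamL q))) q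

theorem measurable_innerIntegrand (M : ℕ) (ν : ℕ → ℕ) (n : ℕ) (ξ : ℝ) (m : ℂ) :
    Measurable (innerIntegrand M ν n ξ m) := by
  unfold innerIntegrand
  refine Measurable.indicator (measurable_dlamL.mul (Measurable.div ?_ ?_)) measurableSet_Ioc
  · exact ((measurable_edgeWeight M ν n ξ).comp continuous_lamL.measurable).inv
  · exact (continuous_const.sub continuous_lamL).measurable

theorem one_le_norm_sub_of_re {m l : ℂ} (hm : 1 ≤ m.re) (hl : l.re ≤ -1) : 1 ≤ ‖m - l‖ := by
  have := (Complex.re_le_norm (m - l))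
  rw [Complex.sub_re] at this
  linarith

theorem lamL_re_le (q : ℝ) : (lamL q).re ≤ -1 := by
  rw [lamL_eq]
  simp
  positivity

theorem exists_norm_innerIntegrand_le {M : ℕ} (hM : 1 ≤ M) (ν : ℕ → ℕ) {H : ℝ} (hH : 0 ≤ H) :
    ∃ C : ℝ, 0 ≤ C ∧ ∀ᶠ n in atTop, ∀ ξ : ℝ, |ξ| ≤ H → ∀ m : ℂ, 1 ≤ m.re → ∀ q : ℝ,
      ‖innerIntegrand M ν n ξ m q‖ ≤ C * Real.exp (-|q|) := by
  obtain ⟨C, hC0, hC⟩ := exists_norm_inv_edgeWeight_lamL_le hM ν hH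
  refine ⟨2 * C, by positivity, ?_⟩
  filter_upwards [hC] with n hn ξ hξ m hm q
  unfold innerIntegrand
  rw [Set.indicator_apply]
  split_ifs with hq
  · rw [norm_mul, norm_div, mul_assoc]
    refine mul_le_mul (norm_dlamL_le q) ?_ (by positivity) (by norm_num)
    refine (div_le_self (norm_nonneg _) (one_le_norm_sub_of_re hm (lamL_re_le q))).trans ?_
    exact hn ξ hξ q (abs_le.2 ⟨hq.1.le, hq.2⟩)
  · simp only [norm_zero]
    positivity

theorem integrable_innerIntegrand {M : ℕ} {ν : ℕ → ℕ} {n : ℕ} {ξ : ℝ} {m : ℂ} {C : ℝ}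
    (h : ∀ q : ℝ, ‖innerIntegrand M ν n ξ m q‖ ≤ C * Real.exp (-|q|)) :
    Integrable (innerIntegrand M ν n ξ m) :=
  (integrable_exp_neg_abs.const_mul C).mono'
    (measurable_innerIntegrand M ν n ξ m).aestronglyMeasurable (Eventually.of_forall h)

theorem edgeInner_eq {M : ℕ} {ν : ℕ → ℕ} {n : ℕ} (hn : 1 ≤ n) {ξ : ℝ} {m : ℂ}
    (hi : Integrable (innerIntegrand M ν n ξ m)) :
    edgeInner M ν n ξ m = (∫ q : ℝ, innerIntegrand M ν n ξ m q) +
      (segInt (fun l => (edgeWeight M ν n ξ l)⁻¹ / (m - l)) (lamL (edgeRadius M n))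
          (edgeCorner M n) +
        segInt (fun l => (edgeWeight M ν n ξ l)⁻¹ / (m - l)) (edgeCorner M n) (edgeLeft M n) +
        segInt (fun l => (edgeWeight M ν n ξ l)⁻¹ / (m - l)) (edgeLeft M n)
          (starRingEnd ℂ (edgeCorner M n)) +
        segInt (fun l => (edgeWeight M ν n ξ l)⁻¹ / (m - l)) (starRingEnd ℂ (edgeCorner M n))
          (starRingEnd ℂ (lamL (edgeRadius M n)))) := by
  have hR := edgeRadius_pos (M := M) hn
  set R := edgeRadius M n with hRdef
  set f : ℂ → ℂ := fun l => (edgeWeight M ν n ξ l)⁻¹ / (m - l) with hf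
  have h1 : segInt f ((-1 : ℝ) : ℂ) (lamL R) + segInt f (starRingEnd ℂ (lamL R)) ((-1 : ℝ) : ℂ) =
      ∫ q : ℝ, innerIntegrand M ν n ξ m q := by
    have hi' : IntegrableOn (fun q => dlamL q * f (lamL q)) (Set.Ioc (-R) R) :=
      (integrable_indicator_iff measurableSet_Ioc).1 hi
    have hii : IntervalIntegrable (fun q => dlamL q * f (lamL q)) volume (-R) R :=
      (intervalIntegrable_iff_integrableOn_Ioc_of_le (by linarith)).2 hi'
    have e1 : ∫ q : ℝ, innerIntegrand M ν n ξ m q = ∫ q in (-R)..R, dlamL q * f (lamL q) := by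
      rw [intervalIntegral.integral_of_le (by linarith), ← integral_indicator measurableSet_Ioc]
      rfl
    rw [segInt_symm f ((-1 : ℝ) : ℂ) (starRingEnd ℂ (lamL R)), ← lamL_neg, segInt_lamL, segInt_lamL,
      e1,
      ← intervalIntegral.integral_add_adjacent_intervals (a := -R) (b := 0) (c := R)
        (hii.mono_set ?_) (hii.mono_set ?_), intervalIntegral.integral_symm 0 (-R)]
    · ring
    · rw [Set.uIcc_of_le (by linarith), Set.uIcc_of_le (by linarith)]
      exact Set.Icc_subset_Icc_right hR.le
    · rw [Set.uIcc_of_le (by linarith), Set.uIcc_of_le (by linarith)]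
      exact Set.Icc_subset_Icc_left (by linarith)
  rw [← h1, edgeInner, hexInt]
  ring

theorem exists_norm_edgeInner_sub_le {M : ℕ} (hM : 1 ≤ M) (ν : ℕ → ℕ) {H : ℝ} (hH : 0 ≤ H) :
    ∃ C : ℝ, 0 ≤ C ∧ ∀ᶠ n in atTop, ∀ ξ : ℝ, |ξ| ≤ H → ∀ m : ℂ, 1 ≤ m.re →
      ‖edgeInner M ν n ξ m - ∫ q : ℝ, innerIntegrand M ν n ξ m q‖ ≤ C * edgeScale M n := by
  obtain ⟨C0, hC00, hC0⟩ := exists_norm_innerIntegrand_le hM ν hH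
  obtain ⟨C1, hC10, hC1⟩ := exists_norm_inv_edgeWeight_far_le hM ν hH (K := 2) (by norm_num)
  obtain ⟨C2, hC20, hC2⟩ := exists_norm_inv_edgeWeight_line_le hM ν hH (K := 2) (by norm_num)
  refine ⟨2 * ((M : ℝ) + 2) * (C1 + C2), by positivity, ?_⟩
  filter_upwards [hC0, hC1, hC2, eventually_edgeScale hM 1] with n h0 h1 h2 h3 ξ hξ m hm
  obtain ⟨hn, hε, hε1, -, hε2, -, hκ1⟩ := h3
  rw [edgeInner_eq hn (integrable_innerIntegrand (h0 ξ hξ m hm)), add_sub_cancel_left]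
  have hR := edgeRadius_pos (M := M) hn
  have hL := edgeStep_mul_edgeLeft hM hn
  have hκ := edgeStep_pos hM hn
  have hN := critScale_pos hM hn
  have hT := critPoint_eq M n hM
  have hn1 : (1 : ℝ) ≤ n := by exact_mod_cast hn
  have s0 : 0 ≤ √3 := Real.sqrt_nonneg _
  have s3 : √3 ≤ 2 := Real.sqrt_le_iff.2 ⟨by norm_num, by norm_num⟩
  set ε := edgeScale M n with hεdef
  set f : ℂ → ℂ := fun l => (edgeWeight M ν n ξ l)⁻¹ / (m - l) with hf
  have hRe : edgeRadius M n = 9 / 10 / ε := rfl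
  have hκε : edgeStep M n = critScale M n * ε := rfl
  have hmono : ∀ x y : ℝ, critPoint M n + edgeStep M n * x ≤ critPoint M n + edgeStep M n * y →
      x ≤ y := fun x y h => le_of_mul_le_mul_left (by linarith) hκ
  have hexp : Real.exp (-(2 / ε)) ≤ ε ^ 2 / 2 := by
    rw [Real.exp_neg]
    have h := Real.quadratic_le_exp_of_nonneg (show 0 ≤ 2 / ε by positivity)
    have h' : 2 / ε ^ 2 ≤ Real.exp (2 / ε) := by
      have e : (2 / ε) ^ 2 / 2 = 2 / ε ^ 2 := by field_simp
      have : 0 ≤ 2 / ε := by positivity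
      linarith
    calc (Real.exp (2 / ε))⁻¹ ≤ (2 / ε ^ 2)⁻¹ := inv_anti₀ (by positivity) h'
      _ = _ := by rw [inv_div]
  -- the geometry of the far part of the contour
  have hpre : (lamL (edgeRadius M n)).re = -1 - 9 / 20 / ε := by
    rw [lamL_eq, abs_of_pos hR, hRe]; simp; ring
  have hpim : (lamL (edgeRadius M n)).im = √3 / 2 * (9 / 10 / ε) := by
    rw [lamL_eq, hRe]; simp
  have hqre : (edgeCorner M n).re = edgeLeft M n := by rw [edgeCorner]; simp
  have hqim : (edgeCorner M n).im = √3 / 2 * (9 / 10 / ε) := by rw [edgeCorner, hRe]; simp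
  have hql : edgeLeft M n ≤ -1 - 9 / 20 / ε := by
    refine hmono _ _ ?_
    rw [hL, hT, hκε]
    have : critScale M n * ε * (9 / 20 / ε) = critScale M n * (9 / 20) := by field_simp
    nlinarith
  have hfar : ∀ z : ℂ, z ∈ segment ℝ (lamL (edgeRadius M n)) (edgeCorner M n) →
      z.im = √3 / 2 * (9 / 10 / ε) ∧ edgeLeft M n ≤ z.re ∧ z.re ≤ -1 - 9 / 20 / ε := by
    intro z hz
    have hS : Convex ℝ {z : ℂ | z.im = √3 / 2 * (9 / 10 / ε) ∧ edgeLeft M n ≤ z.re ∧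
        z.re ≤ -1 - 9 / 20 / ε} :=
      (convex_hyperplane (f := Complex.im) ⟨fun _ _ => rfl, fun _ _ => by simp⟩ _).inter
        ((convex_halfSpace_re_ge _).inter (convex_halfSpace_re_le _))
    exact hS.segment_subset ⟨hpim, by rw [hpre]; exact hql, hpre.le⟩
      ⟨hqim, hqre.ge, by rw [hqre]; exact hql⟩ hz
  have hline : ∀ z : ℂ, z ∈ segment ℝ (edgeCorner M n) (edgeLeft M n : ℂ) →
      z.re = edgeLeft M n ∧ 0 ≤ z.im ∧ z.im ≤ √3 / 2 * (9 / 10 / ε) := by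
    intro z hz
    have hS : Convex ℝ {z : ℂ | z.re = edgeLeft M n ∧ 0 ≤ z.im ∧
        z.im ≤ √3 / 2 * (9 / 10 / ε)} :=
      (convex_hyperplane (f := Complex.re) ⟨fun _ _ => rfl, fun _ _ => by simp⟩ _).inter
        ((convex_halfSpace_im_ge _).inter (convex_halfSpace_im_le _))
    exact hS.segment_subset ⟨hqre, by rw [hqim]; positivity, hqim.le⟩
      ⟨Complex.ofReal_re _, (Complex.ofReal_im _).ge, by rw [Complex.ofReal_im]; positivity⟩ hz
  have hre1 : -1 - 9 / 20 / ε ≤ -1 := by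
    have : 0 ≤ 9 / 20 / ε := by positivity
    linarith
  have fz : ∀ (z : ℂ) (C : ℝ), z.re ≤ -1 → ‖(edgeWeight M ν n ξ z)⁻¹‖ ≤ C * Real.exp (-(2 / ε)) →
      0 ≤ C → ‖f z‖ ≤ C * (ε ^ 2 / 2) := fun z C hz h hC => by
    rw [hf]
    simp only [norm_div]
    exact ((div_le_self (norm_nonneg _) (one_le_norm_sub_of_re hm hz)).trans h).trans
      (mul_le_mul_of_nonneg_left hexp hC)
  have bfar : ∀ z : ℂ, z ∈ segment ℝ (lamL (edgeRadius M n)) (edgeCorner M n) →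
      ‖f z‖ ≤ C1 * (ε ^ 2 / 2) ∧ ‖f (starRingEnd ℂ z)‖ ≤ C1 * (ε ^ 2 / 2) := by
    intro z hz
    obtain ⟨g1, g2, g3⟩ := hfar z hz
    have hb := h1 ξ hξ z g1 g3 (by
      rw [← hL]
      have := mul_le_mul_of_nonneg_left g2 hκ.le
      linarith)
    refine ⟨fz z C1 (g3.trans hre1) hb hC10, fz _ C1 (by rw [Complex.conj_re]; linarith) ?_ hC10⟩
    rw [edgeWeight_conj, ← map_inv₀, RCLike.norm_conj]
    exact hb
  have bline : ∀ z : ℂ, z ∈ segment ℝ (edgeCorner M n) (edgeLeft M n : ℂ) →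
      ‖f z‖ ≤ C2 * (ε ^ 2 / 2) ∧ ‖f (starRingEnd ℂ z)‖ ≤ C2 * (ε ^ 2 / 2) := by
    intro z hz
    obtain ⟨g1, g2, g3⟩ := hline z hz
    have hb := h2 ξ hξ z (by rw [abs_of_nonneg g2]; exact g3) (by rw [g1]; exact hL)
    have hzre : z.re ≤ -1 := by rw [g1]; linarith
    refine ⟨fz z C2 hzre hb hC20, fz _ C2 (by rw [Complex.conj_re]; exact hzre) ?_ hC20⟩
    rw [edgeWeight_conj, ← map_inv₀, RCLike.norm_conj]
    exact hb
  have hconjL : (edgeLeft M n : ℂ) = starRingEnd ℂ (edgeLeft M n : ℂ) :=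
    (Complex.conj_ofReal _).symm
  have hlenfar : ‖edgeCorner M n - lamL (edgeRadius M n)‖ ≤ (M + 2) / ε := by
    have : edgeCorner M n - lamL (edgeRadius M n) =
        ((edgeLeft M n - (-1 - 9 / 20 / ε) : ℝ) : ℂ) := by
      apply Complex.ext
      · rw [Complex.sub_re, hqre, hpre, Complex.ofReal_re]
      · rw [Complex.sub_im, hqim, hpim, Complex.ofReal_im, sub_self]
    rw [this, Complex.norm_real, Real.norm_eq_abs, abs_of_nonpos (by linarith)]
    have h4 : -edgeLeft M n = (M + 1) / ε + 1 / 2 / edgeStep M n := by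
      rw [edgeLeft, critPoint, hκε]
      field_simp
    have h5 : 1 / 2 / edgeStep M n ≤ 1 / 2 := div_le_self (by norm_num) hκ1
    have h6 : (1 : ℝ) / 2 ≤ 1 / ε := by
      rw [div_le_div_iff₀ (by norm_num) hε]; linarith
    have h7 : ((M : ℝ) + 2) / ε = (M + 1) / ε + 1 / ε := by ring
    have h8 : 0 ≤ 9 / 20 / ε := by positivity
    linarith
  have hlenline : ‖(edgeLeft M n : ℂ) - edgeCorner M n‖ ≤ (M + 2) / ε := by
    have : (edgeLeft M n : ℂ) - edgeCorner M n =
        ((-(√3 / 2 * (9 / 10 / ε)) : ℝ) : ℂ) * Complex.I := by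
      rw [edgeCorner, hRe]; push_cast; ring
    rw [this, norm_mul, Complex.norm_real, Complex.norm_I, mul_one, Real.norm_eq_abs, abs_neg,
      abs_of_nonneg (by positivity)]
    have h4 : √3 / 2 * (9 / 10 / ε) ≤ 1 * (1 / ε) := by
      gcongr
      · linarith
      · norm_num
    have h7 : ((M : ℝ) + 2) / ε = (M + 1) / ε + 1 / ε := by ring
    have h8 : 0 ≤ ((M : ℝ) + 1) / ε := by positivity
    linarith
  have e1 := norm_segInt_le fun z hz => (bfar z hz).1
  have e2 := norm_segInt_le fun z hz => (bline z hz).1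
  have e3 : ‖segInt f (edgeLeft M n) (starRingEnd ℂ (edgeCorner M n))‖ ≤
      ‖(edgeLeft M n : ℂ) - edgeCorner M n‖ * (C2 * (ε ^ 2 / 2)) := by
    rw [hconjL, segInt_symm, norm_neg]
    refine (norm_segInt_le (C := C2 * (ε ^ 2 / 2)) fun z hz => ?_).trans_eq ?_
    · have := (bline _ (conj_mem_segment hz)).2
      rwa [Complex.conj_conj] at this
    · rw [← map_sub, RCLike.norm_conj, ← hconjL]
  have e4 : ‖segInt f (starRingEnd ℂ (edgeCorner M n)) (starRingEnd ℂ (lamL (edgeRadius M n)))‖ ≤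
      ‖edgeCorner M n - lamL (edgeRadius M n)‖ * (C1 * (ε ^ 2 / 2)) := by
    rw [segInt_symm, norm_neg]
    refine (norm_segInt_le (C := C1 * (ε ^ 2 / 2)) fun z hz => ?_).trans_eq ?_
    · have := (bfar _ (conj_mem_segment hz)).2
      rwa [Complex.conj_conj] at this
    · rw [← map_sub, RCLike.norm_conj]
  have hf1 : ‖edgeCorner M n - lamL (edgeRadius M n)‖ * (C1 * (ε ^ 2 / 2)) ≤
      (M + 2) / ε * (C1 * (ε ^ 2 / 2)) := mul_le_mul_of_nonneg_right hlenfar (by positivity)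
  have hf2 : ‖(edgeLeft M n : ℂ) - edgeCorner M n‖ * (C2 * (ε ^ 2 / 2)) ≤
      (M + 2) / ε * (C2 * (ε ^ 2 / 2)) := mul_le_mul_of_nonneg_right hlenline (by positivity)
  have htot : (M + 2) / ε * (C1 * (ε ^ 2 / 2)) * 2 + (M + 2) / ε * (C2 * (ε ^ 2 / 2)) * 2 =
      (M + 2) * (C1 + C2) * ε := by
    field_simp
  have h9 : 0 ≤ (M + 2) * (C1 + C2) * ε := by positivity
  refine (norm_add_le _ _).trans ?_
  have h10 := norm_add₃_le (a := segInt f (lamL (edgeRadius M n)) (edgeCorner M n))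
    (b := segInt f (edgeCorner M n) (edgeLeft M n))
    (c := segInt f (edgeLeft M n) (starRingEnd ℂ (edgeCorner M n)))
  linarith

/-! ### The limit of the rescaled kernel -/

theorem tendsto_edgeRadius (M : ℕ) : Tendsto (edgeRadius M) atTop atTop := by
  have h : Tendsto (edgeScale M) atTop (𝓝[>] 0) :=
    tendsto_nhdsWithin_iff.2 ⟨tendsto_edgeScale M,
      (eventually_ge_atTop 1).mono fun n hn => edgeScale_pos M hn⟩
  exact (tendsto_inv_nhdsGT_zero.comp h).const_mul_atTop (show (0 : ℝ) < 9 / 10 by norm_num)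

/-- The Airy factor on the left contour. -/
noncomputable def airyLeft (ξ q : ℝ) : ℂ := (Complex.exp (lamL q ^ 3 / 3 - ξ * lamL q))⁻¹

/-- The Airy factor on the right contour. -/
noncomputable def airyRight (η r : ℝ) : ℂ := Complex.exp (muR r ^ 3 / 3 - η * muR r)

theorem tendsto_innerIntegrand {M : ℕ} (hM : 1 ≤ M) (ν : ℕ → ℕ) (ξ₀ : ℝ) (m : ℂ) (q : ℝ) :
    Tendsto (fun i : ℕ × ℝ => innerIntegrand M ν i.1 i.2 m q) (atTop ×ˢ 𝓝 ξ₀)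
      (𝓝 (dlamL q * (airyLeft ξ₀ q / (m - lamL q)))) := by
  have h1 : Tendsto (fun i : ℕ × ℝ =>
      dlamL q * ((edgeWeight M ν i.1 i.2 (lamL q))⁻¹ / (m - lamL q))) (atTop ×ˢ 𝓝 ξ₀)
      (𝓝 (dlamL q * (airyLeft ξ₀ q / (m - lamL q)))) :=
    (((tendsto_edgeWeight hM ν ξ₀ (lamL q)).inv₀ (Complex.exp_ne_zero _)).div_const _).const_mul _
  refine h1.congr' ?_
  filter_upwards [((tendsto_edgeRadius M).eventually (eventually_gt_atTop |q|)).prod_inl (𝓝 ξ₀)]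
    with i hi
  rw [innerIntegrand, Set.indicator_of_mem]
  exact ⟨(abs_lt.1 hi).1, (abs_lt.1 hi).2.le⟩

theorem eventually_abs_le {ξ₀ : ℝ} : ∀ᶠ i : ℕ × ℝ in atTop ×ˢ 𝓝 ξ₀, |i.2| ≤ |ξ₀| + 1 :=
  Filter.Eventually.prod_inr
    ((continuous_abs.tendsto ξ₀).eventually (eventually_le_nhds (by linarith : |ξ₀| < |ξ₀| + 1))) _

theorem tendsto_integral_innerIntegrand {M : ℕ} (hM : 1 ≤ M) (ν : ℕ → ℕ) (ξ₀ : ℝ) {m : ℂ}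
    (hm : 1 ≤ m.re) :
    Tendsto (fun i : ℕ × ℝ => ∫ q : ℝ, innerIntegrand M ν i.1 i.2 m q) (atTop ×ˢ 𝓝 ξ₀)
      (𝓝 (∫ q : ℝ, dlamL q * (airyLeft ξ₀ q / (m - lamL q)))) := by
  obtain ⟨C, -, hC⟩ := exists_norm_innerIntegrand_le hM ν (show 0 ≤ |ξ₀| + 1 by positivity)
  refine MeasureTheory.tendsto_integral_filter_of_dominated_convergence
    (fun q => C * Real.exp (-|q|)) (Eventually.of_forall fun i =>
      (measurable_innerIntegrand M ν i.1 i.2 m).aestronglyMeasurable) ?_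
    (integrable_exp_neg_abs.const_mul C)
    (Eventually.of_forall fun q => tendsto_innerIntegrand hM ν ξ₀ m q)
  filter_upwards [hC.prod_inl (𝓝 ξ₀), eventually_abs_le] with i h1 h2
  exact Eventually.of_forall fun q => h1 i.2 h2 m hm q

theorem tendsto_edgeInner {M : ℕ} (hM : 1 ≤ M) (ν : ℕ → ℕ) (ξ₀ : ℝ) {m : ℂ} (hm : 1 ≤ m.re) :
    Tendsto (fun i : ℕ × ℝ => edgeInner M ν i.1 i.2 m) (atTop ×ˢ 𝓝 ξ₀)
      (𝓝 (∫ q : ℝ, dlamL q * (airyLeft ξ₀ q / (m - lamL q)))) := by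
  obtain ⟨C, -, hC⟩ := exists_norm_edgeInner_sub_le hM ν (show 0 ≤ |ξ₀| + 1 by positivity)
  have h0 : Tendsto (fun i : ℕ × ℝ => C * edgeScale M i.1) (atTop ×ˢ 𝓝 ξ₀) (𝓝 0) := by
    simpa using ((tendsto_edgeScale M).comp tendsto_fst).const_mul C
  have h1 : Tendsto (fun i : ℕ × ℝ => edgeInner M ν i.1 i.2 m -
      ∫ q : ℝ, innerIntegrand M ν i.1 i.2 m q) (atTop ×ˢ 𝓝 ξ₀) (𝓝 0) := by
    refine squeeze_zero_norm' ?_ h0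
    filter_upwards [hC.prod_inl (𝓝 ξ₀), eventually_abs_le] with i h1 h2 using h1 i.2 h2 m hm
  simpa using h1.add (tendsto_integral_innerIntegrand hM ν ξ₀ hm)

theorem exists_norm_edgeInner_le {M : ℕ} (hM : 1 ≤ M) (ν : ℕ → ℕ) {H : ℝ} (hH : 0 ≤ H) :
    ∃ C : ℝ, 0 ≤ C ∧ ∀ᶠ n in atTop, ∀ ξ : ℝ, |ξ| ≤ H → ∀ m : ℂ, 1 ≤ m.re →
      ‖edgeInner M ν n ξ m‖ ≤ C := by
  obtain ⟨C0, hC00, hC0⟩ := exists_norm_innerIntegrand_le hM ν hH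
  obtain ⟨C1, hC10, hC1⟩ := exists_norm_edgeInner_sub_le hM ν hH
  have hI : 0 ≤ ∫ q : ℝ, Real.exp (-|q|) := integral_nonneg fun q => (Real.exp_pos _).le
  refine ⟨C1 + C0 * ∫ q : ℝ, Real.exp (-|q|), by positivity, ?_⟩
  filter_upwards [hC0, hC1, eventually_edgeScale hM 1] with n h0 h1 h2 ξ hξ m hm
  obtain ⟨-, hε, hε1, -⟩ := h2
  have h3 : ‖∫ q : ℝ, innerIntegrand M ν n ξ m q‖ ≤ C0 * ∫ q : ℝ, Real.exp (-|q|) := by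
    rw [← integral_const_mul]
    exact norm_integral_le_of_norm_le (integrable_exp_neg_abs.const_mul C0)
      (Eventually.of_forall (h0 ξ hξ m hm))
  calc ‖edgeInner M ν n ξ m‖
      = ‖(edgeInner M ν n ξ m - ∫ q : ℝ, innerIntegrand M ν n ξ m q) +
          ∫ q : ℝ, innerIntegrand M ν n ξ m q‖ := by rw [sub_add_cancel]
    _ ≤ C1 * edgeScale M n + C0 * ∫ q : ℝ, Real.exp (-|q|) :=
        (norm_add_le _ _).trans (add_le_add (h1 ξ hξ m hm) h3)
    _ ≤ _ := by nlinarith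

theorem measurable_segInt {g : ℂ → ℂ} (hg : Measurable g) (a b : ℂ) :
    Measurable fun m => segInt (fun l => g l / (m - l)) a b := by
  unfold segInt
  refine Measurable.const_mul ?_ _
  simp only [intervalIntegral.integral_of_le zero_le_one]
  refine (StronglyMeasurable.integral_prod_right (Measurable.stronglyMeasurable ?_)).measurable
  refine Measurable.div (hg.comp ?_) (measurable_fst.sub ?_) <;> fun_prop

theorem measurable_edgeInner (M : ℕ) (ν : ℕ → ℕ) (n : ℕ) (ξ : ℝ) :
    Measurable (edgeInner M ν n ξ) := by
  have h := (measurable_edgeWeight M ν n ξ).inv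
  unfold edgeInner hexInt
  exact (((((measurable_segInt h _ _).add (measurable_segInt h _ _)).add
    (measurable_segInt h _ _)).add (measurable_segInt h _ _)).add
    (measurable_segInt h _ _)).add (measurable_segInt h _ _)

theorem one_le_rightPath_re {R : ℝ} (hR : 0 ≤ R) (r : ℝ) : 1 ≤ (rightPath R r).re := by
  have : 0 ≤ min |r| R := le_min (abs_nonneg r) hR
  simp [rightPath]
  positivity

theorem one_le_muR_re (r : ℝ) : 1 ≤ (muR r).re := by
  simp [muR_eq]
  positivity

/-- The integrand of the outer contour integral in edge coordinates. -/
noncomputable def outerIntegrand (M : ℕ) (ν : ℕ → ℕ) (n : ℕ) (ξ η r : ℝ) : ℂ :=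
  ((rightSlope (edgeRadius M n) r : ℂ) + ((√3 / 2 : ℝ) : ℂ) * Complex.I) *
    (edgeWeight M ν n η (rightPath (edgeRadius M n) r) *
      edgeInner M ν n ξ (rightPath (edgeRadius M n) r))

theorem measurable_outerIntegrand (M : ℕ) (ν : ℕ → ℕ) (n : ℕ) (ξ η : ℝ) :
    Measurable (outerIntegrand M ν n ξ η) := by
  have h := (continuous_rightPath (edgeRadius M n)).measurable
  exact ((Complex.measurable_ofReal.comp (measurable_rightSlope _)).add_const _).mul
    (((measurable_edgeWeight M ν n η).comp h).mul ((measurable_edgeInner M ν n ξ).comp h))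

theorem exists_norm_outerIntegrand_le {M : ℕ} (hM : 1 ≤ M) (ν : ℕ → ℕ) {H : ℝ} (hH : 0 ≤ H) :
    ∃ C : ℝ, 0 ≤ C ∧ ∀ᶠ n in atTop, ∀ ξ η : ℝ, |ξ| ≤ H → |η| ≤ H → ∀ r : ℝ,
      ‖outerIntegrand M ν n ξ η r‖ ≤ C * Real.exp (-|r|) := by
  obtain ⟨C0, hC00, hC0⟩ := exists_norm_edgeWeight_le hM ν hH
  obtain ⟨C1, hC10, hC1⟩ := exists_norm_edgeInner_le hM ν hH
  refine ⟨2 * C0 * C1, by positivity, ?_⟩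
  filter_upwards [hC0, hC1, eventually_ge_atTop 1] with n h0 h1 hn ξ η hξ hη r
  have hR := (edgeRadius_pos (M := M) hn).le
  rw [outerIntegrand, norm_mul, norm_mul]
  calc _ ≤ 2 * ((C0 * Real.exp (-|r|)) * C1) := by
        gcongr
        · exact norm_half_add_le (abs_rightSlope_le _ _)
        · exact h0 η hη r
        · exact h1 ξ hξ _ (one_le_rightPath_re hR r)
    _ = _ := by ring

theorem tendsto_outerIntegrand {M : ℕ} (hM : 1 ≤ M) (ν : ℕ → ℕ) (p : ℝ × ℝ) {r : ℝ}
    (hr : r ≠ 0) :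
    Tendsto (fun i : ℕ × ℝ × ℝ => outerIntegrand M ν i.1 i.2.1 i.2.2 r) (atTop ×ˢ 𝓝 p)
      (𝓝 (dmuR r * (airyRight p.2 r *
        ∫ q : ℝ, dlamL q * (airyLeft p.1 q / (muR r - lamL q))))) := by
  have h1 : Tendsto (fun i : ℕ × ℝ × ℝ => (i.1, i.2.1)) (atTop ×ˢ 𝓝 p) (atTop ×ˢ 𝓝 p.1) :=
    tendsto_fst.prodMk ((continuous_fst.tendsto p).comp tendsto_snd)
  have h2 : Tendsto (fun i : ℕ × ℝ × ℝ => (i.1, i.2.2)) (atTop ×ˢ 𝓝 p) (atTop ×ˢ 𝓝 p.2) :=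
    tendsto_fst.prodMk ((continuous_snd.tendsto p).comp tendsto_snd)
  have h3 := (((tendsto_edgeWeight hM ν p.2 (muR r)).comp h2).mul
    ((tendsto_edgeInner hM ν p.1 (one_le_muR_re r)).comp h1)).const_mul (dmuR r)
  refine h3.congr' ?_
  filter_upwards [((tendsto_edgeRadius M).eventually (eventually_gt_atTop |r|)).prod_inl (𝓝 p)]
    with i hi
  rw [outerIntegrand, rightPath_of_le hi.le, rightSlope, if_pos hi, dmuR_eq hr]
  rfl

theorem tendsto_integral_outerIntegrand {M : ℕ} (hM : 1 ≤ M) (ν : ℕ → ℕ) (p : ℝ × ℝ) :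
    Tendsto (fun i : ℕ × ℝ × ℝ => ∫ r : ℝ, outerIntegrand M ν i.1 i.2.1 i.2.2 r) (atTop ×ˢ 𝓝 p)
      (𝓝 (∫ r : ℝ, dmuR r * (airyRight p.2 r *
        ∫ q : ℝ, dlamL q * (airyLeft p.1 q / (muR r - lamL q))))) := by
  obtain ⟨C, -, hC⟩ := exists_norm_outerIntegrand_le hM ν (show 0 ≤ ‖p‖ + 1 by positivity)
  refine MeasureTheory.tendsto_integral_filter_of_dominated_convergence
    (fun r => C * Real.exp (-|r|)) (Eventually.of_forall fun i =>
      (measurable_outerIntegrand M ν i.1 i.2.1 i.2.2).aestronglyMeasurable) ?_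
    (integrable_exp_neg_abs.const_mul C) ?_
  · have hp : ∀ᶠ i : ℕ × ℝ × ℝ in atTop ×ˢ 𝓝 p, ‖i.2‖ ≤ ‖p‖ + 1 :=
      Filter.Eventually.prod_inr ((continuous_norm.tendsto p).eventually
        (eventually_le_nhds (by linarith : ‖p‖ < ‖p‖ + 1))) _
    filter_upwards [hC.prod_inl (𝓝 p), hp] with i h1 h2
    exact Eventually.of_forall fun r =>
      h1 _ _ ((norm_fst_le i.2).trans h2) ((norm_snd_le i.2).trans h2) r
  · filter_upwards [compl_mem_ae_iff.2 (Real.volume_singleton (a := 0))] with r hr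
    exact tendsto_outerIntegrand hM ν p hr

/-! ### The limit is the Airy kernel -/

theorem tendsto_prodMk_const (ξ : ℝ) : Tendsto (fun n : ℕ => (n, ξ)) atTop (atTop ×ˢ 𝓝 ξ) :=
  tendsto_id.prodMk tendsto_const_nhds

theorem exists_norm_airyRight_le (η : ℝ) :
    ∃ C : ℝ, 0 ≤ C ∧ ∀ r : ℝ, ‖airyRight η r‖ ≤ C * Real.exp (-|r|) := by
  obtain ⟨C, hC0, hC⟩ := exists_norm_edgeWeight_le le_rfl (fun _ => 0) (abs_nonneg η)
  refine ⟨C, hC0, fun r => ?_⟩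
  refine le_of_tendsto ((tendsto_edgeWeight le_rfl (fun _ => 0) η (muR r)).comp
    (tendsto_prodMk_const η)).norm ?_
  filter_upwards [hC, (tendsto_edgeRadius 1).eventually (eventually_ge_atTop |r|)] with n h1 h2
  rw [← rightPath_of_le h2]
  exact h1 η le_rfl r

theorem exists_norm_airyLeft_le (ξ : ℝ) :
    ∃ C : ℝ, 0 ≤ C ∧ ∀ q : ℝ, ‖airyLeft ξ q‖ ≤ C * Real.exp (-|q|) := by
  obtain ⟨C, hC0, hC⟩ := exists_norm_inv_edgeWeight_lamL_le le_rfl (fun _ => 0) (abs_nonneg ξ)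
  refine ⟨C, hC0, fun q => ?_⟩
  refine le_of_tendsto (((tendsto_edgeWeight le_rfl (fun _ => 0) ξ (lamL q)).inv₀
    (Complex.exp_ne_zero _)).comp (tendsto_prodMk_const ξ)).norm ?_
  filter_upwards [hC, (tendsto_edgeRadius 1).eventually (eventually_ge_atTop |q|)] with n h1 h2
  exact h1 ξ le_rfl q h2

theorem measurable_airyLeft (ξ : ℝ) : Measurable (airyLeft ξ) := by
  unfold airyLeft
  have := continuous_lamL
  exact Measurable.inv (by fun_prop)

theorem measurable_airyRight (η : ℝ) : Measurable (airyRight η) := by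
  unfold airyRight
  have := continuous_muR
  fun_prop

/-- The integrand of the double integral defining the Airy kernel. -/
noncomputable def airyIntegrand (ξ η r q : ℝ) : ℂ :=
  dmuR r * airyRight ξ r * (dlamL q * airyLeft η q) / (muR r - lamL q)

theorem integrable_airyIntegrand (ξ η : ℝ) :
    Integrable (Function.uncurry (airyIntegrand ξ η)) (volume.prod volume) := by
  obtain ⟨C, hC0, hC⟩ := exists_norm_airyRight_le ξ
  obtain ⟨D, hD0, hD⟩ := exists_norm_airyLeft_le η
  refine ((integrable_exp_neg_abs.const_mul (2 * C)).mul_prod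
    (integrable_exp_neg_abs.const_mul (2 * D))).mono' (Measurable.aestronglyMeasurable ?_)
    (Eventually.of_forall fun z => ?_)
  · refine Measurable.div (Measurable.mul
      ((measurable_dmuR.mul (measurable_airyRight ξ)).comp measurable_fst)
      ((measurable_dlamL.mul (measurable_airyLeft η)).comp measurable_snd)) ?_
    exact (continuous_muR.measurable.comp measurable_fst).sub
      (continuous_lamL.measurable.comp measurable_snd)
  · simp only [Function.uncurry_def, airyIntegrand]
    rw [norm_div]
    refine (div_le_self (norm_nonneg _)
      (one_le_norm_sub_of_re (one_le_muR_re _) (lamL_re_le _))).trans ?_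
    rw [norm_mul, norm_mul, norm_mul, mul_assoc 2 C, mul_assoc 2 D]
    gcongr
    · exact norm_dmuR_le _
    · exact hC _
    · exact norm_dlamL_le _
    · exact hD _

theorem KAi_eq (ξ η : ℝ) :
    KAi ξ η = (1 / (2 * (Real.pi : ℂ) * Complex.I) ^ 2) * ∫ r : ℝ, ∫ q : ℝ,
      airyIntegrand ξ η r q := by
  rw [KAi]
  congr 1
  refine integral_congr_ae (Eventually.of_forall fun r => ?_)
  simp only
  rw [← integral_const_mul]
  refine integral_congr_ae (Eventually.of_forall fun q => ?_)
  simp only [airyIntegrand, airyRight, airyLeft]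
  rw [← Complex.exp_neg, sub_add (_ - _), sub_eq_add_neg (_ - _) (_ - _), Complex.exp_add]
  ring

theorem muR_neg (q : ℝ) : muR (-q) = -lamL q := by
  rw [muR_eq, lamL_eq, abs_neg]
  push_cast
  ring

theorem dmuR_neg (q : ℝ) : dmuR (-q) = dlamL q := by
  rw [dmuR, dlamL, Real.sign_neg]
  push_cast
  congr 3
  ring

theorem airyIntegrand_neg (ξ η r q : ℝ) :
    airyIntegrand ξ η (-r) (-q) = airyIntegrand η ξ q r := by
  have hl : lamL (-q) = -muR q := by
    rw [← neg_neg (lamL (-q)), ← muR_neg, neg_neg]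
  have hd : dlamL (-q) = dmuR q := by rw [← dmuR_neg, neg_neg]
  simp only [airyIntegrand, airyRight, airyLeft, muR_neg, dmuR_neg, hl, hd, ← Complex.exp_neg]
  rw [show (-lamL r) ^ 3 / 3 - ξ * -lamL r = -(lamL r ^ 3 / 3 - ξ * lamL r) by ring,
    show -((-muR q) ^ 3 / 3 - η * -muR q) = muR q ^ 3 / 3 - η * muR q by ring]
  rw [show -lamL r - -muR q = muR q - lamL r by ring]
  ring

theorem KAi_symm (ξ η : ℝ) : KAi ξ η = KAi η ξ := by
  rw [KAi_eq, KAi_eq, integral_integral_swap (integrable_airyIntegrand η ξ),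
    ← integral_neg_eq_self (fun r => ∫ q : ℝ, airyIntegrand ξ η r q)]
  congr 1
  refine integral_congr_ae (Eventually.of_forall fun r => ?_)
  simp only
  rw [← integral_neg_eq_self]
  simp only [airyIntegrand_neg]

theorem tendsto_edge_Kn {M : ℕ} (hM : 1 ≤ M) (ν : ℕ → ℕ) (hν0 : ν 0 = 0) (p : ℝ × ℝ) :
    Tendsto (fun i : ℕ × ℝ × ℝ =>
      ((Real.exp (-(critPoint M i.1 * (i.2.1 / edgeStep M i.1 - i.2.2 / edgeStep M i.1))) *
        (Real.exp (logEdge M i.1) / edgeStep M i.1) : ℝ) : ℂ) *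
      Kn M ν i.1 (Real.exp (logEdge M i.1) * (1 + i.2.1 / edgeStep M i.1))
        (Real.exp (logEdge M i.1) * (1 + i.2.2 / edgeStep M i.1))) (atTop ×ˢ 𝓝 p)
      (𝓝 (KAi p.1 p.2)) := by
  have hκ : Tendsto (fun i : ℕ × ℝ × ℝ => edgeStep M i.1) (atTop ×ˢ 𝓝 p) atTop :=
    (tendsto_edgeStep hM).comp tendsto_fst
  have h1 : Tendsto (fun i : ℕ × ℝ × ℝ => 1 + i.2.1 / edgeStep M i.1) (atTop ×ˢ 𝓝 p) (𝓝 1) := by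
    simpa using (Tendsto.div_atTop ((continuous_fst.tendsto p).comp tendsto_snd) hκ).const_add 1
  have h2 : Tendsto (fun i : ℕ × ℝ × ℝ => 1 + i.2.2 / edgeStep M i.1) (atTop ×ˢ 𝓝 p) (𝓝 1) := by
    simpa using (Tendsto.div_atTop ((continuous_snd.tendsto p).comp tendsto_snd) hκ).const_add 1
  have h3 : Tendsto (fun i : ℕ × ℝ × ℝ => ((1 + i.2.2 / edgeStep M i.1 : ℝ) : ℂ)⁻¹)
      (atTop ×ˢ 𝓝 p) (𝓝 1) := by
    simpa using ((Complex.continuous_ofReal.tendsto 1).comp h2).inv₀ (by simp)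
  have h4 := h3.mul ((tendsto_integral_outerIntegrand hM ν p).const_mul
    (1 / (2 * (Real.pi : ℂ) * Complex.I) ^ 2))
  have hK : 1 * (1 / (2 * (Real.pi : ℂ) * Complex.I) ^ 2 * ∫ r : ℝ, dmuR r * (airyRight p.2 r *
        ∫ q : ℝ, dlamL q * (airyLeft p.1 q / (muR r - lamL q)))) = KAi p.1 p.2 := by
    rw [KAi_symm, KAi_eq, one_mul]
    congr 1
    refine integral_congr_ae (Eventually.of_forall fun r => ?_)
    simp only
    rw [← mul_assoc, ← integral_const_mul]
    refine integral_congr_ae (Eventually.of_forall fun q => ?_)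
    simp only [airyIntegrand]
    ring
  rw [hK] at h4
  refine h4.congr' ?_
  filter_upwards [h1.eventually (lt_mem_nhds one_pos), h2.eventually (lt_mem_nhds one_pos),
    (eventually_edgeScale hM 1).prod_inl (𝓝 p)] with i hξ hη h
  exact (Kn_edge_eq hM ν hν0 h.1 (by linarith [h.2.2.1]) hξ hη).symm

/-! ### The rescaled kernel in the normalisation of the theorem -/

theorem edgeScale_eq {M n : ℕ} :
    edgeScale M n =
      (2 : ℝ) ^ ((1 : ℝ) / 3) * ((M : ℝ) + 1) ^ ((1 : ℝ) / 3) / (n : ℝ) ^ ((1 : ℝ) / 3) := by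
  rw [edgeScale, Real.div_rpow (by positivity) (by positivity),
    Real.mul_rpow (by positivity) (by positivity)]

theorem critPoint_div_edgeStep {M n : ℕ} (hM : 1 ≤ M) (hn : 1 ≤ n) :
    critPoint M n / edgeStep M n =
      (2 : ℝ) ^ (-(1 : ℝ) / 3) * ((M : ℝ) + 1) ^ ((2 : ℝ) / 3) * (n : ℝ) ^ ((1 : ℝ) / 3) := by
  have hN := (critScale_pos hM hn).ne'
  have hn0 : (0 : ℝ) < n := by exact_mod_cast hn
  have hM1 : (0 : ℝ) < (M : ℝ) + 1 := by positivity
  rw [critPoint, edgeStep, mul_comm ((M : ℝ) + 1), mul_div_mul_left _ _ hN, edgeScale_eq,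
    show -(1 : ℝ) / 3 = -(1 / 3) by norm_num, Real.rpow_neg (by norm_num),
    show (2 : ℝ) / 3 = 1 - 1 / 3 by norm_num, Real.rpow_sub hM1, Real.rpow_one]
  field_simp

theorem exp_logEdge {M n : ℕ} (hM : 1 ≤ M) (hn : 1 ≤ n) :
    Real.exp (logEdge M n) = (n : ℝ) ^ M * (((M : ℝ) + 1) ^ (M + 1) / (M : ℝ) ^ M) := by
  have hN := critScale_pos hM hn
  have hT : 0 < critPoint M n := mul_pos (by positivity) hN
  have hM0 : (0 : ℝ) < M := by exact_mod_cast hM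
  rw [logEdge, Real.exp_sub, Real.exp_log hN, show ((M : ℝ) + 1) * Real.log (critPoint M n) =
    ((M + 1 : ℕ) : ℝ) * Real.log (critPoint M n) by push_cast; rfl, Real.exp_nat_mul,
    Real.exp_log hT, critPoint, mul_pow, pow_succ (critScale M n), mul_div_assoc, mul_div_assoc,
    div_self hN.ne', mul_one, critScale, div_pow]
  ring

theorem edge_const_mul {M n : ℕ} (hM : 1 ≤ M) (hn : 1 ≤ n) :
    ((M : ℝ) + 1) ^ ((M : ℝ) + 2 / 3) / ((2 : ℝ) ^ ((1 : ℝ) / 3) * (M : ℝ) ^ ((M : ℝ) - 1)) *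
      (n : ℝ) ^ (-(2 : ℝ) / 3) =
      ((M : ℝ) + 1) ^ (M + 1) / (M : ℝ) ^ M / edgeStep M n := by
  have hn0 : (0 : ℝ) < n := by exact_mod_cast hn
  have hM0 : (0 : ℝ) < M := by exact_mod_cast hM
  have hM1 : (0 : ℝ) < (M : ℝ) + 1 := by positivity
  rw [show (M : ℝ) + 2 / 3 = ((M + 1 : ℕ) : ℝ) - 1 / 3 by push_cast; ring, Real.rpow_sub hM1,
    Real.rpow_natCast, Real.rpow_sub hM0, Real.rpow_natCast, Real.rpow_one,
    show -(2 : ℝ) / 3 = 1 / 3 - 1 by norm_num, Real.rpow_sub hn0, Real.rpow_one, edgeStep,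
    edgeScale_eq, critScale]
  field_simp

theorem tendstoLocallyUniformly_of_tendsto_prod {ι X Y : Type*} [TopologicalSpace X]
    [PseudoMetricSpace Y] {l : Filter ι} [l.NeBot] {F : ι → X → Y} {f : X → Y}
    (h : ∀ x, Tendsto (fun i : ι × X => F i.1 i.2) (l ×ˢ 𝓝 x) (𝓝 (f x))) :
    TendstoLocallyUniformly F f l := by
  rw [Metric.tendstoLocallyUniformly_iff]
  intro ε hε x
  obtain ⟨s, hs, t, ht, hst⟩ := Filter.eventually_prod_iff.1
    ((h x).eventually (Metric.ball_mem_nhds (f x) (show 0 < ε / 3 by linarith)))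
  refine ⟨{y | t y}, ht, hs.mono fun i hi y hy => ?_⟩
  have h1 : Tendsto (fun j => F j y) l (𝓝 (f y)) :=
    (h y).comp (tendsto_id.prodMk tendsto_const_nhds)
  have h2 : dist (f y) (f x) ≤ ε / 3 := le_of_tendsto (h1.dist tendsto_const_nhds)
    (hs.mono fun j hj => (Metric.mem_ball.1 (hst hj hy)).le)
  have h3 : dist (F i y) (f x) < ε / 3 := hst hi hy
  linarith [dist_triangle_right (f y) (F i y) (f x)]

/-- Soft edge universality for singular values of products of Ginibre matrices. -/
theorem soft_edge_universality_Ginibre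
    (M : ℕ) (hM : 1 ≤ M) (ν : ℕ → ℕ) (hν0 : ν 0 = 0)
    (S : Set (ℝ × ℝ)) (hS : IsCompact S) :
    TendstoUniformlyOn
      (fun (n : ℕ) (p : ℝ × ℝ) =>
        ((Real.exp (-((2 : ℝ) ^ (-(1 : ℝ)/3) * ((M : ℝ) + 1) ^ ((2 : ℝ)/3) *
              (p.1 - p.2) * (n : ℝ) ^ ((1 : ℝ)/3))) *
            ((n : ℝ) ^ ((M : ℝ) - 2/3) *
              (((M : ℝ) + 1) ^ ((M : ℝ) + 2/3) /
                ((2 : ℝ) ^ ((1 : ℝ)/3) * (M : ℝ) ^ ((M : ℝ) - 1)))) : ℝ) : ℂ) *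
          Kn M ν n
            ((n : ℝ) ^ M * (((M : ℝ) + 1) ^ (M + 1) / (M : ℝ) ^ M +
              (((M : ℝ) + 1) ^ ((M : ℝ) + 2/3) /
                ((2 : ℝ) ^ ((1 : ℝ)/3) * (M : ℝ) ^ ((M : ℝ) - 1))) * p.1 *
                (n : ℝ) ^ (-(2 : ℝ)/3)))
            ((n : ℝ) ^ M * (((M : ℝ) + 1) ^ (M + 1) / (M : ℝ) ^ M +
              (((M : ℝ) + 1) ^ ((M : ℝ) + 2/3) /
                ((2 : ℝ) ^ ((1 : ℝ)/3) * (M : ℝ) ^ ((M : ℝ) - 1))) * p.2 *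
                (n : ℝ) ^ (-(2 : ℝ)/3))))
      (fun p => KAi p.1 p.2) atTop S := by
  refine (tendstoLocallyUniformlyOn_iff_tendstoUniformlyOn_of_compact hS).1
    (tendstoLocallyUniformly_of_tendsto_prod fun p => ?_).tendstoLocallyUniformlyOn
  refine (tendsto_edge_Kn hM ν hν0 p).congr' ?_
  filter_upwards [(eventually_ge_atTop 1).prod_inl (𝓝 p)] with ⟨n, ξ, η⟩ hn
  have hκ := (edgeStep_pos hM hn).ne'
  have hn0 : (0 : ℝ) < n := by exact_mod_cast hn
  have hc := edge_const_mul hM hn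
  set c := ((M : ℝ) + 1) ^ ((M : ℝ) + 2 / 3) /
    ((2 : ℝ) ^ ((1 : ℝ) / 3) * (M : ℝ) ^ ((M : ℝ) - 1)) with hcdef
  have harg : ∀ x : ℝ, Real.exp (logEdge M n) * (1 + x / edgeStep M n) =
      (n : ℝ) ^ M * (((M : ℝ) + 1) ^ (M + 1) / (M : ℝ) ^ M + c * x * (n : ℝ) ^ (-(2 : ℝ) / 3)) := by
    intro x
    rw [mul_right_comm, hc, exp_logEdge hM hn]
    ring
  have hexp : critPoint M n * (ξ / edgeStep M n - η / edgeStep M n) =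
      (2 : ℝ) ^ (-(1 : ℝ) / 3) * ((M : ℝ) + 1) ^ ((2 : ℝ) / 3) * (ξ - η) *
        (n : ℝ) ^ ((1 : ℝ) / 3) := by
    rw [mul_right_comm, ← critPoint_div_edgeStep hM hn]
    ring
  have hpre : Real.exp (logEdge M n) / edgeStep M n = (n : ℝ) ^ ((M : ℝ) - 2 / 3) * c := by
    rw [show (M : ℝ) - 2 / 3 = M + -(2 : ℝ) / 3 by ring, Real.rpow_add hn0, Real.rpow_natCast,
      mul_assoc, mul_comm _ c, hc, exp_logEdge hM hn]
    ring
  simp only [harg, hexp, hpre]
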